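/- Assume [H1] and [H2], and let ψ : [0,T_max) → D^{σ,p}(𝕋ⁿ) denote the maximal mild solution of the nonlocal Fokker–Planck equation. Define v₁(t) := ∫₀ᵗ e^{−(t−s)A_p}(F(ψ(s)) − F(ψ(t))) ds for t ∈ [0,T_max). Then v₁(t) ∈ D(A_p) for all t ∈ [0,T_max), and A_p v₁ ∈ C^{ν−ε}_loc([0,T_max), L^p(𝕋ⁿ)) for every ε ∈ (0,ν), where ν := min(1 − σ/2, σ/2 − 1/2 − n/(2p)). -/

import Mathlib

open MeasureTheory ENNReal Set Filter

noncomputable section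

/-- Ambient space `ℝ × ℝ^m`: the universal cover of the torus `𝕋^{m+1}` (so `n = m + 1`). -/
abbrev Spc (m : ℕ) : Type := ℝ × (Fin m → ℝ)

/-- Unit cube in the last `m` coordinates: a fundamental domain for `𝕋^m`. -/
def cube1 (m : ℕ) : Set (Fin m → ℝ) := Set.pi Set.univ fun _ => Set.Ico (0 : ℝ) 1

/-- A fundamental domain for the torus `𝕋^{m+1}`. -/
def cube (m : ℕ) : Set (Spc m) := Set.Ico (0 : ℝ) 1 ×ˢ cube1 m

/-- The measure of the torus: Lebesgue measure restricted to a fundamental domain. -/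
def μT (m : ℕ) : Measure (Spc m) := volume.restrict (cube m)

/-- `ℤ^{m+1}`-periodicity: `f` is a function on the torus `𝕋^{m+1}`. -/
def IsPeriodic {m : ℕ} (f : Spc m → ℝ) : Prop :=
  ∀ (x : Spc m) (k : ℤ) (j : Fin m → ℤ), f (x.1 + k, fun i => x.2 i + j i) = f x

/-- The first coordinate direction. -/
def e1 (m : ℕ) : Spc m := (1, 0)

/-- The remaining coordinate directions. -/
def eC (m : ℕ) (i : Fin m) : Spc m := (0, Pi.single i 1)

/-- Partial derivative in the direction `v`. -/
def pd {m : ℕ} (v : Spc m) (f : Spc m → ℝ) (x : Spc m) : ℝ := fderiv ℝ f x v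

/-- `∇f ⋅ ∇g`. -/
def gradDot {m : ℕ} (f g : Spc m → ℝ) (x : Spc m) : ℝ :=
  pd (e1 m) f x * pd (e1 m) g x + ∑ i, pd (eC m i) f x * pd (eC m i) g x

/-- The Laplacian. -/
def lap {m : ℕ} (f : Spc m → ℝ) (x : Spc m) : ℝ :=
  pd (e1 m) (pd (e1 m) f) x + ∑ i, pd (eC m i) (pd (eC m i) f) x

/-- The marginal `ψ̄(x₁) = ∫_{𝕋^m} ψ(x₁, ⋅)`. -/
def marg {m : ℕ} (ψ : Spc m → ℝ) (x1 : ℝ) : ℝ := ∫ y in cube1 m, ψ (x1, y)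

/-- The nonlocal coefficient `φ_ψ = (∫ ∂_{x₁}V ψ dx₂…dxₙ) / ψ̄`. -/
def phiF {m : ℕ} (V ψ : Spc m → ℝ) (x1 : ℝ) : ℝ :=
  (∫ y in cube1 m, pd (e1 m) V (x1, y) * ψ (x1, y)) / marg ψ x1

/-- `F(ψ) = ∇V⋅∇ψ + ΔV ψ − ∂_{x₁}(φ_ψ ψ)`. -/
def Fop {m : ℕ} (V ψ : Spc m → ℝ) (x : Spc m) : ℝ :=
  gradDot V ψ x + lap V x * ψ x - pd (e1 m) (fun z => phiF V ψ z.1 * ψ z) x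

/-- `L^p`-norm on the torus. -/
def LpN {m : ℕ} (p : ℝ) (f : Spc m → ℝ) : ℝ≥0∞ := eLpNorm f (ENNReal.ofReal p) (μT m)

/-- Gagliardo (Sobolev–Slobodeckij) seminorm of fractional order `s`. -/
def gagl {m : ℕ} {F : Type*} [NormedAddCommGroup F] (s p : ℝ) (f : Spc m → F) : ℝ≥0∞ :=
  (∫⁻ x in cube m, ∫⁻ y in cube m,
      ENNReal.ofReal (‖f x - f y‖ ^ p / ‖x - y‖ ^ ((m : ℝ) + 1 + s * p))) ^ (1 / p)

/-- The differential of `f`. -/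
def grd {m : ℕ} (f : Spc m → ℝ) (x : Spc m) : Spc m →L[ℝ] ℝ := fderiv ℝ f x

/-- The `W^{σ,p}`-norm on the torus, for `0 ≤ σ ≤ 2`. -/
def WNorm {m : ℕ} (σ p : ℝ) (f : Spc m → ℝ) : ℝ≥0∞ :=
  if σ ≤ 0 then LpN p f
  else if σ < 1 then LpN p f + gagl σ p f
  else if σ < 2 then
    LpN p f + eLpNorm (fun x => ‖grd f x‖) (ENNReal.ofReal p) (μT m)
      + (if σ = 1 then 0 else gagl (σ - 1) p (grd f))
  else
    LpN p f + eLpNorm (fun x => ‖grd f x‖) (ENNReal.ofReal p) (μT m)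
      + eLpNorm (fun x => ‖iteratedFDeriv ℝ 2 f x‖) (ENNReal.ofReal p) (μT m)

/-- Membership in `W^{σ,p}(𝕋^{m+1})`, for `0 ≤ σ ≤ 2`. -/
def MemW {m : ℕ} (σ p : ℝ) (f : Spc m → ℝ) : Prop :=
  IsPeriodic f ∧ Measurable f ∧ (1 ≤ σ → Differentiable ℝ f) ∧
    (2 ≤ σ → Differentiable ℝ (grd f)) ∧ WNorm σ p f < ⊤

/-- Membership in `𝒟^{σ,p}(𝕋^{m+1}) = {ψ ∈ W^{σ,p} | ψ̄ > 0}`. -/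
def MemD {m : ℕ} (σ p : ℝ) (f : Spc m → ℝ) : Prop :=
  MemW σ p f ∧ ∀ x1 : ℝ, 0 < marg f x1

/-- Hypothesis `[H₁]`: `ψ₀ ∈ 𝒟^{σ,p}`, `ψ₀ ≥ 0`, `∫ ψ₀ = 1`. -/
def Hyp1 {m : ℕ} (σ p : ℝ) (ψ0 : Spc m → ℝ) : Prop :=
  MemD σ p ψ0 ∧ (∀ x, 0 ≤ ψ0 x) ∧ (∫ x in cube m, ψ0 x) = 1

/-- Hypothesis `[H₂]`: `n = m + 1 ≥ 2`, `p > n`, `σ ∈ (1 + n/p, 2)`. -/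
def Hyp2 (m : ℕ) (σ p : ℝ) : Prop :=
  1 ≤ m ∧ (m : ℝ) + 1 < p ∧ 1 + ((m : ℝ) + 1) / p < σ ∧ σ < 2

/-- The real interval `[0, Tmax)`, where `Tmax ∈ (0, ∞]`. -/
def Ico0 (Tmax : ℝ≥0∞) : Set ℝ := {t : ℝ | 0 ≤ t ∧ ENNReal.ofReal t < Tmax}

/-- The real interval `(0, Tmax)`, where `Tmax ∈ (0, ∞]`. -/
def Ioo0 (Tmax : ℝ≥0∞) : Set ℝ := {t : ℝ | 0 < t ∧ ENNReal.ofReal t < Tmax}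

/-- Continuity in `W^{σ,p}`-norm of a curve, on a time set `s`. -/
def ContW {m : ℕ} (σ p : ℝ) (s : Set ℝ) (ψ : ℝ → Spc m → ℝ) : Prop :=
  ∀ t ∈ s, ∀ ε : ℝ, 0 < ε → ∃ δ > 0, ∀ t' ∈ s, |t' - t| < δ →
    WNorm σ p (fun x => ψ t' x - ψ t x) < ENNReal.ofReal ε

/-- Hölder continuity (exponent `α`) in `W^{σ,p}`-norm of a curve, on a time set `s`. -/
def HolderW {m : ℕ} (α σ p : ℝ) (s : Set ℝ) (ψ : ℝ → Spc m → ℝ) : Prop :=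
  ∃ C : ℝ, ∀ t ∈ s, ∀ t' ∈ s,
    WNorm σ p (fun x => ψ t' x - ψ t x) ≤ ENNReal.ofReal (C * |t' - t| ^ α)

/-- `ψ` is an `L^p`-solution on `[0, Tmax)` of the nonlocal Fokker–Planck equation
`∂ₜψ = div(∇V ψ + β⁻¹∇ψ) − ∂_{x₁}(φ_ψ ψ) = β⁻¹Δψ + F(ψ)`, `ψ(0) = ψ₀`. -/
structure IsLpSolution {m : ℕ} (V : Spc m → ℝ) (β σ p : ℝ) (ψ0 : Spc m → ℝ)
    (Tmax : ℝ≥0∞) (ψ : ℝ → Spc m → ℝ) : Prop where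
  init : ∀ x, ψ 0 x = ψ0 x
  contLp : ContW 0 p (Ico0 Tmax) ψ
  regW2 : ∀ t ∈ Ioo0 Tmax, MemW 2 p (ψ t)
  regD : ∀ t ∈ Ioo0 Tmax, MemD σ p (ψ t)
  eqn : ∀ t ∈ Ioo0 Tmax,
    Tendsto (fun h : ℝ => LpN p
        (fun x => (ψ (t + h) x - ψ t x) / h - (β⁻¹ * lap (ψ t) x + Fop V (ψ t) x)))
      (nhdsWithin 0 {h : ℝ | h ≠ 0}) (nhds 0)
  derivCont : ContW 0 p (Ioo0 Tmax)
    (fun t x => β⁻¹ * lap (ψ t) x + Fop V (ψ t) x)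

/-- A maximal `L^p`-solution: an `L^p`-solution admitting no proper extension. -/
def IsMaximalLpSolution {m : ℕ} (V : Spc m → ℝ) (β σ p : ℝ) (ψ0 : Spc m → ℝ)
    (Tmax : ℝ≥0∞) (ψ : ℝ → Spc m → ℝ) : Prop :=
  IsLpSolution V β σ p ψ0 Tmax ψ ∧ 0 < Tmax ∧
    ∀ (Tmax' : ℝ≥0∞) (ψ' : ℝ → Spc m → ℝ), IsLpSolution V β σ p ψ0 Tmax' ψ' →
      (∀ t ∈ Ico0 Tmax, ψ' t = ψ t) → Tmax' ≤ Tmax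

/-- The Euclidean quadratic form on `Spc m`. -/
def qd {m : ℕ} (z : Spc m) : ℝ := z.1 ^ 2 + ∑ i, z.2 i ^ 2

/-- The heat semigroup `e^{β⁻¹ t Δ}` on the torus, realized by convolution with the Gaussian
heat kernel on the universal cover (and the identity for `t ≤ 0`). -/
def heatSG {m : ℕ} (β t : ℝ) (f : Spc m → ℝ) (x : Spc m) : ℝ :=
  if t ≤ 0 then f x
  else ∫ y : Spc m, (4 * Real.pi * (t / β)) ^ (-((m : ℝ) + 1) / 2) *
      Real.exp (-qd (x - y) / (4 * (t / β))) * f y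

/-- `ψ` is a mild solution of the nonlocal Fokker–Planck equation on `[0, Tmax)`:
`ψ ∈ C([0,Tmax), 𝒟^{σ,p})` and `ψ(t) = e^{β⁻¹tΔ}ψ₀ + ∫₀ᵗ e^{β⁻¹(t−s)Δ} F(ψ(s)) ds`. -/
def IsMildSolution {m : ℕ} (V : Spc m → ℝ) (β σ p : ℝ) (ψ0 : Spc m → ℝ)
    (Tmax : ℝ≥0∞) (ψ : ℝ → Spc m → ℝ) : Prop :=
  (∀ x, ψ 0 x = ψ0 x) ∧ (∀ t ∈ Ico0 Tmax, MemD σ p (ψ t)) ∧ ContW σ p (Ico0 Tmax) ψ ∧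
    ∀ t ∈ Ico0 Tmax, ∀ᵐ x ∂(volume : Measure (Spc m)),
      ψ t x = heatSG β t ψ0 x + ∫ s in Set.Ioc (0 : ℝ) t, heatSG β (t - s) (Fop V (ψ s)) x

/-- A maximal mild solution. -/
def IsMaximalMildSolution {m : ℕ} (V : Spc m → ℝ) (β σ p : ℝ) (ψ0 : Spc m → ℝ)
    (Tmax : ℝ≥0∞) (ψ : ℝ → Spc m → ℝ) : Prop :=
  IsMildSolution V β σ p ψ0 Tmax ψ ∧ 0 < Tmax ∧
    ∀ (Tmax' : ℝ≥0∞) (ψ' : ℝ → Spc m → ℝ), IsMildSolution V β σ p ψ0 Tmax' ψ' →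
      (∀ t ∈ Ico0 Tmax, ψ' t = ψ t) → Tmax' ≤ Tmax

/-- `L^p`-norm on the one-dimensional torus `𝕋`. -/
def LpN1 (p : ℝ) (g : ℝ → ℝ) : ℝ≥0∞ :=
  eLpNorm g (ENNReal.ofReal p) (volume.restrict (Set.Ico (0 : ℝ) 1))

/-- Membership in `L^p₀(𝕋^{m+1})`: periodic, `L^p` and of mean zero. -/
def MemL0 {m : ℕ} (p : ℝ) (f : Spc m → ℝ) : Prop :=
  IsPeriodic f ∧ Measurable f ∧ LpN p f < ⊤ ∧ (∫ x in cube m, f x) = 0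

/-- `v₁(t) = ∫₀ᵗ e^{−(t−s)A_p} (F(ψ(s)) − F(ψ(t))) ds`. -/
def v1 {m : ℕ} (V : Spc m → ℝ) (β : ℝ) (ψ : ℝ → Spc m → ℝ) (t : ℝ) (x : Spc m) : ℝ :=
  ∫ s in Set.Ioc (0 : ℝ) t,
    heatSG β (t - s) (fun y => Fop V (ψ s) y - Fop V (ψ t) y) x


/-- Gaussian kernel. -/
def gk {m : ℕ} (a : ℝ) (z : Spc m) : ℝ :=
  (4 * Real.pi * a) ^ (-((m : ℝ) + 1) / 2) * Real.exp (-qd z / (4 * a))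

/-- Euclidean bilinear form. -/
def bl (m : ℕ) : Spc m →L[ℝ] (Spc m →L[ℝ] ℝ) :=
  (ContinuousLinearMap.fst ℝ ℝ (Fin m → ℝ)).smulRight (ContinuousLinearMap.fst ℝ ℝ (Fin m → ℝ)) +
  ∑ i, ((ContinuousLinearMap.proj i).comp (ContinuousLinearMap.snd ℝ ℝ (Fin m → ℝ))).smulRight
    ((ContinuousLinearMap.proj i).comp (ContinuousLinearMap.snd ℝ ℝ (Fin m → ℝ)))

lemma bl_apply {m : ℕ} (z w : Spc m) : bl m z w = z.1 * w.1 + ∑ i, z.2 i * w.2 i := by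
  simp [bl]

lemma qd_nonneg {m : ℕ} (z : Spc m) : 0 ≤ qd z := by
  unfold qd; positivity

lemma norm_sq_le_qd {m : ℕ} (z : Spc m) : ‖z‖ ^ 2 ≤ qd z := by
  have h : ‖z‖ ≤ Real.sqrt (qd z) := by
    rw [Prod.norm_def]
    apply max_le
    · apply Real.le_sqrt_of_sq_le
      rw [Real.norm_eq_abs, sq_abs]; unfold qd
      have : 0 ≤ ∑ i, z.2 i ^ 2 := by positivity
      linarith
    · rw [pi_norm_le_iff_of_nonneg (Real.sqrt_nonneg _)]
      intro i
      apply Real.le_sqrt_of_sq_le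
      rw [Real.norm_eq_abs, sq_abs]; unfold qd
      have : z.2 i ^ 2 ≤ ∑ i, z.2 i ^ 2 :=
        Finset.single_le_sum (f := fun i => z.2 i ^ 2) (fun _ _ => sq_nonneg _) (Finset.mem_univ i)
      nlinarith [sq_nonneg z.1]
  calc ‖z‖ ^ 2 ≤ Real.sqrt (qd z) ^ 2 := by gcongr
    _ = qd z := Real.sq_sqrt (qd_nonneg z)

lemma abs_bl_le {m : ℕ} (z w : Spc m) : |bl m z w| ≤ ((m : ℝ) + 1) * ‖z‖ * ‖w‖ := by
  rw [bl_apply]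
  have h1 : ∀ z : Spc m, |z.1| ≤ ‖z‖ := fun z => by
    rw [Prod.norm_def]; exact le_max_left _ _
  have h2 : ∀ (z : Spc m) i, |z.2 i| ≤ ‖z‖ := fun z i => by
    rw [Prod.norm_def]; exact (norm_le_pi_norm z.2 i).trans (le_max_right _ _)
  calc |z.1 * w.1 + ∑ i, z.2 i * w.2 i| ≤ |z.1 * w.1| + |∑ i, z.2 i * w.2 i| := abs_add_le _ _
    _ ≤ |z.1 * w.1| + ∑ i, |z.2 i * w.2 i| := by
        gcongr; exact Finset.abs_sum_le_sum_abs _ _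
    _ ≤ ‖z‖ * ‖w‖ + ∑ i : Fin m, ‖z‖ * ‖w‖ := by
        gcongr with i
        · rw [abs_mul]; gcongr <;> apply h1
        · rw [abs_mul]; gcongr <;> apply h2
    _ = _ := by simp; ring

lemma norm_bl_apply_le {m : ℕ} (z : Spc m) : ‖bl m z‖ ≤ ((m : ℝ) + 1) * ‖z‖ :=
  ContinuousLinearMap.opNorm_le_bound _ (by positivity) fun w => by
    rw [Real.norm_eq_abs]; exact abs_bl_le z w

lemma norm_bl_le {m : ℕ} : ‖bl m‖ ≤ ((m : ℝ) + 1) :=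
  ContinuousLinearMap.opNorm_le_bound _ (by positivity) fun w => norm_bl_apply_le w

lemma norm_bl_apply_le' {m : ℕ} (z : Spc m) {s : ℝ} (hs : 0 < s) :
    ‖bl m z‖ ≤ ((m : ℝ) + 1) * (Real.sqrt s * (1 + qd z / s)) := by
  refine (norm_bl_apply_le z).trans ?_
  gcongr
  have h1 := norm_sq_le_qd z
  have hq := qd_nonneg z
  have h2 : ‖z‖ ≤ Real.sqrt (qd z) := Real.le_sqrt_of_sq_le h1
  have h3 : Real.sqrt (qd z) = Real.sqrt s * Real.sqrt (qd z / s) := by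
    rw [← Real.sqrt_mul hs.le]; congr 1; field_simp
  rw [h3] at h2
  refine h2.trans ?_
  gcongr
  rw [Real.sqrt_le_left (by positivity)]
  have : 0 ≤ qd z / s := by positivity
  nlinarith

lemma hasFDerivAt_qd {m : ℕ} (z : Spc m) : HasFDerivAt (qd (m := m)) ((2 : ℝ) • bl m z) z := by
  have h : qd (m := m) = fun z => bl m z z := by
    funext z; rw [bl_apply]; simp [qd, sq]
  rw [h]
  have := (bl m).hasFDerivAt (x := z)
  have h2 := HasFDerivAt.clm_apply this (hasFDerivAt_id (𝕜 := ℝ) z)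
  refine h2.congr_fderiv (ContinuousLinearMap.ext fun w => ?_)
  simp [bl_apply, two_mul, mul_comm]

lemma continuous_qd {m : ℕ} : Continuous (qd (m := m)) := by
  unfold qd; fun_prop

lemma gk_nonneg {m : ℕ} {a : ℝ} (ha : 0 < a) (z : Spc m) : 0 ≤ gk a z := by
  unfold gk; positivity

lemma continuous_gk {m : ℕ} (a : ℝ) : Continuous (gk (m := m) a) := by
  unfold gk
  have := continuous_qd (m := m)
  fun_prop

lemma gk_eq_prod {m : ℕ} {a : ℝ} (z : Spc m) :
    Real.exp (-qd z / (4 * a)) = Real.exp (-(1 / (4 * a)) * z.1 ^ 2) *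
      ∏ i, Real.exp (-(1 / (4 * a)) * z.2 i ^ 2) := by
  rw [← Real.exp_sum, ← Real.exp_add, ← Finset.mul_sum]
  congr 1; unfold qd; ring

lemma integrable_gk {m : ℕ} {a : ℝ} (ha : 0 < a) : Integrable (gk (m := m) a) := by
  unfold gk
  apply Integrable.const_mul
  simp_rw [gk_eq_prod]
  have h := integrable_exp_neg_mul_sq (b := 1 / (4 * a)) (by positivity)
  exact Integrable.mul_prod h (Integrable.fintype_prod (fun _ : Fin m => h))

lemma integral_gk {m : ℕ} {a : ℝ} (ha : 0 < a) : ∫ z, gk (m := m) a z = 1 := by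
  unfold gk
  rw [integral_const_mul]
  simp_rw [gk_eq_prod]
  have e := integral_prod_mul (μ := (volume : Measure ℝ)) (ν := (volume : Measure (Fin m → ℝ)))
    (fun x => Real.exp (-(1 / (4 * a)) * x ^ 2))
    (fun y => ∏ i, Real.exp (-(1 / (4 * a)) * y i ^ 2))
  rw [← Measure.volume_eq_prod] at e
  rw [e, integral_fintype_prod_volume_eq_pow (fun x : ℝ => Real.exp (-(1 / (4 * a)) * x ^ 2)),
    integral_gaussian]
  have : Real.pi / (1 / (4 * a)) = 4 * Real.pi * a := by field_simp
  rw [this, Fintype.card_fin, ← pow_succ', Real.sqrt_eq_rpow, ← Real.rpow_natCast,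
    ← Real.rpow_mul (by positivity), ← Real.rpow_add (by positivity)]
  convert Real.rpow_zero _ using 2
  push_cast; ring

/-- first derivative of the kernel -/
def gk1 {m : ℕ} (a : ℝ) (z : Spc m) : Spc m →L[ℝ] ℝ := (-(gk a z / (2 * a))) • bl m z

/-- second derivative of the kernel -/
def gk2 {m : ℕ} (a : ℝ) (z : Spc m) : Spc m →L[ℝ] (Spc m →L[ℝ] ℝ) :=
  (gk a z / (4 * a ^ 2)) • (bl m z).smulRight (bl m z) - (gk a z / (2 * a)) • bl m

lemma hasFDerivAt_gk {m : ℕ} {a : ℝ} (ha : 0 < a) (z : Spc m) :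
    HasFDerivAt (gk a) (gk1 a z) z := by
  have h := (((hasFDerivAt_qd z).const_mul (-(1 / (4 * a)))).exp).const_mul
    ((4 * Real.pi * a) ^ (-((m : ℝ) + 1) / 2))
  have e : gk (m := m) a = fun z => (4 * Real.pi * a) ^ (-((m : ℝ) + 1) / 2) *
    Real.exp (-(1 / (4 * a)) * qd z) := by
    funext z; unfold gk; congr 2; ring
  rw [gk1, e]
  refine h.congr_fderiv (ContinuousLinearMap.ext fun w => ?_)
  simp
  field_simp
  ring

lemma hasFDerivAt_gk1 {m : ℕ} {a : ℝ} (ha : 0 < a) (z : Spc m) :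
    HasFDerivAt (gk1 a) (gk2 a z) z := by
  have h1 : HasFDerivAt (fun z : Spc m => -(gk a z / (2 * a))) ((-(1 / (2 * a))) • gk1 a z) z := by
    have := (hasFDerivAt_gk ha z).const_mul (-(1 / (2 * a)))
    refine this.congr_of_eventuallyEq (Eventually.of_forall fun w => ?_)
    simp only; ring
  have h2 := HasFDerivAt.smul h1 ((bl m).hasFDerivAt (x := z))
  refine h2.congr_fderiv (ContinuousLinearMap.ext fun v => ContinuousLinearMap.ext fun w => ?_)
  simp [gk2, gk1]
  field_simp
  ring

lemma continuous_gk1 {m : ℕ} (a : ℝ) : Continuous (gk1 (m := m) a) := by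
  unfold gk1
  have := continuous_gk (m := m) a
  fun_prop

lemma cont_sub_gen {X E : Type*} [TopologicalSpace X] [NormedAddCommGroup E] [NormedSpace ℝ E]
    {c d : X → ℝ} {h : X → E} (hc : Continuous c) (hd : Continuous d) (hh : Continuous h) (b : E) :
    Continuous fun x => c x • h x - d x • b := (hc.smul hh).sub (hd.smul continuous_const)

lemma cont_aux {X : Type*} [NormedAddCommGroup X] [NormedSpace ℝ X] (b : X →L[ℝ] X →L[ℝ] ℝ)
    {c d : X → ℝ} (hc : Continuous c) (hd : Continuous d) :
    Continuous fun z => c z • (b z).smulRight (b z) - d z • b := by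
  have h : Continuous fun z : X => (b z).smulRight (b z) := by
    have : ∀ z : X, (b z).smulRight (b z) =
      ContinuousLinearMap.smulRightL ℝ X (X →L[ℝ] ℝ) (b z) (b z) := fun z => rfl
    simp_rw [this]
    fun_prop
  exact cont_sub_gen (E := X →L[ℝ] X →L[ℝ] ℝ) hc hd h b

lemma continuous_gk2 {m : ℕ} (a : ℝ) : Continuous (gk2 (m := m) a) :=
  cont_aux (bl m) ((continuous_gk a).div_const _) ((continuous_gk a).div_const _)

lemma cube_exp_bound (x : ℝ) (hx : 0 ≤ x) : Real.exp (-x / 4) * (1 + x) ^ 3 ≤ 20000 * Real.exp (-x / 8) := by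
  have h1 : Real.exp (-x / 4) = Real.exp (-x / 8) * Real.exp (-x / 8) := by
    rw [← Real.exp_add]; congr 1; ring
  have h2 : (1 + x) ^ 3 ≤ 20000 * Real.exp (x / 8) := by
    have h3 := Real.pow_div_factorial_le_exp (x / 8) (by positivity) 3
    have h5 : (1 + x) ^ 3 ≤ 4 * (1 + x ^ 3) := by nlinarith [mul_nonneg (add_nonneg hx zero_le_one) (sq_nonneg (x - 1))]
    norm_num [Nat.factorial] at h3
    have h6 : x ^ 3 ≤ 3072 * Real.exp (x / 8) := by
      have : x ^ 3 = 3072 * ((x / 8) ^ 3 / 6) := by ring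
      rw [this]; gcongr
    have h7 : 1 ≤ Real.exp (x / 8) := Real.one_le_exp (by positivity)
    nlinarith
  have h8 : Real.exp (-x / 8) * Real.exp (x / 8) = 1 := by
    rw [← Real.exp_add]; simp; ring
  calc Real.exp (-x / 4) * (1 + x) ^ 3 ≤ Real.exp (-x / 4) * (20000 * Real.exp (x / 8)) := by gcongr
    _ = 20000 * Real.exp (-x / 8) * (Real.exp (-x / 8) * Real.exp (x / 8)) := by rw [h1]; ring
    _ = _ := by rw [h8, mul_one]

lemma gk_poly {m : ℕ} : ∃ C : ℝ, 0 ≤ C ∧ ∀ a : ℝ, 0 < a → ∀ s ∈ Icc a (2 * a), ∀ z : Spc m,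
    gk s z * (1 + qd z / s) ^ 3 ≤ C * gk (4 * a) z := by
  refine ⟨4 ^ (((m : ℝ) + 1) / 2) * 20000, by positivity, fun a ha s hs z => ?_⟩
  have hs0 : 0 < s := ha.trans_le hs.1
  have hq := qd_nonneg z
  have h1 := cube_exp_bound (qd z / s) (by positivity)
  have h2 : Real.exp (-(qd z / s) / 8) ≤ Real.exp (-qd z / (4 * (4 * a))) := by
    apply Real.exp_le_exp.2
    have : qd z / (16 * a) ≤ qd z / (8 * s) := by
      apply div_le_div_of_nonneg_left hq (by positivity); linarith [hs.2]
    have e1 : -(qd z / s) / 8 = -(qd z / (8 * s)) := by field_simp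
    have e2 : -qd z / (4 * (4 * a)) = - (qd z / (16 * a)) := by field_simp; ring
    rw [e1, e2]; linarith
  have h3 : (4 * Real.pi * s) ^ (-((m : ℝ) + 1) / 2) ≤
      4 ^ (((m : ℝ) + 1) / 2) * (4 * Real.pi * (4 * a)) ^ (-((m : ℝ) + 1) / 2) := by
    have e : (4 : ℝ) * Real.pi * (4 * a) = 4 * (4 * Real.pi * a) := by ring
    rw [e, Real.mul_rpow (x := 4) (y := 4 * Real.pi * a) (by norm_num) (by positivity), ← mul_assoc, ← Real.rpow_add (by norm_num : (0:ℝ) < 4)]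
    have : ((m : ℝ) + 1) / 2 + -((m : ℝ) + 1) / 2 = 0 := by ring
    rw [this, Real.rpow_zero, one_mul]
    apply Real.rpow_le_rpow_of_nonpos (by positivity)
    · nlinarith [hs.1, Real.pi_pos]
    · have : (0 : ℝ) ≤ m := by positivity
      linarith
  unfold gk
  have e3 : -qd z / (4 * s) = -(qd z / s) / 4 := by field_simp
  rw [e3]
  calc _ = (4 * Real.pi * s) ^ (-((m : ℝ) + 1) / 2) *
        (Real.exp (-(qd z / s) / 4) * (1 + qd z / s) ^ 3) := by ring
    _ ≤ (4 ^ (((m : ℝ) + 1) / 2) * (4 * Real.pi * (4 * a)) ^ (-((m : ℝ) + 1) / 2)) *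
        (20000 * Real.exp (-qd z / (4 * (4 * a)))) := by
        refine mul_le_mul h3 (h1.trans (by gcongr)) (by positivity) (by positivity)
    _ = _ := by ring

/-- integrated kernel bounds of parabolic order `j` -/
structure KFam {m : ℕ} {E : Type*} [NormedAddCommGroup E] (k : ℝ → Spc m → E) (j C : ℝ) : Prop where
  meas : StronglyMeasurable (fun q : ℝ × Spc m => k q.1 q.2)
  int : ∀ τ, 0 < τ → Integrable (k τ)
  bd : ∀ τ, 0 < τ → ∫ z, ‖k τ z‖ ≤ C * τ ^ (-j)
  diff : ∀ τ, 0 < τ → ∀ h, 0 ≤ h → ∀ θ, 0 ≤ θ → θ ≤ 1 →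
    ∫ z, ‖k (τ + h) z - k τ z‖ ≤ C * (h ^ θ * τ ^ (-j - θ))
  dom : ∀ τ, 0 < τ → ∃ D a : ℝ, 0 ≤ D ∧ 0 < a ∧ ∀ z, ‖k τ z‖ ≤ D * gk a z

lemma KFam.scale {m : ℕ} {E : Type*} [NormedAddCommGroup E] {k : ℝ → Spc m → E} {j C : ℝ}
    (hk : KFam k j C) (hC : 0 ≤ C) {β : ℝ} (hβ : 0 < β) :
    ∃ C', 0 ≤ C' ∧ KFam (fun τ => k (τ / β)) j C' := by
  refine ⟨C * β ^ j, by positivity, ?_, ?_, ?_, ?_, fun τ hτ => hk.dom _ (by positivity)⟩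
  · exact hk.meas.comp_measurable (g := fun q : ℝ × Spc m => (q.1 / β, q.2)) (by fun_prop)
  · intro τ hτ; exact hk.int _ (by positivity)
  · intro τ hτ
    refine (hk.bd _ (by positivity)).trans (le_of_eq ?_)
    rw [Real.div_rpow hτ.le hβ.le, Real.rpow_neg hβ.le]
    field_simp
  · intro τ hτ h hh θ h0 h1
    have := hk.diff (τ / β) (by positivity) (h / β) (by positivity) θ h0 h1
    rw [← add_div] at this
    refine this.trans (le_of_eq ?_)
    rw [Real.div_rpow hτ.le hβ.le, Real.div_rpow hh hβ.le]
    have : β ^ θ * β ^ (-j - θ) * β ^ j = 1 := by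
      rw [← Real.rpow_add hβ, ← Real.rpow_add hβ]
      convert Real.rpow_zero _ using 2; ring
    have p1 := Real.rpow_pos_of_pos hβ θ
    have p2 := Real.rpow_pos_of_pos hβ (-j - θ)
    have e4 : C * (h ^ θ / β ^ θ * (τ ^ (-j - θ) / β ^ (-j - θ))) =
      C * h ^ θ * τ ^ (-j - θ) / (β ^ θ * β ^ (-j - θ)) := by field_simp
    rw [e4, div_eq_iff (by positivity)]
    linear_combination (-C * h ^ θ * τ ^ (-j - θ)) * this

lemma KFam.of_pointwise {m : ℕ} {E : Type*} [NormedAddCommGroup E] [NormedSpace ℝ E]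
    {k kd : ℝ → Spc m → E} {j C : ℝ} (hC : 0 ≤ C) (hj : 0 ≤ j)
    (hm : StronglyMeasurable (fun q : ℝ × Spc m => k q.1 q.2))
    (hd : ∀ s, 0 < s → ∀ z, HasDerivAt (fun s => k s z) (kd s z) s)
    (hb : ∀ s, 0 < s → ∀ z, ‖k s z‖ ≤ C * s ^ (-j) * (gk s z * (1 + qd z / s) ^ 3))
    (hb' : ∀ s, 0 < s → ∀ z, ‖kd s z‖ ≤ C * s ^ (-j - 1) * (gk s z * (1 + qd z / s) ^ 3)) :
    ∃ C', 0 ≤ C' ∧ KFam k j C' := by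
  obtain ⟨G, hG, hgk⟩ := gk_poly (m := m)
  have key : ∀ a, 0 < a → ∀ z, ‖k a z‖ ≤ C * G * a ^ (-j) * gk (4 * a) z := by
    intro a ha z
    calc _ ≤ _ := hb a ha z
      _ ≤ C * a ^ (-j) * (G * gk (4 * a) z) := by
        exact mul_le_mul_of_nonneg_left (hgk a ha a ⟨le_rfl, by linarith⟩ z) (by positivity)
      _ = _ := by ring
  have km : ∀ a, StronglyMeasurable (k a) := fun a =>
    hm.comp_measurable (g := fun z : Spc m => (a, z)) (by fun_prop)
  have kint : ∀ τ, 0 < τ → Integrable (k τ) := fun τ hτ =>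
    Integrable.mono' ((integrable_gk (by positivity : 0 < 4 * τ)).const_mul (C * G * τ ^ (-j)))
      (km τ).aestronglyMeasurable (Eventually.of_forall fun z => key τ hτ z)
  have kbd : ∀ τ, 0 < τ → ∫ z, ‖k τ z‖ ≤ C * G * τ ^ (-j) := by
    intro τ hτ
    calc _ ≤ ∫ z, C * G * τ ^ (-j) * gk (4 * τ) z := by
          apply integral_mono_of_nonneg (Eventually.of_forall fun z => norm_nonneg _)
            ((integrable_gk (by positivity)).const_mul _) (Eventually.of_forall fun z => key τ hτ z)
      _ = _ := by rw [integral_const_mul, integral_gk (by positivity), mul_one]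
  refine ⟨2 * (C * G), by positivity, hm, kint, ?_, ?_,
    fun τ hτ => ⟨C * G * τ ^ (-j), 4 * τ, by positivity, by positivity, key τ hτ⟩⟩
  · intro τ hτ
    have : 0 ≤ C * G * τ ^ (-j) := by positivity
    linarith [kbd τ hτ]
  · intro τ hτ h hh θ h0 h1
    rcases le_total h τ with hle | hle
    · have pw : ∀ z, ‖k (τ + h) z - k τ z‖ ≤ C * G * (τ ^ (-j - 1) * h) * gk (4 * τ) z := by
        intro z
        have := (convex_Icc τ (2 * τ)).norm_image_sub_le_of_norm_hasDerivWithin_le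
          (f := fun s => k s z) (f' := fun s => kd s z)
          (C := C * τ ^ (-j - 1) * (G * gk (4 * τ) z)) (x := τ) (y := τ + h)
          (fun x hx => (hd x (hτ.trans_le hx.1) z).hasDerivWithinAt)
          (fun x hx => (hb' x (hτ.trans_le hx.1) z).trans ?_) ⟨le_rfl, by linarith⟩
          ⟨by linarith, by linarith⟩
        · refine this.trans (le_of_eq ?_)
          rw [add_sub_cancel_left, Real.norm_of_nonneg hh]; ring
        · have g1 := hgk τ hτ x hx z
          have g2 : x ^ (-j - 1) ≤ τ ^ (-j - 1) :=
            Real.rpow_le_rpow_of_nonpos hτ hx.1 (by linarith)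
          have hx0 : 0 < x := hτ.trans_le hx.1
          have := gk_nonneg hx0 z
          have := qd_nonneg z
          exact mul_le_mul (mul_le_mul_of_nonneg_left g2 hC) g1 (by positivity) (by positivity)
      calc _ ≤ ∫ z, C * G * (τ ^ (-j - 1) * h) * gk (4 * τ) z := by
            apply integral_mono_of_nonneg (Eventually.of_forall fun z => norm_nonneg _)
              ((integrable_gk (by positivity)).const_mul _) (Eventually.of_forall pw)
        _ = C * G * (τ ^ (-j - 1) * h) := by
            rw [integral_const_mul, integral_gk (by positivity), mul_one]
        _ ≤ C * G * (h ^ θ * τ ^ (-j - θ)) := by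
            refine mul_le_mul_of_nonneg_left ?_ (by positivity)
            rcases hh.eq_or_lt with rfl | hpos
            · rw [mul_zero]; positivity
            have e1 : h = h ^ θ * h ^ (1 - θ) := by
              rw [← Real.rpow_add hpos]; simp
            have e2 : τ ^ (-j - θ) = τ ^ (-j - 1) * τ ^ (1 - θ) := by
              rw [← Real.rpow_add hτ]; congr 1; ring
            have e3 : h ^ (1 - θ) ≤ τ ^ (1 - θ) := Real.rpow_le_rpow hh hle (by linarith)
            calc τ ^ (-j - 1) * h = τ ^ (-j - 1) * (h ^ θ * h ^ (1 - θ)) := by rw [← e1]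
              _ ≤ τ ^ (-j - 1) * (h ^ θ * τ ^ (1 - θ)) := by gcongr
              _ = h ^ θ * τ ^ (-j - θ) := by rw [e2]; ring
        _ ≤ _ := by
            have : 0 ≤ C * G * (h ^ θ * τ ^ (-j - θ)) := by positivity
            linarith
    · have hτh : 0 < τ + h := by linarith
      calc _ ≤ ∫ z, (‖k (τ + h) z‖ + ‖k τ z‖) :=
            integral_mono_of_nonneg (Eventually.of_forall fun z => norm_nonneg _)
              ((kint _ hτh).norm.add (kint _ hτ).norm) (Eventually.of_forall fun z => norm_sub_le _ _)
        _ = (∫ z, ‖k (τ + h) z‖) + ∫ z, ‖k τ z‖ := integral_add (kint _ hτh).norm (kint _ hτ).norm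
        _ ≤ C * G * (τ + h) ^ (-j) + C * G * τ ^ (-j) := add_le_add (kbd _ hτh) (kbd _ hτ)
        _ ≤ C * G * τ ^ (-j) + C * G * τ ^ (-j) := by
            refine add_le_add (mul_le_mul_of_nonneg_left ?_ (by positivity)) le_rfl
            exact Real.rpow_le_rpow_of_nonpos hτ (by linarith) (by linarith)
        _ = 2 * (C * G) * τ ^ (-j) := by ring
        _ ≤ _ := by
            gcongr
            have e2 : τ ^ (-j) = τ ^ θ * τ ^ (-j - θ) := by
              rw [← Real.rpow_add hτ]; congr 1; ring
            rw [e2]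
            gcongr

/-- time derivative -/
def gkt {m : ℕ} (s : ℝ) (z : Spc m) : ℝ := gk s z * (qd z / (4 * s ^ 2) - ((m : ℝ) + 1) / (2 * s))

lemma hasDerivAt_gk {m : ℕ} (z : Spc m) {s : ℝ} (hs : 0 < s) :
    HasDerivAt (fun s => gk s z) (gkt s z) s := by
  have h1 : HasDerivAt (fun s : ℝ => 4 * Real.pi * s) (4 * Real.pi) s := by
    simpa using (hasDerivAt_id s).const_mul (4 * Real.pi)
  have h2 := h1.rpow_const (p := -((m : ℝ) + 1) / 2) (Or.inl (by positivity))
  have h3 : HasDerivAt (fun s : ℝ => -qd z / (4 * s)) (qd z / (4 * s ^ 2)) s := by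
    have := ((hasDerivAt_id s).const_mul 4).inv (by simp; positivity) |>.const_mul (-qd z)
    refine (this.congr_deriv ?_).congr_of_eventuallyEq (Eventually.of_forall fun x => ?_)
    · simp; field_simp
    · simp; ring
  have h4 := h2.mul h3.exp
  refine h4.congr_deriv ?_
  rw [Real.rpow_sub_one (by positivity)]
  unfold gkt gk
  field_simp
  ring

lemma abs_gkt_le {m : ℕ} (z : Spc m) {s : ℝ} (hs : 0 < s) :
    |gkt s z| ≤ ((m : ℝ) + 1) * s⁻¹ * (gk s z * (1 + qd z / s)) := by
  have hg := gk_nonneg hs z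
  have hq := qd_nonneg z
  unfold gkt
  rw [abs_mul, abs_of_nonneg hg]
  have hm : (0 : ℝ) ≤ m := by positivity
  have : |qd z / (4 * s ^ 2) - ((m : ℝ) + 1) / (2 * s)| ≤ ((m : ℝ) + 1) * s⁻¹ * (1 + qd z / s) := by
    have e1 : qd z / (4 * s ^ 2) = s⁻¹ * ((qd z / s) / 4) := by field_simp
    have e2 : ((m : ℝ) + 1) / (2 * s) = s⁻¹ * (((m : ℝ) + 1) / 2) := by field_simp
    rw [e1, e2, ← mul_sub, abs_mul, abs_of_nonneg (by positivity : 0 ≤ s⁻¹), mul_comm ((m : ℝ) + 1), mul_assoc]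
    have hx : 0 ≤ qd z / s := by positivity
    refine mul_le_mul_of_nonneg_left (abs_le.2 ⟨?_, ?_⟩) (by positivity) <;> nlinarith [mul_nonneg hm hx]
  calc _ ≤ gk s z * (((m : ℝ) + 1) * s⁻¹ * (1 + qd z / s)) := mul_le_mul_of_nonneg_left this hg
    _ = _ := by ring

lemma meas_gk {m : ℕ} : Measurable (fun q : ℝ × Spc m => gk q.1 q.2) := by
  unfold gk
  have := continuous_qd (m := m)
  fun_prop

lemma pow_help {X g c : ℝ} (hX : 1 ≤ X) (hg : 0 ≤ g) (hc : 0 ≤ c) {i : ℕ} (hi : i ≤ 3) :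
    c * (g * X ^ i) ≤ c * (g * X ^ 3) := by
  have := pow_le_pow_right₀ hX hi
  gcongr

lemma kfam0 {m : ℕ} : ∃ C, 0 ≤ C ∧ KFam (gk (m := m)) 0 C := by
  refine KFam.of_pointwise (C := (m : ℝ) + 1) (kd := gkt) (by positivity) le_rfl
    meas_gk.stronglyMeasurable (fun s hs z => hasDerivAt_gk z hs) ?_ ?_
  · intro s hs z
    have hg := gk_nonneg hs z
    have hX : 1 ≤ 1 + qd z / s := by have := qd_nonneg z; have : 0 ≤ qd z / s := by positivity
                                     linarith
    rw [Real.norm_of_nonneg hg, neg_zero, Real.rpow_zero, mul_one]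
    have h1 := pow_help hX hg (zero_le_one) (i := 0) (by norm_num)
    have : (0 : ℝ) ≤ m * (gk s z * (1 + qd z / s) ^ 3) := by positivity
    simp at h1; linarith
  · intro s hs z
    have hg := gk_nonneg hs z
    have hX : 1 ≤ 1 + qd z / s := by have := qd_nonneg z; have : 0 ≤ qd z / s := by positivity
                                     linarith
    refine (abs_gkt_le z hs).trans ?_
    have h1 := pow_help hX hg (by positivity : 0 ≤ ((m : ℝ) + 1) * s⁻¹) (i := 1) (by norm_num)
    rw [pow_one] at h1
    rw [show (-0 - 1 : ℝ) = -1 by norm_num, Real.rpow_neg_one]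
    exact h1

lemma abs_c1_le {m : ℕ} (z : Spc m) {s : ℝ} (hs : 0 < s) :
    |(gkt s z * (2 * s) - gk s z * 2) / (2 * s) ^ 2| ≤
      ((m : ℝ) + 1) * (s ^ 2)⁻¹ * (gk s z * (1 + qd z / s)) := by
  have h := abs_gkt_le z hs
  have hg := gk_nonneg hs z
  have hx : 0 ≤ qd z / s := by have := qd_nonneg z; positivity
  have hm : (0 : ℝ) ≤ m := by positivity
  rw [abs_div, abs_of_pos (by positivity : 0 < (2 * s) ^ 2), div_le_iff₀ (by positivity)]
  calc |gkt s z * (2 * s) - gk s z * 2| ≤ |gkt s z * (2 * s)| + |gk s z * 2| := abs_sub _ _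
    _ = |gkt s z| * (2 * s) + gk s z * 2 := by
        rw [abs_mul (gkt s z) _, abs_mul (gk s z) _, abs_of_nonneg hg, abs_of_pos (by positivity : 0 < 2 * s)]; norm_num
    _ ≤ ((m : ℝ) + 1) * s⁻¹ * (gk s z * (1 + qd z / s)) * (2 * s) + gk s z * 2 := by gcongr
    _ = 2 * gk s z * (((m : ℝ) + 1) * (1 + qd z / s) + 1) := by field_simp
    _ ≤ 2 * gk s z * (((m : ℝ) + 1) * (1 + qd z / s) * 2) := by
        refine mul_le_mul_of_nonneg_left ?_ (by positivity)
        nlinarith [mul_nonneg hm hx]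
    _ = _ := by field_simp

lemma abs_c2_le {m : ℕ} (z : Spc m) {s : ℝ} (hs : 0 < s) :
    |(gkt s z * (4 * s ^ 2) - gk s z * (4 * (2 * s))) / (4 * s ^ 2) ^ 2| ≤
      ((m : ℝ) + 1) * (s ^ 3)⁻¹ * (gk s z * (1 + qd z / s)) := by
  have h := abs_gkt_le z hs
  have hg := gk_nonneg hs z
  have hx : 0 ≤ qd z / s := by have := qd_nonneg z; positivity
  have hm : (0 : ℝ) ≤ m := by positivity
  rw [abs_div, abs_of_pos (by positivity : 0 < (4 * s ^ 2) ^ 2), div_le_iff₀ (by positivity)]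
  calc _ ≤ |gkt s z * (4 * s ^ 2)| + |gk s z * (4 * (2 * s))| := abs_sub _ _
    _ = |gkt s z| * (4 * s ^ 2) + gk s z * (4 * (2 * s)) := by
        rw [abs_mul (gkt s z) _, abs_mul (gk s z) _, abs_of_nonneg hg, abs_of_pos (by positivity : 0 < 4 * s ^ 2),
          abs_of_pos (by positivity : 0 < 4 * (2 * s))]
    _ ≤ ((m : ℝ) + 1) * s⁻¹ * (gk s z * (1 + qd z / s)) * (4 * s ^ 2) + gk s z * (4 * (2 * s)) := by gcongr
    _ = 4 * s * gk s z * (((m : ℝ) + 1) * (1 + qd z / s) + 2) := by field_simp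
    _ ≤ 4 * s * gk s z * (((m : ℝ) + 1) * (1 + qd z / s) * 4) := by
        refine mul_le_mul_of_nonneg_left ?_ (by positivity)
        nlinarith [mul_nonneg hm hx]
    _ = _ := by field_simp

lemma sqrt_help {s : ℝ} (hs : 0 < s) : s ^ (-(1 / 2) : ℝ) = s⁻¹ * √s := by
  rw [Real.sqrt_eq_rpow, ← Real.rpow_neg_one, ← Real.rpow_add hs]; norm_num

lemma kfam1 {m : ℕ} : ∃ C, 0 ≤ C ∧ KFam (gk1 (m := m)) (1 / 2) C := by
  have hX : ∀ s : ℝ, 0 < s → ∀ z : Spc m, 1 ≤ 1 + qd z / s := fun s hs z => by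
    have := qd_nonneg z; have : 0 ≤ qd z / s := by positivity
    linarith
  have hm : (0 : ℝ) ≤ m := by positivity
  refine KFam.of_pointwise (C := ((m : ℝ) + 1) ^ 2)
    (kd := fun s z => (-((gkt s z * (2 * s) - gk s z * 2) / (2 * s) ^ 2)) • bl m z)
    (by positivity) (by norm_num) ?_ ?_ ?_ ?_
  · unfold gk1
    have h := meas_gk (m := m)
    have : Measurable fun q : ℝ × Spc m => -(gk q.1 q.2 / (2 * q.1)) := by fun_prop
    exact this.stronglyMeasurable.smul (((bl m).continuous.comp continuous_snd).stronglyMeasurable)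
  · intro s hs z
    have h2 : HasDerivAt (fun s : ℝ => 2 * s) 2 s := by simpa using (hasDerivAt_id s).const_mul 2
    exact (((hasDerivAt_gk z hs).div h2 (by positivity)).neg).smul_const (bl m z)
  · intro s hs z
    have hg := gk_nonneg hs z
    have h1 := hX s hs z
    unfold gk1
    rw [norm_smul, norm_neg, Real.norm_of_nonneg (by positivity), sqrt_help hs]
    calc gk s z / (2 * s) * ‖bl m z‖ ≤ gk s z / (2 * s) * (((m : ℝ) + 1) * (√s * (1 + qd z / s))) := by
          gcongr; exact norm_bl_apply_le' z hs
      _ = ((m : ℝ) + 1) * (s⁻¹ * √s) / 2 * (gk s z * (1 + qd z / s) ^ 1) := by field_simp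
      _ ≤ ((m : ℝ) + 1) * (s⁻¹ * √s) / 2 * (gk s z * (1 + qd z / s) ^ 3) :=
          pow_help h1 hg (by positivity) (by norm_num)
      _ ≤ _ := by
          refine mul_le_mul_of_nonneg_right ?_ (by positivity)
          have : 0 ≤ s⁻¹ * √s := by positivity
          nlinarith [mul_nonneg hm this]
  · intro s hs z
    have hg := gk_nonneg hs z
    have h1 := hX s hs z
    rw [norm_smul, norm_neg, Real.norm_eq_abs, Real.rpow_sub_one hs.ne', sqrt_help hs]
    calc _ ≤ ((m : ℝ) + 1) * (s ^ 2)⁻¹ * (gk s z * (1 + qd z / s)) * (((m : ℝ) + 1) * (√s * (1 + qd z / s))) :=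
          mul_le_mul (abs_c1_le z hs) (norm_bl_apply_le' z hs) (norm_nonneg _) (by positivity)
      _ = ((m : ℝ) + 1) ^ 2 * ((s⁻¹ * √s) / s) * (gk s z * (1 + qd z / s) ^ 2) := by field_simp
      _ ≤ _ := pow_help h1 hg (by positivity) (by norm_num)

lemma meas_aux {X E : Type*} [MeasurableSpace X] [NormedAddCommGroup E] [NormedSpace ℝ E]
    {c d : X → ℝ} {h : X → E} (hc : Measurable c) (hd : Measurable d) (hh : StronglyMeasurable h) (b : E) :
    StronglyMeasurable fun x => c x • h x - d x • b :=
  (hc.stronglyMeasurable.smul hh).sub (hd.stronglyMeasurable.smul stronglyMeasurable_const)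

lemma deriv_aux {E : Type*} [NormedAddCommGroup E] [NormedSpace ℝ E]
    {c d : ℝ → ℝ} {c' d' s : ℝ} (hc : HasDerivAt c c' s) (hd : HasDerivAt d d' s) (e b : E) :
    HasDerivAt (fun x => c x • e - d x • b) (c' • e - d' • b) s :=
  (hc.smul_const e).sub (hd.smul_const b)

lemma norm_aux {E : Type*} [NormedAddCommGroup E] [NormedSpace ℝ E]
    {c d C D A B : ℝ} {e b : E} (hc : |c| ≤ C) (hd : |d| ≤ D) (he : ‖e‖ ≤ A) (hb : ‖b‖ ≤ B) :
    ‖c • e - d • b‖ ≤ C * A + D * B := by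
  refine (norm_sub_le _ _).trans ?_
  rw [norm_smul, norm_smul]
  exact add_le_add (mul_le_mul hc he (norm_nonneg _) ((abs_nonneg _).trans hc))
    (mul_le_mul hd hb (norm_nonneg _) ((abs_nonneg _).trans hd))

lemma cont_aux' {X : Type*} [NormedAddCommGroup X] [NormedSpace ℝ X] (b : X →L[ℝ] X →L[ℝ] ℝ) :
    Continuous fun z => (b z).smulRight (b z) := by
  have : (fun z => (b z).smulRight (b z)) = fun z => ContinuousLinearMap.smulRightL ℝ X (X →L[ℝ] ℝ) (b z) (b z) := rfl
  rw [this]; fun_prop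

lemma kfam2 {m : ℕ} : ∃ C, 0 ≤ C ∧ KFam (gk2 (m := m)) 1 C := by
  have hX : ∀ s : ℝ, 0 < s → ∀ z : Spc m, 1 ≤ 1 + qd z / s := fun s hs z => by
    have := qd_nonneg z; have : 0 ≤ qd z / s := by positivity
    linarith
  have hm : (1 : ℝ) ≤ m + 1 := by have : (0 : ℝ) ≤ m := by positivity
                                  linarith
  have hbb : ∀ s : ℝ, 0 < s → ∀ z : Spc m,
      ‖(bl m z).smulRight (bl m z)‖ ≤ ((m : ℝ) + 1) ^ 2 * (s * (1 + qd z / s) ^ 2) := by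
    intro s hs z
    rw [ContinuousLinearMap.norm_smulRight_apply]
    have h := norm_bl_apply_le' z hs
    calc _ ≤ _ := mul_le_mul h h (norm_nonneg _) (by have := hX s hs z; positivity)
      _ = ((m : ℝ) + 1) ^ 2 * ((√s * √s) * (1 + qd z / s) ^ 2) := by ring
      _ = _ := by rw [Real.mul_self_sqrt hs.le]
  refine KFam.of_pointwise (C := 2 * ((m : ℝ) + 1) ^ 3)
    (kd := fun s z => ((gkt s z * (4 * s ^ 2) - gk s z * (4 * (2 * s))) / (4 * s ^ 2) ^ 2) •
      (bl m z).smulRight (bl m z) - ((gkt s z * (2 * s) - gk s z * 2) / (2 * s) ^ 2) • bl m)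
    (by positivity) (by norm_num) ?_ ?_ ?_ ?_
  · unfold gk2
    have h := meas_gk (m := m)
    have h1 : Measurable fun q : ℝ × Spc m => (gk q.1 q.2 / (4 * q.1 ^ 2)) := by fun_prop
    have h2 : Measurable fun q : ℝ × Spc m => (gk q.1 q.2 / (2 * q.1)) := by fun_prop
    refine meas_aux (E := Spc m →L[ℝ] Spc m →L[ℝ] ℝ) h1 h2 ?_ (bl m)
    exact ((cont_aux' (bl m)).comp continuous_snd).stronglyMeasurable
  · intro s hs z
    have h2 : HasDerivAt (fun s : ℝ => 2 * s) 2 s := by simpa using (hasDerivAt_id s).const_mul 2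
    have h3 : HasDerivAt (fun s : ℝ => 4 * s ^ 2) (4 * (2 * s)) s := by
      simpa using (hasDerivAt_pow 2 s).const_mul 4
    exact deriv_aux (E := Spc m →L[ℝ] Spc m →L[ℝ] ℝ) ((hasDerivAt_gk z hs).div h3 (by positivity))
      ((hasDerivAt_gk z hs).div h2 (by positivity)) _ _
  · intro s hs z
    have hg := gk_nonneg hs z
    have h1 := hX s hs z
    have := norm_aux (E := Spc m →L[ℝ] Spc m →L[ℝ] ℝ) (c := gk s z / (4 * s ^ 2)) (d := gk s z / (2 * s))
      (abs_of_nonneg (by positivity)).le (abs_of_nonneg (by positivity)).le (hbb s hs z) norm_bl_le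
    refine this.trans ?_
    calc _ = (((m : ℝ) + 1) ^ 2 * s⁻¹ / 4) * (gk s z * (1 + qd z / s) ^ 2) +
          (((m : ℝ) + 1) * s⁻¹ / 2) * (gk s z * (1 + qd z / s) ^ 0) := by field_simp
      _ ≤ (((m : ℝ) + 1) ^ 2 * s⁻¹ / 4) * (gk s z * (1 + qd z / s) ^ 3) +
          (((m : ℝ) + 1) * s⁻¹ / 2) * (gk s z * (1 + qd z / s) ^ 3) :=
          add_le_add (pow_help h1 hg (by positivity) (by norm_num)) (pow_help h1 hg (by positivity) (by norm_num))
      _ = ((((m : ℝ) + 1) ^ 2 / 4 + ((m : ℝ) + 1) / 2)) * s⁻¹ * (gk s z * (1 + qd z / s) ^ 3) := by ring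
      _ ≤ 2 * ((m : ℝ) + 1) ^ 3 * s⁻¹ * (gk s z * (1 + qd z / s) ^ 3) := by
          refine mul_le_mul_of_nonneg_right (mul_le_mul_of_nonneg_right ?_ (by positivity)) (by positivity)
          nlinarith [pow_le_pow_right₀ hm (show 2 ≤ 3 by norm_num), pow_le_pow_right₀ hm (show 1 ≤ 3 by norm_num)]
      _ = _ := by rw [Real.rpow_neg_one]
  · intro s hs z
    have hg := gk_nonneg hs z
    have h1 := hX s hs z
    have := norm_aux (E := Spc m →L[ℝ] Spc m →L[ℝ] ℝ) (abs_c2_le z hs) (abs_c1_le z hs) (hbb s hs z) norm_bl_le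
    refine this.trans ?_
    calc _ = (((m : ℝ) + 1) ^ 3 * (s ^ 2)⁻¹) * (gk s z * (1 + qd z / s) ^ 3) +
          (((m : ℝ) + 1) ^ 2 * (s ^ 2)⁻¹) * (gk s z * (1 + qd z / s) ^ 1) := by field_simp
      _ ≤ (((m : ℝ) + 1) ^ 3 * (s ^ 2)⁻¹) * (gk s z * (1 + qd z / s) ^ 3) +
          (((m : ℝ) + 1) ^ 2 * (s ^ 2)⁻¹) * (gk s z * (1 + qd z / s) ^ 3) :=
          add_le_add (pow_help h1 hg (by positivity) (by norm_num)) (pow_help h1 hg (by positivity) (by norm_num))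
      _ = (((m : ℝ) + 1) ^ 3 + ((m : ℝ) + 1) ^ 2) * (s ^ 2)⁻¹ * (gk s z * (1 + qd z / s) ^ 3) := by ring
      _ ≤ 2 * ((m : ℝ) + 1) ^ 3 * (s ^ 2)⁻¹ * (gk s z * (1 + qd z / s) ^ 3) := by
          refine mul_le_mul_of_nonneg_right (mul_le_mul_of_nonneg_right ?_ (by positivity)) (by positivity)
          nlinarith [pow_le_pow_right₀ hm (show 2 ≤ 3 by norm_num)]
      _ = _ := by
          congr 2
          rw [show (-1 - 1 : ℝ) = -((2 : ℕ) : ℝ) by norm_num, Real.rpow_neg hs.le, Real.rpow_natCast]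

instance haarSpc (m : ℕ) : (volume : Measure (Spc m)).IsAddHaarMeasure :=
  Measure.prod.instIsAddHaarMeasure (volume : Measure ℝ) (volume : Measure (Fin m → ℝ))

/-- convolution -/
def cnv {m : ℕ} {E : Type*} [NormedAddCommGroup E] [NormedSpace ℝ E] (k : Spc m → E) (g : Spc m → ℝ)
    (x : Spc m) : E := ∫ y, g y • k (x - y)

section
variable {m : ℕ} {E : Type*} [NormedAddCommGroup E] [NormedSpace ℝ E]

lemma cnv_integrable {k : Spc m → E} (hk : Integrable k) {g : Spc m → ℝ} (hg : Measurable g) {M : ℝ}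
    (hM : ∀ y, |g y| ≤ M) (x : Spc m) : Integrable fun y => g y • k (x - y) := by
  have h1 : Integrable fun y => k (x - y) := hk.comp_sub_left x
  exact h1.bdd_smul M hg.aestronglyMeasurable (Eventually.of_forall hM)

lemma norm_cnv_le {k : Spc m → E} (hk : Integrable k) {g : Spc m → ℝ} {M : ℝ}
    (hM : ∀ y, |g y| ≤ M) (x : Spc m) : ‖cnv k g x‖ ≤ M * ∫ z, ‖k z‖ := by
  have h1 : Integrable fun y => M * ‖k (x - y)‖ := (hk.norm.comp_sub_left x).const_mul M
  refine (norm_integral_le_of_norm_le h1 (Eventually.of_forall fun y => ?_)).trans (le_of_eq ?_)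
  · rw [norm_smul]; exact mul_le_mul_of_nonneg_right (hM y) (norm_nonneg _)
  · rw [integral_const_mul, integral_sub_left_eq_self (fun z => ‖k z‖) volume x]

lemma cnv_sub_k {k k' : Spc m → E} (hk : Integrable k) (hk' : Integrable k') {g : Spc m → ℝ}
    (hg : Measurable g) {M : ℝ} (hM : ∀ y, |g y| ≤ M) (x : Spc m) :
    cnv k g x - cnv k' g x = cnv (fun z => k z - k' z) g x := by
  unfold cnv
  rw [← integral_sub (cnv_integrable hk hg hM x) (cnv_integrable hk' hg hM x)]
  simp [smul_sub]

lemma cnv_sub_g {k : Spc m → E} (hk : Integrable k) {g g' : Spc m → ℝ}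
    (hg : Measurable g) {M : ℝ} (hM : ∀ y, |g y| ≤ M)
    (hg' : Measurable g') {M' : ℝ} (hM' : ∀ y, |g' y| ≤ M') (x : Spc m) :
    cnv k g x - cnv k g' x = cnv k (fun y => g y - g' y) x := by
  unfold cnv
  rw [← integral_sub (cnv_integrable hk hg hM x) (cnv_integrable hk hg' hM' x)]
  simp [sub_smul]

lemma qd_young {m : ℕ} (x x0 y : Spc m) : qd (x0 - y) ≤ 2 * qd (x - y) + 2 * qd (x - x0) := by
  unfold qd
  have : ∀ a b c : ℝ, (b - c) ^ 2 ≤ 2 * (a - c) ^ 2 + 2 * (a - b) ^ 2 := fun a b c => by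
    nlinarith [sq_nonneg ((a - c) + (a - b))]
  have h2 : ∑ i, (x0 - y).2 i ^ 2 ≤ ∑ i, (2 * (x - y).2 i ^ 2 + 2 * (x - x0).2 i ^ 2) :=
    Finset.sum_le_sum fun i _ => this _ _ _
  rw [Finset.sum_add_distrib, ← Finset.mul_sum, ← Finset.mul_sum] at h2
  have h1 := this x.1 x0.1 y.1
  simp only [Prod.fst_sub] at *
  linarith

lemma gk_shift {m : ℕ} {a : ℝ} (ha : 0 < a) (x0 : Spc m) : ∃ D, 0 ≤ D ∧ ∀ x ∈ Metric.ball x0 1, ∀ y,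
    gk a (x - y) ≤ D * gk (2 * a) (x0 - y) := by
  obtain ⟨Q, hQ⟩ := (isCompact_closedBall (0 : Spc m) 1).bddAbove_image (f := qd) continuous_qd.continuousOn
  refine ⟨2 ^ (((m : ℝ) + 1) / 2) * Real.exp (Q / (4 * a)), by positivity, fun x hx y => ?_⟩
  have h1 : qd (x - x0) ≤ Q := hQ ⟨x - x0, by simpa [dist_eq_norm] using (Metric.mem_ball.1 hx).le, rfl⟩
  have h2 := qd_young x x0 y
  unfold gk
  have e1 : (4 * Real.pi * (2 * a)) ^ (-((m : ℝ) + 1) / 2) =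
      (2 ^ (((m : ℝ) + 1) / 2))⁻¹ * (4 * Real.pi * a) ^ (-((m : ℝ) + 1) / 2) := by
    rw [show 4 * Real.pi * (2 * a) = 2 * (4 * Real.pi * a) by ring,
      Real.mul_rpow (by norm_num) (by positivity), neg_div, Real.rpow_neg (by norm_num)]
  rw [e1]
  have e2 : Real.exp (-qd (x - y) / (4 * a)) ≤ Real.exp (Q / (4 * a)) * Real.exp (-qd (x0 - y) / (4 * (2 * a))) := by
    rw [← Real.exp_add]
    apply Real.exp_le_exp.2
    rw [div_add_div _ _ (by positivity) (by positivity), div_le_div_iff₀ (by positivity) (by positivity)]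
    have : 0 < a ^ 2 := by positivity
    have : 0 ≤ a ^ 3 * (2 * qd (x - y) + 2 * qd (x - x0) - qd (x0 - y)) := mul_nonneg (by positivity) (by linarith)
    have : 0 ≤ a ^ 3 * (Q - qd (x - x0)) := mul_nonneg (by positivity) (by linarith)
    nlinarith
  have hp : 0 < (2 : ℝ) ^ (((m : ℝ) + 1) / 2) := by positivity
  calc _ ≤ (4 * Real.pi * a) ^ (-((m : ℝ) + 1) / 2) *
        (Real.exp (Q / (4 * a)) * Real.exp (-qd (x0 - y) / (4 * (2 * a)))) := by gcongr
    _ = _ := by field_simp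

lemma hasFDerivAt_cnv {k : Spc m → E} {k' : Spc m → Spc m →L[ℝ] E} (hk : Integrable k)
    (hd : ∀ z, HasFDerivAt k (k' z) z) (hkm' : StronglyMeasurable k')
    {D a : ℝ} (hD : 0 ≤ D) (ha : 0 < a) (hdom : ∀ z, ‖k' z‖ ≤ D * gk a z)
    {g : Spc m → ℝ} (hg : Measurable g) {M : ℝ} (hM : ∀ y, |g y| ≤ M) (x0 : Spc m) :
    HasFDerivAt (cnv k g) (cnv k' g x0) x0 := by
  obtain ⟨D', hD', hs⟩ := gk_shift ha x0
  have hM0 : 0 ≤ M := (abs_nonneg _).trans (hM 0)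
  refine hasFDerivAt_integral_of_dominated_of_fderiv_le (s := Metric.ball x0 1)
    (F := fun x y => g y • k (x - y)) (F' := fun x y => g y • k' (x - y))
    (bound := fun y => M * (D * (D' * gk (2 * a) (x0 - y))))
    (Metric.ball_mem_nhds _ one_pos) ?_ (cnv_integrable hk hg hM x0) ?_ ?_ ?_ ?_
  · exact Eventually.of_forall fun x => (cnv_integrable hk hg hM x).aestronglyMeasurable
  · exact (hg.stronglyMeasurable.smul (hkm'.comp_measurable (measurable_const.sub measurable_id))).aestronglyMeasurable
  · refine Eventually.of_forall fun y x hx => ?_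
    rw [norm_smul]
    refine mul_le_mul (hM y) ((hdom _).trans ?_) (norm_nonneg _) hM0
    exact mul_le_mul_of_nonneg_left (hs x hx y) hD
  · exact (((integrable_gk (by positivity : 0 < 2 * a)).comp_sub_left x0).const_mul D').const_mul D |>.const_mul M
  · refine Eventually.of_forall fun y x hx => ?_
    have h1 : HasFDerivAt (fun x : Spc m => k (x - y)) (k' (x - y)) x := by
      exact (hasFDerivAt_comp_sub y).2 (hd (x - y))
    exact h1.const_smul (g y)
end

lemma rpow_int {a b e : ℝ} (hab : a ≤ b) (he : -1 < e) :
    IntegrableOn (fun s => (b - s) ^ e) (Ioo a b) ∧ ∫ s in Ioo a b, (b - s) ^ e = (b - a) ^ (e + 1) / (e + 1) := by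
  constructor
  · have h := (intervalIntegral.intervalIntegrable_rpow' (a := b - a) (b := 0) he).comp_sub_left (c := b)
    rw [sub_zero, sub_sub_self] at h
    have h := (intervalIntegrable_iff_integrableOn_Ioc_of_le hab).1 h
    rw [integrableOn_Ioc_iff_integrableOn_Ioo] at h
    exact h
  · rw [← integral_Ioc_eq_integral_Ioo, ← intervalIntegral.integral_of_le hab,
      intervalIntegral.integral_comp_sub_left (fun s => s ^ e) b, integral_rpow (Or.inl he)]
    rw [sub_self, Real.zero_rpow (by linarith), sub_zero]

lemma time_holder {E : Type*} [NormedAddCommGroup E] [NormedSpace ℝ E] {Φ : ℝ → ℝ → E} {t h T K θ e : ℝ}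
    (ht : 0 ≤ t) (hh : 0 ≤ h) (hT : t + h ≤ T) (hK : 0 ≤ K) (he : 0 < e)
    (hi : IntegrableOn (Φ (t + h)) (Ioo 0 (t + h))) (hi' : IntegrableOn (Φ t) (Ioo 0 t))
    (h1 : ∀ s ∈ Ioo t (t + h), ‖Φ (t + h) s‖ ≤ K * h ^ θ * (t + h - s) ^ (e - 1))
    (h2 : ∀ s ∈ Ioo 0 t, ‖Φ (t + h) s - Φ t s‖ ≤ K * h ^ θ * (t - s) ^ (e - 1)) :
    ‖(∫ s in Ioo 0 (t + h), Φ (t + h) s) - ∫ s in Ioo 0 t, Φ t s‖ ≤ (2 * K * T ^ e / e) * h ^ θ := by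
  have hi1 : IntegrableOn (Φ (t + h)) (Ioo 0 t) := hi.mono_set (Ioo_subset_Ioo_right (by linarith))
  have hi2 : IntegrableOn (Φ (t + h)) (Ioo t (t + h)) := hi.mono_set (Ioo_subset_Ioo_left ht)
  have e1 : ∫ s in Ioo 0 (t + h), Φ (t + h) s =
      (∫ s in Ioo 0 t, Φ (t + h) s) + ∫ s in Ioo t (t + h), Φ (t + h) s := by
    rw [← integrableOn_Ioc_iff_integrableOn_Ioo] at hi1 hi2
    rw [← integral_Ioc_eq_integral_Ioo, ← integral_Ioc_eq_integral_Ioo, ← integral_Ioc_eq_integral_Ioo,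
      ← setIntegral_union _ measurableSet_Ioc hi1 hi2, Ioc_union_Ioc_eq_Ioc ht (by linarith)]
    exact Set.disjoint_left.2 fun x hx hx' => by linarith [hx.2, hx'.1]
  obtain ⟨j1, j2⟩ := rpow_int (a := 0) (b := t) (e := e - 1) ht (by linarith)
  obtain ⟨l1, l2⟩ := rpow_int (a := t) (b := t + h) (e := e - 1) (by linarith) (by linarith)
  rw [e1, add_sub_right_comm, ← integral_sub hi1 hi']
  have hTe : ∀ u, 0 ≤ u → u ≤ T → u ^ e ≤ T ^ e := fun u hu hu' => Real.rpow_le_rpow hu hu' he.le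
  have b1 : ‖∫ s in Ioo 0 t, (Φ (t + h) s - Φ t s)‖ ≤ K * h ^ θ * (t ^ e / e) := by
    refine (norm_integral_le_of_norm_le (j1.const_mul (K * h ^ θ))
      ((ae_restrict_iff' measurableSet_Ioo).2 (Eventually.of_forall h2))).trans (le_of_eq ?_)
    rw [integral_const_mul, j2]; simp
  have b2 : ‖∫ s in Ioo t (t + h), Φ (t + h) s‖ ≤ K * h ^ θ * (h ^ e / e) := by
    refine (norm_integral_le_of_norm_le (l1.const_mul (K * h ^ θ))
      ((ae_restrict_iff' measurableSet_Ioo).2 (Eventually.of_forall h1))).trans (le_of_eq ?_)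
    rw [integral_const_mul, l2]; simp
  calc _ ≤ _ := norm_add_le _ _
    _ ≤ K * h ^ θ * (t ^ e / e) + K * h ^ θ * (h ^ e / e) := add_le_add b1 b2
    _ ≤ K * h ^ θ * (T ^ e / e) + K * h ^ θ * (T ^ e / e) := by
        have := hTe t ht (by linarith); have := hTe h hh (by linarith); gcongr
    _ = _ := by ring

/-- Duhamel integral -/
def Duh {m : ℕ} {E : Type*} [NormedAddCommGroup E] [NormedSpace ℝ E] (k : ℝ → Spc m → E)
    (g : ℝ → Spc m → ℝ) (t : ℝ) (x : Spc m) : E := ∫ s in Ioo 0 t, cnv (k (t - s)) (g s) x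

/-- source terms -/
structure Src {m : ℕ} (g : ℝ → Spc m → ℝ) (t H r : ℝ) : Prop where
  meas : Measurable fun q : ℝ × Spc m => g q.1 q.2
  nn : 0 ≤ H
  bd : ∀ s ∈ Ioo 0 t, ∀ y, |g s y| ≤ H * (t - s) ^ r

section
variable {m : ℕ} {E : Type*} [NormedAddCommGroup E] [NormedSpace ℝ E]

lemma Src.meas' {g : ℝ → Spc m → ℝ} {t H r : ℝ} (hg : Src g t H r) (s : ℝ) : Measurable (g s) :=
  hg.meas.comp (measurable_const.prodMk measurable_id)

lemma Duh_meas {k : ℝ → Spc m → E} {j C : ℝ} (hk : KFam k j C)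
    {g : ℝ → Spc m → ℝ} {t H r : ℝ} (hg : Src g t H r) (x : Spc m) :
    StronglyMeasurable fun s => cnv (k (t - s)) (g s) x := by
  unfold cnv
  refine StronglyMeasurable.integral_prod_right (f := fun s y => g s y • k (t - s) (x - y)) ?_
  refine StronglyMeasurable.smul hg.meas.stronglyMeasurable ?_
  exact hk.meas.comp_measurable (g := fun q : ℝ × Spc m => (t - q.1, x - q.2)) (by fun_prop)

lemma Duh_bd {k : ℝ → Spc m → E} {j C : ℝ} (hk : KFam k j C)
    {g : ℝ → Spc m → ℝ} {t H r : ℝ} (hg : Src g t H r) (x : Spc m) {s : ℝ} (hs : s ∈ Ioo 0 t) :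
    ‖cnv (k (t - s)) (g s) x‖ ≤ H * C * (t - s) ^ (r - j) := by
  have hp : 0 < t - s := by linarith [hs.2]
  refine (norm_cnv_le (hk.int _ hp) (hg.bd s hs) x).trans ?_
  refine (mul_le_mul_of_nonneg_left (hk.bd _ hp) (mul_nonneg hg.nn (by positivity))).trans (le_of_eq ?_)
  rw [sub_eq_add_neg r j, Real.rpow_add hp]; ring

lemma Duh_int {k : ℝ → Spc m → E} {j C : ℝ} (hk : KFam k j C)
    {g : ℝ → Spc m → ℝ} {t H r : ℝ} (ht : 0 ≤ t) (hg : Src g t H r) (hr : -1 < r - j) (x : Spc m) :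
    IntegrableOn (fun s => cnv (k (t - s)) (g s) x) (Ioo 0 t) :=
  Integrable.mono' ((rpow_int (a := 0) ht hr).1.const_mul (H * C)) (Duh_meas hk hg x).aestronglyMeasurable
    ((ae_restrict_iff' measurableSet_Ioo).2 (Eventually.of_forall fun _ hs => Duh_bd hk hg x hs))

lemma Duh_norm_le {k : ℝ → Spc m → E} {j C : ℝ} (hk : KFam k j C)
    {g : ℝ → Spc m → ℝ} {t H r : ℝ} (ht : 0 ≤ t) (hg : Src g t H r) (hr : -1 < r - j) (x : Spc m) :
    ‖Duh k g t x‖ ≤ H * C * (t ^ (r - j + 1) / (r - j + 1)) := by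
  refine (norm_integral_le_of_norm_le ((rpow_int (a := 0) ht hr).1.const_mul (H * C))
    ((ae_restrict_iff' measurableSet_Ioo).2 (Eventually.of_forall fun _ hs => Duh_bd hk hg x hs))).trans (le_of_eq ?_)
  rw [integral_const_mul, (rpow_int ht hr).2, sub_zero]

lemma hasFDerivAt_Duh {k : ℝ → Spc m → E} {k' : ℝ → Spc m → Spc m →L[ℝ] E} {j j' C C' : ℝ} (hk : KFam k j C)
    (hk' : KFam k' j' C') (hd : ∀ τ, 0 < τ → ∀ z, HasFDerivAt (k τ) (k' τ z) z)
    {g : ℝ → Spc m → ℝ} {t H r : ℝ} (ht : 0 ≤ t) (hg : Src g t H r) (hr : -1 < r - j) (hr' : -1 < r - j')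
    (x0 : Spc m) : HasFDerivAt (Duh k g t) (Duh k' g t x0) x0 := by
  refine hasFDerivAt_integral_of_dominated_of_fderiv_le (s := univ)
    (F := fun x s => cnv (k (t - s)) (g s) x) (F' := fun x s => cnv (k' (t - s)) (g s) x)
    (bound := fun s => H * C' * (t - s) ^ (r - j')) univ_mem ?_ (Duh_int hk ht hg hr x0) ?_ ?_ ?_ ?_
  · exact Eventually.of_forall fun x => (Duh_meas hk hg x).aestronglyMeasurable
  · exact (Duh_meas hk' hg x0).aestronglyMeasurable
  · exact (ae_restrict_iff' measurableSet_Ioo).2 (Eventually.of_forall fun s hs x _ => Duh_bd hk' hg x hs)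
  · exact (rpow_int ht hr').1.const_mul _
  · refine (ae_restrict_iff' measurableSet_Ioo).2 (Eventually.of_forall fun s hs x _ => ?_)
    have hp : 0 < t - s := by linarith [hs.2]
    obtain ⟨D, a, hD, ha, hdom⟩ := hk'.dom _ hp
    exact hasFDerivAt_cnv (hk.int _ hp) (hd _ hp)
      (hk'.meas.comp_measurable (g := fun z : Spc m => (t - s, z)) (by fun_prop))
      hD ha hdom (hg.meas' s) (hg.bd s hs) x

/-- time regularity for bounded sources -/
lemma Duh_holder0 {k : ℝ → Spc m → E} {j C : ℝ} (hk : KFam k j C) (hC : 0 ≤ C) {T M θ : ℝ}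
    (hθ : 0 ≤ θ) (hθ1 : θ ≤ 1) (hj : j + θ < 1) {g : ℝ → Spc m → ℝ} (hg : Src g T M 0) {t h : ℝ}
    (ht : 0 ≤ t) (hh : 0 ≤ h) (hT : t + h ≤ T) (x : Spc m) :
    ‖Duh k g (t + h) x - Duh k g t x‖ ≤ (2 * (C * M) * T ^ (1 - j - θ) / (1 - j - θ)) * h ^ θ := by
  have hb : ∀ s ∈ Ioo 0 T, ∀ y, |g s y| ≤ M := fun s hs y => by simpa using hg.bd s hs y
  have src : ∀ u ≤ T, Src g u M 0 := fun u hu => ⟨hg.meas, hg.nn, fun s hs y => by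
    simpa using hb s ⟨hs.1, hs.2.trans_le hu⟩ y⟩
  have hM := hg.nn
  refine time_holder (Φ := fun t s => cnv (k (t - s)) (g s) x) ht hh hT (by positivity) (by linarith)
    (Duh_int hk (by linarith) (src _ hT) (by linarith) x) (Duh_int hk ht (src _ (by linarith)) (by linarith) x) ?_ ?_
  · intro s hs
    have hp : 0 < t + h - s := by linarith [hs.2]
    have h1 := Duh_bd hk (src _ hT) x (s := s) ⟨by linarith [hs.1], hs.2⟩
    refine h1.trans ?_
    have e1 : (t + h - s) ^ (0 - j) = (t + h - s) ^ θ * (t + h - s) ^ (1 - j - θ - 1) := by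
      rw [← Real.rpow_add hp]; congr 1; ring
    rw [e1]
    have : (t + h - s) ^ θ ≤ h ^ θ := Real.rpow_le_rpow hp.le (by linarith [hs.1]) hθ
    calc _ ≤ M * C * (h ^ θ * (t + h - s) ^ (1 - j - θ - 1)) := by gcongr
      _ = _ := by ring
  · intro s hs
    have hp : 0 < t - s := by linarith [hs.2]
    have hp' : 0 < t + h - s := by linarith [hs.2]
    have hsT : s ∈ Ioo 0 T := ⟨hs.1, by linarith [hs.2]⟩
    have e2 : t + h - s = (t - s) + h := by ring
    rw [cnv_sub_k (hk.int _ hp') (hk.int _ hp) (hg.meas' s) (hb s hsT)]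
    refine (norm_cnv_le ((hk.int _ hp').sub (hk.int _ hp)) (hb s hsT) x).trans ?_
    rw [e2]
    refine (mul_le_mul_of_nonneg_left (hk.diff _ hp h hh θ hθ hθ1) hM).trans (le_of_eq ?_)
    rw [show 1 - j - θ - 1 = -j - θ by ring]; ring

/-- time regularity for Hölder sources, singular kernel -/
lemma Duh_holder1 {k : ℝ → Spc m → E} {C : ℝ} (hk : KFam k 1 C) (hC : 0 ≤ C) {T H ν ε : ℝ}
    (hε : 0 < ε) (hεν : ε < ν) (hν : ν ≤ 1) {f : ℝ → Spc m → ℝ} (hH : 0 ≤ H)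
    (hm : Measurable fun q : ℝ × Spc m => f q.1 q.2)
    (hf : ∀ s ∈ Icc 0 T, ∀ t ∈ Icc 0 T, ∀ y, |f s y - f t y| ≤ H * |s - t| ^ ν) {t h : ℝ}
    (ht : 0 ≤ t) (hh : 0 ≤ h) (hT : t + h ≤ T) (x : Spc m) :
    ‖Duh k (fun s y => f s y - f (t + h) y) (t + h) x - Duh k (fun s y => f s y - f t y) t x‖ ≤
      (2 * (2 * (C * H)) * T ^ ε / ε) * h ^ (ν - ε) := by
  have src : ∀ u ∈ Icc 0 T, Src (fun s y => f s y - f u y) u H ν := fun u hu => ⟨by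
    exact hm.sub (hm.comp (measurable_const.prodMk measurable_snd)), hH, fun s hs y => by
    have := hf s ⟨hs.1.le, hs.2.le.trans hu.2⟩ u hu y
    rwa [abs_sub_comm s u, abs_of_pos (by linarith [hs.2] : 0 < u - s)] at this⟩
  have hth : t + h ∈ Icc 0 T := ⟨by linarith, hT⟩
  have htt : t ∈ Icc 0 T := ⟨ht, by linarith⟩
  refine time_holder (Φ := fun t s => cnv (k (t - s)) (fun y => f s y - f t y) x) ht hh hT (by positivity) hε
    (Duh_int hk (by linarith) (src _ hth) (by linarith) x) (Duh_int hk ht (src _ htt) (by linarith) x) ?_ ?_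
  · intro s hs
    have hp : 0 < t + h - s := by linarith [hs.2]
    have h1 := Duh_bd hk (src _ hth) x (s := s) ⟨by linarith [hs.1], hs.2⟩
    refine h1.trans ?_
    have e1 : (t + h - s) ^ (ν - 1) = (t + h - s) ^ (ν - ε) * (t + h - s) ^ (ε - 1) := by
      rw [← Real.rpow_add hp]; congr 1; ring
    rw [e1]
    have : (t + h - s) ^ (ν - ε) ≤ h ^ (ν - ε) := Real.rpow_le_rpow hp.le (by linarith [hs.1]) (by linarith)
    calc _ ≤ H * C * (h ^ (ν - ε) * (t + h - s) ^ (ε - 1)) := by gcongr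
      _ ≤ 2 * (H * C * (h ^ (ν - ε) * (t + h - s) ^ (ε - 1))) := by
          have : 0 ≤ H * C * (h ^ (ν - ε) * (t + h - s) ^ (ε - 1)) := by positivity
          linarith
      _ = _ := by ring
  · intro s hs
    have hp : 0 < t - s := by linarith [hs.2]
    have hp' : 0 < t + h - s := by linarith [hs.2]
    have hs' : s ∈ Ioo 0 (t + h) := ⟨hs.1, by linarith [hs.2]⟩
    have e2 : t + h - s = (t - s) + h := by ring
    have k1 := hk.int _ hp'
    have k0 := hk.int _ hp
    have m1 := (src _ hth).meas' s
    have m0 := (src _ htt).meas' s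
    have b1 := (src _ hth).bd s hs'
    have b0 := (src _ htt).bd s hs
    have hd : ∀ y, |(f s y - f (t + h) y) - (f s y - f t y)| ≤ H * h ^ ν := fun y => by
      have := hf t htt (t + h) hth y
      rw [show t - (t + h) = -h by ring, abs_neg, abs_of_nonneg hh] at this
      convert this using 2; ring
    have A : ‖cnv (k (t + h - s)) (fun y => f s y - f (t + h) y) x - cnv (k (t + h - s)) (fun y => f s y - f t y) x‖
        ≤ C * H * h ^ (ν - ε) * (t - s) ^ (ε - 1) := by
      rw [cnv_sub_g k1 m1 b1 m0 b0]
      refine (norm_cnv_le k1 hd x).trans ?_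
      refine (mul_le_mul_of_nonneg_left (hk.bd _ hp') (by positivity)).trans ?_
      have e3 : h ^ ν = h ^ (ν - ε) * h ^ ε := by
        rw [← Real.rpow_add' hh (by linarith)]; congr 1; ring
      have e4 : h ^ ε ≤ (t + h - s) ^ ε := Real.rpow_le_rpow hh (by linarith) hε.le
      have e5 : (t + h - s) ^ ε * (t + h - s) ^ (-1 : ℝ) = (t + h - s) ^ (ε - 1) := by
        rw [← Real.rpow_add hp']; rfl
      have e6 : (t + h - s) ^ (ε - 1) ≤ (t - s) ^ (ε - 1) :=
        Real.rpow_le_rpow_of_nonpos hp (by linarith) (by linarith)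
      rw [e3]
      calc _ = C * H * h ^ (ν - ε) * (h ^ ε * (t + h - s) ^ (-1 : ℝ)) := by ring
        _ ≤ C * H * h ^ (ν - ε) * ((t + h - s) ^ ε * (t + h - s) ^ (-1 : ℝ)) := by gcongr
        _ ≤ _ := by rw [e5]; gcongr
    have B : ‖cnv (k (t + h - s)) (fun y => f s y - f t y) x - cnv (k (t - s)) (fun y => f s y - f t y) x‖
        ≤ C * H * h ^ (ν - ε) * (t - s) ^ (ε - 1) := by
      rw [cnv_sub_k k1 k0 m0 b0]
      refine (norm_cnv_le (k1.sub k0) b0 x).trans ?_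
      rw [e2]
      refine (mul_le_mul_of_nonneg_left (hk.diff _ hp h hh (ν - ε) (by linarith) (by linarith)) (by positivity)).trans
        (le_of_eq ?_)
      have : (t - s) ^ (ε - 1) = (t - s) ^ ν * (t - s) ^ (-1 - (ν - ε)) := by
        rw [← Real.rpow_add hp]; congr 1; ring
      rw [this]; ring
    have := norm_add_le_of_le A B
    rw [sub_add_sub_cancel] at this
    exact this.trans (le_of_eq (by ring))
end

/-- closed unit cube -/
def CC (m : ℕ) : Set (Spc m) := {x | (0 ≤ x.1 ∧ x.1 ≤ 1) ∧ ∀ i, 0 ≤ x.2 i ∧ x.2 i ≤ 1}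

def one1 (m : ℕ) : Spc m := (1, fun _ => 1)

def XX {m : ℕ} (v : Spc m) (ρ : ℝ) (x : Spc m) (q : Spc m × ℝ) : Spc m :=
  (1 - ρ) • x + ρ • ((1 / 3 : ℝ) • (one1 m + q.1 + q.2 • v))

lemma cube_sub_CC {m : ℕ} {x : Spc m} (hx : x ∈ cube m) : x ∈ CC m :=
  ⟨⟨hx.1.1, hx.1.2.le⟩, fun i => ⟨(hx.2 i (mem_univ i)).1, (hx.2 i (mem_univ i)).2.le⟩⟩

lemma vol_cube1 (m : ℕ) : volume (cube1 m) = 1 := by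
  unfold cube1; rw [volume_pi, Measure.pi_pi]; simp

lemma vol_cube (m : ℕ) : volume (cube m) = 1 := by
  unfold cube
  rw [Measure.volume_eq_prod, Measure.prod_prod, vol_cube1]; simp

instance (m : ℕ) : IsProbabilityMeasure (μT m) := ⟨by simp [μT, vol_cube]⟩

lemma meas_cube1 (m : ℕ) : MeasurableSet (cube1 m) := MeasurableSet.univ_pi fun _ => measurableSet_Ico
lemma meas_cube (m : ℕ) : MeasurableSet (cube m) := measurableSet_Ico.prod (meas_cube1 m)

instance probI : IsProbabilityMeasure (volume.restrict (Icc (0:ℝ) 1)) := ⟨by simp⟩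

def PP (m : ℕ) : Measure (Spc m × ℝ) := (μT m).prod (volume.restrict (Icc (0:ℝ) 1))

instance (m : ℕ) : IsProbabilityMeasure (PP m) := by unfold PP; infer_instance

lemma z1 {a u τ w ρ : ℝ} (ha : 0 ≤ a) (ha1 : a ≤ 1) (hu : 0 ≤ u) (hu1 : u < 1) (hτ : 0 ≤ τ) (hτ1 : τ ≤ 1)
    (hw : |w| ≤ 1) (hρ : 0 < ρ) (hρ1 : ρ ≤ 1) :
    0 ≤ (1 - ρ) * a + ρ * (1 / 3 * (1 + u + τ * w)) ∧ (1 - ρ) * a + ρ * (1 / 3 * (1 + u + τ * w)) < 1 ∧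
    |(1 - ρ) * a + ρ * (1 / 3 * (1 + u + τ * w)) - a| ≤ ρ := by
  have h1 : |τ * w| ≤ 1 := by
    rw [abs_mul, abs_of_nonneg hτ]; nlinarith [abs_nonneg w]
  have h2 := abs_le.1 h1
  set z := 1 / 3 * (1 + u + τ * w) with hz
  have hz0 : 0 ≤ z := by rw [hz]; linarith
  have hz1 : z < 1 := by rw [hz]; linarith
  refine ⟨by nlinarith, by nlinarith, ?_⟩
  rw [show (1 - ρ) * a + ρ * z - a = ρ * (z - a) by ring, abs_mul, abs_of_pos hρ]
  have : |z - a| ≤ 1 := abs_le.2 ⟨by linarith, by linarith⟩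
  nlinarith

lemma norm_coord {m : ℕ} {x : Spc m} {r : ℝ} (hr : 0 ≤ r) : ‖x‖ ≤ r ↔ |x.1| ≤ r ∧ ∀ i, |x.2 i| ≤ r := by
  rw [Prod.norm_def, max_le_iff, pi_norm_le_iff_of_nonneg hr]; rfl

lemma XX_mem {m : ℕ} {v x : Spc m} {ρ : ℝ} (hv : ‖v‖ ≤ 1) (hx : x ∈ CC m) (hρ : 0 < ρ) (hρ1 : ρ ≤ 1)
    {u : Spc m} (hu : u ∈ cube m) {τ : ℝ} (hτ : τ ∈ Icc (0:ℝ) 1) :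
    XX v ρ x (u, τ) ∈ cube m ∧ ‖XX v ρ x (u, τ) - x‖ ≤ ρ := by
  have hv' := (norm_coord zero_le_one).1 hv
  have h1 := z1 hx.1.1 hx.1.2 hu.1.1 hu.1.2 hτ.1 hτ.2 hv'.1 hρ hρ1
  have h2 := fun i => z1 (hx.2 i).1 (hx.2 i).2 (hu.2 i (mem_univ i)).1 (hu.2 i (mem_univ i)).2 hτ.1 hτ.2
    (hv'.2 i) hρ hρ1
  refine ⟨⟨⟨h1.1, h1.2.1⟩, fun i _ => ⟨(h2 i).1, (h2 i).2.1⟩⟩, (norm_coord hρ.le).2 ⟨h1.2.2, fun i => (h2 i).2.2⟩⟩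

lemma ae_XX {m : ℕ} {v x : Spc m} {ρ : ℝ} (hv : ‖v‖ ≤ 1) (hx : x ∈ CC m) (hρ : 0 < ρ) (hρ1 : ρ ≤ 1) :
    ∀ᵐ q ∂(PP m), XX v ρ x q ∈ cube m ∧ ‖XX v ρ x q - x‖ ≤ ρ := by
  unfold PP μT
  rw [Measure.prod_restrict]
  refine (ae_restrict_iff' ((meas_cube m).prod measurableSet_Icc)).2 (Eventually.of_forall fun q hq => ?_)
  exact XX_mem hv hx hρ hρ1 hq.1 hq.2

lemma continuous_XX {m : ℕ} (v : Spc m) (ρ : ℝ) : Continuous fun w : Spc m × (Spc m × ℝ) => XX v ρ w.1 w.2 := by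
  unfold XX; fun_prop

lemma meas_XX {m : ℕ} (v : Spc m) (ρ : ℝ) (x : Spc m) : Measurable (XX v ρ x) := by
  unfold XX; fun_prop

lemma finrank_Spc (m : ℕ) : Module.finrank ℝ (Spc m) = m + 1 := by
  simp [Module.finrank_prod, add_comm]

lemma lint_affine {m : ℕ} {c : ℝ} (hc : 0 < c) (a : Spc m) {h : Spc m → ℝ≥0∞} (hh : Measurable h) :
    ∫⁻ u, h (a + c • u) = ENNReal.ofReal ((c⁻¹) ^ (m + 1)) * ∫⁻ z, h z := by
  have h1 := lintegral_map (μ := (volume : Measure (Spc m))) (f := fun u => h (a + u)) (g := fun u => c • u)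
    (by fun_prop) (by fun_prop)
  have h2 : Measure.map (fun u : Spc m => c • u) volume = ENNReal.ofReal ((c⁻¹) ^ (m + 1)) • volume := by
    rw [Measure.map_addHaar_smul _ hc.ne', finrank_Spc, abs_of_pos (by positivity), inv_pow]
  rw [← h1, h2, lintegral_smul_measure, lintegral_add_left_eq_self, smul_eq_mul]

lemma lint_XX {m : ℕ} {v x : Spc m} {ρ : ℝ} (hv : ‖v‖ ≤ 1) (hx : x ∈ CC m) (hρ : 0 < ρ) (hρ1 : ρ ≤ 1)
    {h : Spc m → ℝ≥0∞} (hh : Measurable h) :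
    ∫⁻ q, h (XX v ρ x q) ∂(PP m) ≤ ENNReal.ofReal ((3 / ρ) ^ (m + 1)) * ∫⁻ z in cube m, h z := by
  unfold PP
  rw [lintegral_prod_symm' (fun q => h (XX v ρ x q)) (hh.comp (meas_XX v ρ x))]
  have : ∀ τ ∈ Icc (0:ℝ) 1, ∫⁻ u, h (XX v ρ x (u, τ)) ∂(μT m) ≤
      ENNReal.ofReal ((3 / ρ) ^ (m + 1)) * ∫⁻ z in cube m, h z := by
    intro τ hτ
    have e : ∀ u, XX v ρ x (u, τ) = ((1 - ρ) • x + (ρ / 3) • (one1 m + τ • v)) + (ρ / 3) • u := by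
      intro u; unfold XX; simp only; module
    calc ∫⁻ u, h (XX v ρ x (u, τ)) ∂(μT m) = ∫⁻ u in cube m, (cube m).indicator h (XX v ρ x (u, τ)) := by
          refine setLIntegral_congr_fun (meas_cube m) fun u hu => ?_
          rw [indicator_of_mem (XX_mem hv hx hρ hρ1 hu hτ).1]
      _ ≤ ∫⁻ u, (cube m).indicator h (XX v ρ x (u, τ)) := setLIntegral_le_lintegral _ _
      _ = _ := by
          simp_rw [e]
          rw [lint_affine (by positivity) _ (hh.indicator (meas_cube m)), inv_div,
            lintegral_indicator (meas_cube m)]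
  calc _ ≤ ∫⁻ τ in Icc (0:ℝ) 1, ENNReal.ofReal ((3 / ρ) ^ (m + 1)) * ∫⁻ z in cube m, h z :=
        setLIntegral_mono' measurableSet_Icc this
    _ = _ := by rw [lintegral_const]; simp

lemma lint_XX2 {m : ℕ} {v x y : Spc m} {ρ ρ' : ℝ} (hv : ‖v‖ ≤ 1) (hx : x ∈ CC m) (hy : y ∈ CC m)
    (hρ : 0 < ρ) (hρ1 : ρ ≤ 1) (hρ' : 0 < ρ') (hρ1' : ρ' ≤ 1)
    {h : Spc m → Spc m → ℝ≥0∞} (hh : Measurable fun q : Spc m × Spc m => h q.1 q.2) :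
    ∫⁻ q, ∫⁻ q', h (XX v ρ x q) (XX v ρ' y q') ∂(PP m) ∂(PP m) ≤
      ENNReal.ofReal ((3 / ρ) ^ (m + 1)) * ENNReal.ofReal ((3 / ρ') ^ (m + 1)) *
        ∫⁻ z in cube m, ∫⁻ z' in cube m, h z z' := by
  calc _ ≤ ∫⁻ q, ENNReal.ofReal ((3 / ρ') ^ (m + 1)) * (∫⁻ z' in cube m, h (XX v ρ x q) z') ∂(PP m) :=
        lintegral_mono fun q => lint_XX hv hy hρ' hρ1' (hh.comp (measurable_const.prodMk measurable_id))
    _ = ENNReal.ofReal ((3 / ρ') ^ (m + 1)) * ∫⁻ q, (∫⁻ z' in cube m, h (XX v ρ x q) z') ∂(PP m) :=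
        lintegral_const_mul' _ _ ENNReal.ofReal_ne_top
    _ ≤ ENNReal.ofReal ((3 / ρ') ^ (m + 1)) * (ENNReal.ofReal ((3 / ρ) ^ (m + 1)) *
        ∫⁻ z in cube m, ∫⁻ z' in cube m, h z z') := by
        gcongr
        exact lint_XX hv hx hρ hρ1 (h := fun z => ∫⁻ z' in cube m, h z z') hh.lintegral_prod_right'
    _ = _ := by ring

def TT {m : ℕ} (g : Spc m → ℝ) (v : Spc m) (ρ : ℝ) (x : Spc m) : ℝ := ∫ q, g (XX v ρ x q) ∂(PP m)

lemma int_XX {m : ℕ} {v x : Spc m} {ρ : ℝ} (hv : ‖v‖ ≤ 1) (hx : x ∈ CC m) (hρ : 0 < ρ) (hρ1 : ρ ≤ 1)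
    {g : Spc m → ℝ} (hg : Measurable g) (hi : ∫⁻ z in cube m, ‖g z‖ₑ < ⊤) :
    Integrable (fun q => g (XX v ρ x q)) (PP m) := by
  refine ⟨(hg.comp (meas_XX v ρ x)).aestronglyMeasurable, ?_⟩
  exact (lint_XX hv hx hρ hρ1 (h := fun z => ‖g z‖ₑ) hg.enorm).trans_lt (ENNReal.mul_lt_top ENNReal.ofReal_lt_top hi)

lemma TT_eq {m : ℕ} {v x : Spc m} {ρ : ℝ} (hv : ‖v‖ ≤ 1) (hx : x ∈ CC m) (hρ : 0 < ρ) (hρ1 : ρ ≤ 1)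
    {f : Spc m → ℝ} (hf : Differentiable ℝ f) (hi : ∫⁻ z in cube m, ‖grd f z v‖ₑ < ⊤)
    (hg : Measurable fun z => grd f z v) :
    TT (fun z => grd f z v) v ρ x = ∫ u, (3 / ρ) * (f (XX v ρ x (u, 1)) - f (XX v ρ x (u, 0))) ∂(μT m) := by
  have hint := int_XX hv hx hρ hρ1 hg hi
  unfold TT
  unfold PP at hint ⊢
  rw [integral_prod _ hint]
  refine integral_congr_ae (hint.prod_right_ae.mono fun u hu => ?_)
  simp only
  rw [integral_Icc_eq_integral_Ioc, ← intervalIntegral.integral_of_le zero_le_one, mul_sub]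
  refine intervalIntegral.integral_eq_sub_of_hasDerivAt (f := fun τ => (3 / ρ) * f (XX v ρ x (u, τ))) ?_ ?_
  · intro τ _
    have h1 : HasDerivAt (fun τ : ℝ => XX v ρ x (u, τ)) ((ρ / 3) • v) τ := by
      have e : ∀ τ : ℝ, XX v ρ x (u, τ) = ((1 - ρ) • x + (ρ / 3) • (one1 m + u)) + τ • ((ρ / 3) • v) := by
        intro u; unfold XX; simp only; module
      have : HasDerivAt (fun τ : ℝ => ((1 - ρ) • x + (ρ / 3) • (one1 m + u)) + τ • ((ρ / 3) • v))
          ((1 : ℝ) • ((ρ / 3) • v)) τ := ((hasDerivAt_id τ).smul_const _).const_add _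
      rw [one_smul] at this
      exact this.congr_of_eventuallyEq (Eventually.of_forall e)
    have h2 := ((hf (XX v ρ x (u, τ))).hasFDerivAt.comp_hasDerivAt τ h1).const_mul (3 / ρ)
    refine h2.congr_deriv ?_
    rw [map_smul, smul_eq_mul]; unfold grd; field_simp
  · rw [intervalIntegrable_iff_integrableOn_Icc_of_le zero_le_one]; exact hu

lemma TT_lim {m : ℕ} {v x : Spc m} (hv : ‖v‖ ≤ 1) (hx : x ∈ CC m)
    {f : Spc m → ℝ} (hf : Differentiable ℝ f) (hi : ∫⁻ z in cube m, ‖grd f z v‖ₑ < ⊤)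
    (hg : Measurable fun z => grd f z v) {ρs : ℕ → ℝ} (h0 : ∀ k, 0 < ρs k) (h1 : ∀ k, ρs k ≤ 1)
    (hl : Tendsto ρs atTop (nhds 0)) :
    Tendsto (fun k => TT (fun z => grd f z v) v (ρs k) x) atTop (nhds (grd f x v)) := by
  rw [Metric.tendsto_atTop]
  intro ε hε
  have hd := (hf x).hasFDerivAt.isLittleO.def (show 0 < ε / 12 by positivity)
  obtain ⟨δ, hδ, hball⟩ := Metric.eventually_nhds_iff.1 hd
  obtain ⟨K, hK⟩ := Metric.tendsto_atTop.1 hl δ hδ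
  refine ⟨K, fun k hk => ?_⟩
  have hρ := h0 k
  have hρδ : ρs k < δ := by have := hK k hk; rwa [Real.dist_eq, sub_zero, abs_of_pos hρ] at this
  rw [TT_eq hv hx hρ (h1 k) hf hi hg, dist_eq_norm]
  set ρ := ρs k
  have hb : ∀ᵐ u ∂(μT m), ‖(3 / ρ) * (f (XX v ρ x (u, 1)) - f (XX v ρ x (u, 0))) - grd f x v‖ ≤ ε / 2 := by
    refine (ae_restrict_iff' (meas_cube m)).2 (Eventually.of_forall fun u hu => ?_)
    have m1 := (XX_mem hv hx hρ (h1 k) hu (τ := 1) (by simp)).2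
    have m0 := (XX_mem hv hx hρ (h1 k) hu (τ := 0) (by simp)).2
    have b1 := @hball (XX v ρ x (u, 1)) (by rw [dist_eq_norm]; linarith)
    have b0 := @hball (XX v ρ x (u, 0)) (by rw [dist_eq_norm]; linarith)
    set w1 := XX v ρ x (u, 1)
    set w0 := XX v ρ x (u, 0)
    have hw : w1 - x = (w0 - x) + (ρ / 3) • v := by
      simp only [w1, w0, XX]; module
    have e : (3 / ρ) * (f w1 - f w0) - grd f x v =
        (3 / ρ) * ((f w1 - f x - fderiv ℝ f x (w1 - x)) - (f w0 - f x - fderiv ℝ f x (w0 - x))) := by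
      rw [hw, map_add, map_smul, smul_eq_mul]; unfold grd; field_simp; ring
    rw [e, norm_mul, Real.norm_of_nonneg (by positivity : 0 ≤ 3 / ρ)]
    calc _ ≤ 3 / ρ * (ε / 12 * ρ + ε / 12 * ρ) := by
          refine mul_le_mul_of_nonneg_left ?_ (by positivity)
          refine (norm_sub_le _ _).trans (add_le_add (b1.trans ?_) (b0.trans ?_)) <;> gcongr
      _ = ε / 2 := by field_simp; norm_num
  have hii : Integrable (fun u => (3 / ρ) * (f (XX v ρ x (u, 1)) - f (XX v ρ x (u, 0)))) (μT m) := by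
    refine Integrable.of_bound (C := ε / 2 + ‖grd f x v‖) ?_ ?_
    · have := hf.continuous
      have c := continuous_XX v ρ
      have c1 : ∀ τ : ℝ, Continuous fun u : Spc m => XX v ρ x (u, τ) := fun τ =>
        c.comp (by fun_prop : Continuous fun u : Spc m => (x, (u, τ)))
      exact (((this.comp (c1 1)).sub (this.comp (c1 0))).const_smul (3 / ρ)).aestronglyMeasurable
    · refine hb.mono fun u hu => ?_
      have := norm_le_norm_add_norm_sub' ((3 / ρ) * (f (XX v ρ x (u, 1)) - f (XX v ρ x (u, 0)))) (grd f x v)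
      linarith
  have e2 : (∫ u, (3 / ρ) * (f (XX v ρ x (u, 1)) - f (XX v ρ x (u, 0))) ∂(μT m)) - grd f x v =
      ∫ u, ((3 / ρ) * (f (XX v ρ x (u, 1)) - f (XX v ρ x (u, 0))) - grd f x v) ∂(μT m) := by
    rw [integral_sub hii (integrable_const _)]; simp
  rw [e2]
  have := norm_integral_le_of_norm_le_const hb
  simp at this
  rw [Real.norm_eq_abs]; linarith

lemma TT_sub {m : ℕ} {v x y : Spc m} {ρ ρ' : ℝ} (hv : ‖v‖ ≤ 1) (hx : x ∈ CC m) (hy : y ∈ CC m)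
    (hρ : 0 < ρ) (hρ1 : ρ ≤ 1) (hρ' : 0 < ρ') (hρ1' : ρ' ≤ 1)
    {g : Spc m → ℝ} (hg : Measurable g) (hi : ∫⁻ z in cube m, ‖g z‖ₑ < ⊤) {p e N L : ℝ} (hp : 1 ≤ p) (he : 0 ≤ e)
    (hN : 0 ≤ N) (hL : ρ + ρ' + ‖x - y‖ ≤ L)
    (hgN : ∫⁻ x in cube m, ∫⁻ y in cube m, ENNReal.ofReal (‖g x - g y‖ ^ p / ‖x - y‖ ^ e) ≤ ENNReal.ofReal (N ^ p)) :
    |TT g v ρ x - TT g v ρ' y| ≤ (L ^ e * ((3 / ρ) ^ (m + 1) * (3 / ρ') ^ (m + 1) * N ^ p)) ^ (1 / p) := by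
  have hp0 : 0 < p := by linarith
  have hL0 : 0 ≤ L := by have := norm_nonneg (x - y); linarith
  have i1 := int_XX hv hx hρ hρ1 hg hi
  have i2 := int_XX hv hy hρ' hρ1' hg hi
  set Φ : (Spc m × ℝ) × (Spc m × ℝ) → ℝ := fun w => g (XX v ρ x w.1) - g (XX v ρ' y w.2) with hΦ
  have mX : Measurable fun w : (Spc m × ℝ) × (Spc m × ℝ) => XX v ρ x w.1 := (meas_XX v ρ x).comp measurable_fst
  have mY : Measurable fun w : (Spc m × ℝ) × (Spc m × ℝ) => XX v ρ' y w.2 := (meas_XX v ρ' y).comp measurable_snd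
  have mΦ : Measurable Φ := (hg.comp mX).sub (hg.comp mY)
  have e1 : TT g v ρ x - TT g v ρ' y = ∫ w, Φ w ∂((PP m).prod (PP m)) := by
    rw [hΦ, integral_sub (i1.comp_fst _) (i2.comp_snd _)]
    rw [integral_fun_fst (fun q => g (XX v ρ x q)), integral_fun_snd (fun q => g (XX v ρ' y q))]
    simp [TT]
  have b1 : ENNReal.ofReal |TT g v ρ x - TT g v ρ' y| ≤ eLpNorm Φ (ENNReal.ofReal p) ((PP m).prod (PP m)) := by
    rw [e1, ← Real.norm_eq_abs, ofReal_norm]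
    refine (enorm_integral_le_lintegral_enorm _).trans ?_
    rw [← eLpNorm_one_eq_lintegral_enorm]
    refine eLpNorm_le_eLpNorm_of_exponent_le ?_ mΦ.aestronglyMeasurable
    rw [← ENNReal.ofReal_one]; exact ENNReal.ofReal_le_ofReal hp
  have b2 : eLpNorm Φ (ENNReal.ofReal p) ((PP m).prod (PP m)) =
      (∫⁻ w, ENNReal.ofReal (‖Φ w‖ ^ p) ∂((PP m).prod (PP m))) ^ (1 / p) := by
    rw [eLpNorm_eq_lintegral_rpow_enorm_toReal (by simpa using hp0) ENNReal.ofReal_ne_top, ENNReal.toReal_ofReal hp0.le]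
    congr 1
    refine lintegral_congr fun w => ?_
    rw [← ofReal_norm, ENNReal.ofReal_rpow_of_nonneg (norm_nonneg _) hp0.le]
  set H : Spc m → Spc m → ℝ≥0∞ := fun x y => ENNReal.ofReal (‖g x - g y‖ ^ p / ‖x - y‖ ^ e) with hH
  have mH : Measurable fun q : Spc m × Spc m => H q.1 q.2 := by
    have h1 : Measurable fun q : Spc m × Spc m => g q.1 - g q.2 := (hg.comp measurable_fst).sub (hg.comp measurable_snd)
    have h2 : Measurable fun q : Spc m × Spc m => ‖q.1 - q.2‖ := (by fun_prop : Continuous fun q : Spc m × Spc m => ‖q.1 - q.2‖).measurable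
    exact ((h1.norm.pow_const p).div (h2.pow_const e)).ennreal_ofReal
  have b3 : ∀ᵐ w ∂((PP m).prod (PP m)), ENNReal.ofReal (‖Φ w‖ ^ p) ≤
      ENNReal.ofReal (L ^ e) * H (XX v ρ x w.1) (XX v ρ' y w.2) := by
    have a1 := Measure.quasiMeasurePreserving_fst (μ := PP m) (ν := PP m) |>.ae (ae_XX hv hx hρ hρ1)
    have a2 := Measure.quasiMeasurePreserving_snd (μ := PP m) (ν := PP m) |>.ae (ae_XX hv hy hρ' hρ1')
    filter_upwards [a1, a2] with w h1 h2
    rw [hH, ← ENNReal.ofReal_mul (by positivity)]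
    apply ENNReal.ofReal_le_ofReal
    simp only [hΦ]
    set X := XX v ρ x w.1
    set Y := XX v ρ' y w.2
    rcases eq_or_ne X Y with hXY | hXY
    · rw [hXY]; simp [hp0.ne']
    have hpos : 0 < ‖X - Y‖ := norm_pos_iff.2 (sub_ne_zero.2 hXY)
    have hle : ‖X - Y‖ ≤ L := by
      have e3 : X - Y = (X - x) + (x - y) - (Y - y) := by abel
      have := norm_sub_le ((X - x) + (x - y)) (Y - y)
      have := norm_add_le (X - x) (x - y)
      rw [e3]; linarith [h1.2, h2.2]
    have : ‖X - Y‖ ^ e ≤ L ^ e := Real.rpow_le_rpow hpos.le hle he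
    have hpe : 0 < ‖X - Y‖ ^ e := by positivity
    rw [← mul_div_assoc, le_div_iff₀ hpe, mul_comm]
    gcongr
  have b4 : ∫⁻ w, ENNReal.ofReal (‖Φ w‖ ^ p) ∂((PP m).prod (PP m)) ≤
      ENNReal.ofReal (L ^ e * ((3 / ρ) ^ (m + 1) * (3 / ρ') ^ (m + 1) * N ^ p)) := by
    refine (lintegral_mono_ae b3).trans ?_
    rw [lintegral_const_mul' _ _ ENNReal.ofReal_ne_top,
      lintegral_prod (fun w => H (XX v ρ x w.1) (XX v ρ' y w.2)) ((mH.comp (mX.prodMk mY)).aemeasurable), ENNReal.ofReal_mul (by positivity),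
      ENNReal.ofReal_mul (by positivity), ENNReal.ofReal_mul (by positivity)]
    gcongr
    exact (lint_XX2 hv hx hy hρ hρ1 hρ' hρ1' mH).trans (by gcongr)
  rw [b2] at b1
  have b5 := b1.trans (ENNReal.rpow_le_rpow b4 (by positivity))
  rw [ENNReal.ofReal_rpow_of_nonneg (by positivity) (by positivity)] at b5
  exact (ENNReal.ofReal_le_ofReal_iff (by positivity)).1 b5

lemma TT_step {m : ℕ} {s p : ℝ} (hs : 0 ≤ s) (hp : 1 ≤ p) : ∃ C0, 0 ≤ C0 ∧
    ∀ {v x y : Spc m} {ρ ρ' : ℝ} (_ : ‖v‖ ≤ 1) (_ : x ∈ CC m) (_ : y ∈ CC m)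
    (_ : 0 < ρ) (_ : ρ ≤ 1) (_ : ρ / 2 ≤ ρ') (_ : ρ' ≤ ρ) (_ : ‖x - y‖ ≤ ρ)
    {g : Spc m → ℝ} (_ : Measurable g) (_ : ∫⁻ z in cube m, ‖g z‖ₑ < ⊤) {N : ℝ}
    (_ : 0 ≤ N)
    (_ : ∫⁻ x in cube m, ∫⁻ y in cube m, ENNReal.ofReal (‖g x - g y‖ ^ p / ‖x - y‖ ^ ((m:ℝ) + 1 + s * p))
      ≤ ENNReal.ofReal (N ^ p)),
    |TT g v ρ x - TT g v ρ' y| ≤ C0 * N * ρ ^ (s - ((m:ℝ) + 1) / p) := by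
  have hp0 : 0 < p := by linarith
  refine ⟨(3 ^ ((m:ℝ) + 1 + s * p) * 18 ^ (m + 1)) ^ (1 / p), by positivity, ?_⟩
  intro v x y ρ ρ' hv hx hy hρ hρ1 h1 h2 hxy g hg hi N hN hgN
  have hρ' : 0 < ρ' := by linarith
  refine (TT_sub hv hx hy hρ hρ1 hρ' (h2.trans hρ1) hg hi (L := 3 * ρ) hp (by positivity) hN
    (by linarith) hgN).trans ?_
  have e1 : (3 * ρ) ^ ((m:ℝ) + 1 + s * p) * ((3 / ρ) ^ (m + 1) * (3 / ρ') ^ (m + 1) * N ^ p) ≤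
      (3 ^ ((m:ℝ) + 1 + s * p) * 18 ^ (m + 1)) * N ^ p * (ρ ^ (s - ((m:ℝ) + 1) / p)) ^ p := by
    have h3 : (3 / ρ') ^ (m + 1) ≤ (6 / ρ) ^ (m + 1) := by
      gcongr ?_ ^ _
      rw [div_le_div_iff₀ hρ' hρ]; linarith
    have h4 : ρ ^ ((m:ℝ) + 1 + s * p) = (ρ ^ (s - ((m:ℝ) + 1) / p)) ^ p * (ρ ^ (m + 1) * ρ ^ (m + 1)) := by
      rw [← Real.rpow_mul hρ.le, ← Real.rpow_natCast, ← Real.rpow_add hρ, ← Real.rpow_add hρ]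
      congr 1; push_cast; field_simp; ring
    calc _ ≤ (3 * ρ) ^ ((m:ℝ) + 1 + s * p) * ((3 / ρ) ^ (m + 1) * (6 / ρ) ^ (m + 1) * N ^ p) := by gcongr
      _ = _ := by
        rw [Real.mul_rpow (by norm_num) hρ.le, h4, div_pow, div_pow,
          show (18:ℝ) ^ (m + 1) = 3 ^ (m + 1) * 6 ^ (m + 1) by rw [← mul_pow]; norm_num]
        field_simp
  refine (Real.rpow_le_rpow (by positivity) e1 (by positivity)).trans (le_of_eq ?_)
  rw [Real.mul_rpow (by positivity) (by positivity), Real.mul_rpow (by positivity) (by positivity),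
    one_div, Real.rpow_rpow_inv hN hp0.ne', Real.rpow_rpow_inv (by positivity) hp0.ne']

lemma TT_grd {m : ℕ} {s p : ℝ} (hs : 0 ≤ s) (hp : 1 ≤ p) (hα : 0 < s - ((m:ℝ) + 1) / p) : ∃ C1, 0 ≤ C1 ∧
    ∀ {v : Spc m} (_ : ‖v‖ ≤ 1) {f : Spc m → ℝ} (_ : Differentiable ℝ f)
    (_ : ∫⁻ z in cube m, ‖grd f z v‖ₑ < ⊤) {N : ℝ} (_ : 0 ≤ N)
    (_ : ∫⁻ x in cube m, ∫⁻ y in cube m, ENNReal.ofReal (‖grd f x v - grd f y v‖ ^ p / ‖x - y‖ ^ ((m:ℝ) + 1 + s * p))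
      ≤ ENNReal.ofReal (N ^ p)),
    (∀ x ∈ CC m, |grd f x v| ≤ C1 * N + 3 ^ (m + 1) * (∫⁻ z in cube m, ‖grd f z v‖ₑ).toReal) ∧
    (∀ x ∈ CC m, ∀ y ∈ CC m, |grd f x v - grd f y v| ≤ C1 * N * ‖x - y‖ ^ (s - ((m:ℝ) + 1) / p)) := by
  obtain ⟨C0, hC0, hst⟩ := TT_step (m := m) hs hp
  set α := s - ((m:ℝ) + 1) / p with hαd
  set r : ℝ := (1 / 2) ^ α with hr
  have hr1 : r < 1 := Real.rpow_lt_one (by norm_num) (by norm_num) hα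
  have hr1' : 0 < 1 - r := by linarith
  refine ⟨C0 + 2 * (C0 / (1 - r)), by positivity, ?_⟩
  intro v hv f hf hi N hN hgN
  have hg : Measurable fun z => grd f z v := measurable_fderiv_apply_const ℝ f v
  have key : ∀ x ∈ CC m, ∀ ρ, 0 < ρ → ρ ≤ 1 → |TT (fun z => grd f z v) v ρ x - grd f x v| ≤ C0 / (1 - r) * N * ρ ^ α := by
    intro x hx ρ hρ hρ1
    have hk0 : ∀ k : ℕ, 0 < ρ * (1 / 2) ^ k := fun k => by positivity
    have hk1 : ∀ k : ℕ, ρ * (1 / 2) ^ k ≤ 1 := fun k =>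
      mul_le_one₀ hρ1 (by positivity) (pow_le_one₀ (by norm_num) (by norm_num))
    have hlim := TT_lim hv hx hf hi hg hk0 hk1 (by
      have := (tendsto_pow_atTop_nhds_zero_of_lt_one (r := (1/2:ℝ)) (by norm_num) (by norm_num)).const_mul ρ
      simpa using this)
    have := dist_le_of_le_geometric_of_tendsto₀ r (C0 * N * ρ ^ α) hr1 (fun k => by
      rw [Real.dist_eq]
      refine (hst hv hx hx (hk0 k) (hk1 k) (ρ' := ρ * (1 / 2) ^ (k + 1)) ?_ ?_ (by rw [sub_self, norm_zero]; exact (hk0 k).le) hg hi hN hgN).trans (le_of_eq ?_)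
      · rw [pow_succ]; linarith
      · rw [pow_succ]; linarith [hk0 k]
      · rw [Real.mul_rpow hρ.le (by positivity), hr, ← Real.rpow_natCast, ← Real.rpow_natCast, ← Real.rpow_mul (by norm_num),
          ← Real.rpow_mul (by norm_num), mul_comm α]; ring) hlim
    rw [pow_zero, mul_one, Real.dist_eq] at this
    refine this.trans (le_of_eq ?_)
    field_simp
  refine ⟨fun x hx => ?_, fun x hx y hy => ?_⟩
  · have h1 := key x hx 1 one_pos le_rfl
    rw [Real.one_rpow, mul_one] at h1
    have h2 : |TT (fun z => grd f z v) v 1 x| ≤ 3 ^ (m + 1) * (∫⁻ z in cube m, ‖grd f z v‖ₑ).toReal := by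
      have a1 : ‖TT (fun z => grd f z v) v 1 x‖ₑ ≤ ENNReal.ofReal ((3 / 1) ^ (m + 1)) * ∫⁻ z in cube m, ‖grd f z v‖ₑ :=
        (enorm_integral_le_lintegral_enorm _).trans (lint_XX hv hx one_pos le_rfl (h := fun z => ‖grd f z v‖ₑ) hg.enorm)
      have a2 := ENNReal.toReal_mono (ENNReal.mul_lt_top ENNReal.ofReal_lt_top hi).ne a1
      rw [toReal_enorm, ENNReal.toReal_mul, ENNReal.toReal_ofReal (by positivity), div_one] at a2
      exact a2
    have h3 : 0 ≤ C0 / (1 - r) * N := by positivity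
    have := abs_sub_abs_le_abs_sub (grd f x v) (TT (fun z => grd f z v) v 1 x)
    rw [abs_sub_comm] at this
    have : 0 ≤ C0 * N := by positivity
    nlinarith
  · rcases eq_or_ne x y with h | h
    · rw [h]; simp [Real.zero_rpow hα.ne']
    have hpos : 0 < ‖x - y‖ := norm_pos_iff.2 (sub_ne_zero.2 h)
    have hle : ‖x - y‖ ≤ 1 := by
      rw [norm_coord zero_le_one]
      refine ⟨abs_le.2 ⟨?_, ?_⟩, fun i => abs_le.2 ⟨?_, ?_⟩⟩
      · have := hx.1.1; have := hy.1.2; simp; linarith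
      · have := hx.1.2; have := hy.1.1; simp; linarith
      · have := (hx.2 i).1; have := (hy.2 i).2; simp; linarith
      · have := (hx.2 i).2; have := (hy.2 i).1; simp; linarith
    have h1 := key x hx _ hpos hle
    have h2 := key y hy _ hpos hle
    have h3 := hst hv hx hy hpos hle (by linarith) le_rfl le_rfl hg hi hN hgN
    have e : grd f x v - grd f y v = -(TT (fun z => grd f z v) v ‖x - y‖ x - grd f x v) +
      (TT (fun z => grd f z v) v ‖x - y‖ x - TT (fun z => grd f z v) v ‖x - y‖ y) +
      (TT (fun z => grd f z v) v ‖x - y‖ y - grd f y v) := by ring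
    rw [e]
    refine (abs_add_le _ _).trans ?_
    have := abs_add_le (-(TT (fun z => grd f z v) v ‖x - y‖ x - grd f x v)) (TT (fun z => grd f z v) v ‖x - y‖ x - TT (fun z => grd f z v) v ‖x - y‖ y)
    rw [abs_neg] at this
    linarith

def zv {m : ℕ} (k : ℤ) (j : Fin m → ℤ) : Spc m := ((k : ℝ), fun i => (j i : ℝ))

lemma per_zv {m : ℕ} {f : Spc m → ℝ} (hf : IsPeriodic f) (x : Spc m) (k : ℤ) (j : Fin m → ℤ) :
    f (x + zv k j) = f x := hf x k j

lemma grd_per {m : ℕ} {f : Spc m → ℝ} (hf : IsPeriodic f) (x : Spc m) (k : ℤ) (j : Fin m → ℤ) :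
    grd f (x + zv k j) = grd f x := by
  unfold grd
  rw [← fderiv_comp_add_right]
  congr 1; funext y; exact per_zv hf y k j

lemma fl_cube {m : ℕ} (x : Spc m) : ∃ y ∈ cube m, x = y + zv ⌊x.1⌋ (fun i => ⌊x.2 i⌋) := by
  refine ⟨x - zv ⌊x.1⌋ (fun i => ⌊x.2 i⌋), ⟨⟨?_, ?_⟩, fun i _ => ⟨?_, ?_⟩⟩, by abel⟩
  · simp [zv]
  · simp [zv, Int.fract_lt_one]
  · simp [zv]
  · simp [zv, Int.fract_lt_one]

lemma per_forall {m : ℕ} {E : Type*} {F : Spc m → E} {P : E → Prop} (hF : ∀ x k j, F (x + zv k j) = F x)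
    (h : ∀ x ∈ cube m, P (F x)) (x : Spc m) : P (F x) := by
  obtain ⟨y, hy, e⟩ := fl_cube x
  rw [e, hF]; exact h y hy

lemma mid1 {x y : ℝ} (h : |x - y| ≤ 1) : ∃ w : ℝ, ((⌊x⌋:ℝ) ≤ w ∧ w ≤ ⌊x⌋ + 1) ∧ ((⌊y⌋:ℝ) ≤ w ∧ w ≤ ⌊y⌋ + 1) ∧
    |x - w| ≤ |x - y| ∧ |w - y| ≤ |x - y| := by
  wlog hxy : x ≤ y generalizing x y
  · obtain ⟨w, h1, h2, h3, h4⟩ := this (x := y) (y := x) (by rwa [abs_sub_comm]) (by linarith)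
    refine ⟨w, h2, h1, ?_, ?_⟩
    · rw [abs_sub_comm, abs_sub_comm x y]; exact h4
    · rw [abs_sub_comm, abs_sub_comm x y]; exact h3
  have a1 := Int.floor_le x
  have a2 := Int.lt_floor_add_one x
  have b1 := Int.floor_le y
  have b2 := Int.lt_floor_add_one y
  have hf := Int.floor_le_floor hxy
  have h' := (abs_le.1 h).1
  rcases hf.eq_or_lt with e | e
  · refine ⟨x, ⟨a1, a2.le⟩, ⟨by rw [← e]; exact a1, by rw [← e]; exact a2.le⟩, by simp, le_rfl⟩
  · have e1 : ((⌊x⌋:ℤ):ℝ) + 1 ≤ ⌊y⌋ := by exact_mod_cast e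
    have e2 : ⌊y⌋ ≤ ⌊x⌋ + 1 := by
      have : (⌊y⌋:ℝ) < ⌊x⌋ + 1 + 1 := by linarith
      have : ⌊y⌋ < ⌊x⌋ + 1 + 1 := by exact_mod_cast this
      omega
    have e3 : (⌊y⌋:ℝ) ≤ ⌊x⌋ + 1 := by exact_mod_cast e2
    refine ⟨⌊y⌋, ⟨by linarith, e3⟩, ⟨le_rfl, by linarith⟩, ?_, ?_⟩
    · rw [abs_sub_comm x y, abs_sub_comm, abs_of_nonneg, abs_of_nonneg] <;> linarith
    · rw [abs_sub_comm x y, abs_sub_comm, abs_of_nonneg, abs_of_nonneg] <;> linarith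

lemma mid {m : ℕ} {x y : Spc m} (h : ‖x - y‖ ≤ 1) : ∃ w : Spc m,
    x - zv ⌊x.1⌋ (fun i => ⌊x.2 i⌋) ∈ CC m ∧ w - zv ⌊x.1⌋ (fun i => ⌊x.2 i⌋) ∈ CC m ∧
    w - zv ⌊y.1⌋ (fun i => ⌊y.2 i⌋) ∈ CC m ∧ y - zv ⌊y.1⌋ (fun i => ⌊y.2 i⌋) ∈ CC m ∧
    ‖x - w‖ ≤ ‖x - y‖ ∧ ‖w - y‖ ≤ ‖x - y‖ := by
  have hc := (norm_coord zero_le_one).1 h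
  have hc' := (norm_coord (norm_nonneg (x - y))).1 le_rfl
  obtain ⟨w1, p1, p2, p3, p4⟩ := mid1 (x := x.1) (y := y.1) hc.1
  choose w2 q1 q2 q3 q4 using fun i => mid1 (x := x.2 i) (y := y.2 i) (hc.2 i)
  refine ⟨(w1, w2), ?_, ?_, ?_, ?_, ?_, ?_⟩
  · refine ⟨⟨?_, ?_⟩, fun i => ⟨?_, ?_⟩⟩ <;> simp [zv, (Int.fract_lt_one _).le]
  · refine ⟨⟨?_, ?_⟩, fun i => ⟨?_, ?_⟩⟩ <;> simp [zv]
    · exact p1.1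
    · linarith [p1.2]
    · exact (q1 i).1
    · linarith [(q1 i).2]
  · refine ⟨⟨?_, ?_⟩, fun i => ⟨?_, ?_⟩⟩ <;> simp [zv]
    · exact p2.1
    · linarith [p2.2]
    · exact (q2 i).1
    · linarith [(q2 i).2]
  · refine ⟨⟨?_, ?_⟩, fun i => ⟨?_, ?_⟩⟩ <;> simp [zv, (Int.fract_lt_one _).le]
  · exact (norm_coord (norm_nonneg _)).2 ⟨p3.trans hc'.1, fun i => (q3 i).trans (hc'.2 i)⟩
  · exact (norm_coord (norm_nonneg _)).2 ⟨p4.trans hc'.1, fun i => (q4 i).trans (hc'.2 i)⟩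

lemma hyp2_p {m : ℕ} {σ p : ℝ} (h2 : Hyp2 m σ p) : 1 ≤ p ∧ 1 < σ ∧ 0 < σ - 1 - ((m:ℝ) + 1) / p := by
  obtain ⟨h, h', h'', h3⟩ := h2
  have : (0:ℝ) ≤ m := by positivity
  have hp : 0 < p := by linarith
  have : 0 < ((m:ℝ) + 1) / p := by positivity
  exact ⟨by linarith, by linarith, by linarith⟩

lemma WNorm_eq {m : ℕ} {σ p : ℝ} (h2 : Hyp2 m σ p) (f : Spc m → ℝ) :
    WNorm σ p f = LpN p f + eLpNorm (fun x => ‖grd f x‖) (ENNReal.ofReal p) (μT m) + gagl (σ - 1) p (grd f) := by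
  have := hyp2_p h2
  unfold WNorm
  rw [if_neg (by linarith), if_neg (by linarith), if_pos h2.2.2.2, if_neg (by linarith)]

lemma sob_CC {m : ℕ} {σ p : ℝ} (h2 : Hyp2 m σ p) : ∃ C, 0 ≤ C ∧ ∀ f : Spc m → ℝ, Differentiable ℝ f →
    WNorm σ p f < ⊤ → (∀ x ∈ CC m, ‖grd f x‖ ≤ C * (WNorm σ p f).toReal) ∧
    (∀ x ∈ CC m, ∀ y ∈ CC m, ‖grd f x - grd f y‖ ≤ C * (WNorm σ p f).toReal * ‖x - y‖ ^ (σ - 1 - ((m:ℝ) + 1) / p)) := by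
  obtain ⟨hp, hσ, hα⟩ := hyp2_p h2
  have hp0 : 0 < p := by linarith
  obtain ⟨C1, hC1, H⟩ := TT_grd (m := m) (s := σ - 1) (by linarith) hp hα
  refine ⟨C1 + 3 ^ (m + 1), by positivity, ?_⟩
  intro f hf hW
  set W := (WNorm σ p f).toReal with hWd
  have hW0 : 0 ≤ W := ENNReal.toReal_nonneg
  have hWe : WNorm σ p f = ENNReal.ofReal W := (ENNReal.ofReal_toReal hW.ne).symm
  have hgag : gagl (σ - 1) p (grd f) ≤ ENNReal.ofReal W := by
    rw [← hWe, WNorm_eq h2]; exact le_add_self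
  have hgrd : eLpNorm (fun x => ‖grd f x‖) (ENNReal.ofReal p) (μT m) ≤ ENNReal.ofReal W := by
    rw [← hWe, WNorm_eq h2]; exact le_add_right le_add_self
  have hgm : Measurable (grd f) := measurable_fderiv ℝ f
  have hint : ∫⁻ z in cube m, ‖grd f z‖ₑ ≤ ENNReal.ofReal W := by
    refine le_trans ?_ hgrd
    rw [eLpNorm_norm]
    refine le_trans ?_ (eLpNorm_le_eLpNorm_of_exponent_le (p := 1) ?_ hgm.aestronglyMeasurable)
    · rw [eLpNorm_one_eq_lintegral_enorm]; rfl
    · rw [← ENNReal.ofReal_one]; exact ENNReal.ofReal_le_ofReal hp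
  have hgag' : ∫⁻ x in cube m, ∫⁻ y in cube m, ENNReal.ofReal (‖grd f x - grd f y‖ ^ p / ‖x - y‖ ^ ((m:ℝ) + 1 + (σ - 1) * p))
      ≤ ENNReal.ofReal (W ^ p) := by
    unfold gagl at hgag
    have := ENNReal.rpow_le_rpow hgag hp0.le
    rwa [one_div, ENNReal.rpow_inv_rpow hp0.ne', ENNReal.ofReal_rpow_of_nonneg hW0 hp0.le] at this
  have hv1 : ∀ v : Spc m, ‖v‖ ≤ 1 → ∫⁻ z in cube m, ‖grd f z v‖ₑ ≤ ENNReal.ofReal W := by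
    intro v hv
    refine (lintegral_mono fun z => ?_).trans hint
    rw [← ofReal_norm, ← ofReal_norm]
    exact ENNReal.ofReal_le_ofReal (ContinuousLinearMap.unit_le_opNorm _ _ hv)
  have hv2 : ∀ v : Spc m, ‖v‖ ≤ 1 → ∫⁻ x in cube m, ∫⁻ y in cube m,
      ENNReal.ofReal (‖grd f x v - grd f y v‖ ^ p / ‖x - y‖ ^ ((m:ℝ) + 1 + (σ - 1) * p)) ≤ ENNReal.ofReal (W ^ p) := by
    intro v hv
    refine (lintegral_mono fun x => lintegral_mono fun y => ENNReal.ofReal_le_ofReal ?_).trans hgag'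
    have : ‖grd f x v - grd f y v‖ ≤ ‖grd f x - grd f y‖ := (grd f x - grd f y).unit_le_opNorm _ hv
    gcongr
  constructor
  · intro x hx
    refine ContinuousLinearMap.opNorm_le_of_unit_norm (by positivity) fun v hv => ?_
    have h := (H hv.le hf ((hv1 v hv.le).trans_lt ENNReal.ofReal_lt_top) hW0 (hv2 v hv.le)).1 x hx
    have h3 := ENNReal.toReal_mono ENNReal.ofReal_ne_top (hv1 v hv.le)
    rw [ENNReal.toReal_ofReal hW0] at h3
    rw [add_mul, Real.norm_eq_abs]
    exact h.trans (by gcongr)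
  · intro x hx y hy
    refine ContinuousLinearMap.opNorm_le_of_unit_norm (by positivity) fun v hv => ?_
    have h := (H hv.le hf ((hv1 v hv.le).trans_lt ENNReal.ofReal_lt_top) hW0 (hv2 v hv.le)).2 x hx y hy
    refine le_trans h ?_
    have : 0 ≤ (3:ℝ) ^ (m + 1) := by positivity
    gcongr; linarith

lemma sob {m : ℕ} {σ p : ℝ} (h2 : Hyp2 m σ p) : ∃ C, 0 ≤ C ∧ ∀ f : Spc m → ℝ, IsPeriodic f → Differentiable ℝ f →
    WNorm σ p f < ⊤ → (∀ x, |f x| ≤ C * (WNorm σ p f).toReal) ∧ (∀ x, ‖grd f x‖ ≤ C * (WNorm σ p f).toReal) ∧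
    (∀ x y, ‖grd f x - grd f y‖ ≤ C * (WNorm σ p f).toReal * ‖x - y‖ ^ (σ - 1 - ((m:ℝ) + 1) / p)) := by
  obtain ⟨hp, hσ, hα⟩ := hyp2_p h2
  obtain ⟨C, hC, H⟩ := sob_CC h2
  set α := σ - 1 - ((m:ℝ) + 1) / p
  refine ⟨1 + 2 * C, by positivity, ?_⟩
  intro f hper hf hW
  obtain ⟨H1, H2⟩ := H f hf hW
  have hWe : WNorm σ p f = ENNReal.ofReal (WNorm σ p f).toReal := (ENNReal.ofReal_toReal hW.ne).symm
  set W := (WNorm σ p f).toReal with hWd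
  have hW0 : 0 ≤ W := ENNReal.toReal_nonneg
  have hCW : 0 ≤ C * W := by positivity
  have G1 : ∀ x, ‖grd f x‖ ≤ C * W := fun x =>
    per_forall (F := grd f) (P := fun a => ‖a‖ ≤ C * W) (grd_per hper) (fun x hx => H1 x (cube_sub_CC hx)) x
  have F1 : ∀ x, |f x| ≤ (1 + C) * W := by
    refine fun x => per_forall (F := f) (P := fun a => |a| ≤ (1 + C) * W) (per_zv hper) (fun x hx => ?_) x
    have b : ∀ y ∈ cube m, ‖f x‖ₑ ≤ ‖f y‖ₑ + ENNReal.ofReal (C * W) := by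
      intro y hy
      have h1 : ‖f x - f y‖ ≤ C * W * ‖x - y‖ := convex_univ.norm_image_sub_le_of_norm_fderiv_le
        (fun z _ => hf z) (fun z _ => G1 z) (mem_univ y) (mem_univ x)
      have h2 : ‖x - y‖ ≤ 1 := by
        rw [norm_coord zero_le_one]
        have hx := cube_sub_CC hx; have hy := cube_sub_CC hy
        refine ⟨abs_le.2 ⟨?_, ?_⟩, fun i => abs_le.2 ⟨?_, ?_⟩⟩
        · have := hx.1.1; have := hy.1.2; simp; linarith
        · have := hx.1.2; have := hy.1.1; simp; linarith
        · have := (hx.2 i).1; have := (hy.2 i).2; simp; linarith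
        · have := (hx.2 i).2; have := (hy.2 i).1; simp; linarith
      rw [← ofReal_norm, ← ofReal_norm, ← ENNReal.ofReal_add (norm_nonneg _) hCW]
      apply ENNReal.ofReal_le_ofReal
      have := norm_le_norm_add_norm_sub' (f x) (f y)
      nlinarith
    have b2 : ‖f x‖ₑ ≤ ENNReal.ofReal W + ENNReal.ofReal (C * W) := by
      calc ‖f x‖ₑ = ∫⁻ y, ‖f x‖ₑ ∂(μT m) := by simp
        _ ≤ ∫⁻ y, (‖f y‖ₑ + ENNReal.ofReal (C * W)) ∂(μT m) := by
          refine lintegral_mono_ae ((ae_restrict_iff' (meas_cube m)).2 (Eventually.of_forall b))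
        _ = eLpNorm f 1 (μT m) + ENNReal.ofReal (C * W) := by
          rw [lintegral_add_right _ measurable_const, eLpNorm_one_eq_lintegral_enorm]; simp
        _ ≤ _ := by
          gcongr
          rw [← hWe, WNorm_eq h2, add_assoc]
          refine le_add_right (eLpNorm_le_eLpNorm_of_exponent_le ?_ hf.continuous.aestronglyMeasurable)
          rw [← ENNReal.ofReal_one]; exact ENNReal.ofReal_le_ofReal hp
    rw [← ofReal_norm, ← ENNReal.ofReal_add hW0 hCW, ENNReal.ofReal_le_ofReal_iff (by positivity)] at b2
    rw [Real.norm_eq_abs] at b2; linarith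
  refine ⟨fun x => (F1 x).trans (by nlinarith), fun x => (G1 x).trans (by nlinarith), fun x y => ?_⟩
  have hxy : 0 ≤ ‖x - y‖ ^ α := by positivity
  have hfin : C * W * ‖x - y‖ ^ α + C * W * ‖x - y‖ ^ α ≤ (1 + 2 * C) * W * ‖x - y‖ ^ α := by
    have := mul_nonneg hW0 hxy; nlinarith
  rcases le_total ‖x - y‖ 1 with hle | hle
  · obtain ⟨w, a1, a2, a3, a4, a5, a6⟩ := mid hle
    have e : ∀ (u : Spc m) k j, grd f u = grd f (u - zv k j) := fun u k j => by
      rw [← grd_per hper (u - zv k j) k j, sub_add_cancel]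
    have h1 := H2 _ a1 _ a2
    have h2 := H2 _ a3 _ a4
    rw [← e, ← e, sub_sub_sub_cancel_right] at h1 h2
    have := norm_add_le (grd f x - grd f w) (grd f w - grd f y)
    rw [sub_add_sub_cancel] at this
    refine this.trans (le_trans (add_le_add (h1.trans ?_) (h2.trans ?_)) hfin)
    · exact mul_le_mul_of_nonneg_left (Real.rpow_le_rpow (norm_nonneg _) a5 hα.le) hCW
    · exact mul_le_mul_of_nonneg_left (Real.rpow_le_rpow (norm_nonneg _) a6 hα.le) hCW
  · have h1 : 1 ≤ ‖x - y‖ ^ α := Real.one_le_rpow hle hα.le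
    have := norm_sub_le (grd f x) (grd f y)
    have := G1 x; have := G1 y
    nlinarith

def zhom (m : ℕ) : (ℤ × (Fin m → ℤ)) →+ Spc m where
  toFun q := zv q.1 q.2
  map_zero' := by ext <;> simp [zv]
  map_add' a b := by ext <;> simp [zv]

def LZ (m : ℕ) : AddSubgroup (Spc m) := (zhom m).range

instance cntLZ (m : ℕ) : Countable (LZ m) := by
  have : Countable (zhom m).range := (zhom m).rangeRestrict_surjective.countable
  exact this

lemma fd_cube (m : ℕ) : IsAddFundamentalDomain (LZ m) (cube m) := by
  refine IsAddFundamentalDomain.mk' (meas_cube m).nullMeasurableSet fun x => ?_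
  refine ⟨⟨zv (-⌊x.1⌋) (fun i => -⌊x.2 i⌋), ⟨(-⌊x.1⌋, fun i => -⌊x.2 i⌋), rfl⟩⟩, ?_, ?_⟩
  · show zv (-⌊x.1⌋) (fun i => -⌊x.2 i⌋) + x ∈ cube m
    refine ⟨⟨?_, ?_⟩, fun i _ => ⟨?_, ?_⟩⟩ <;> simp [zv]
    · exact Int.floor_le _
    · exact Int.floor_le _
  · rintro ⟨_, ⟨k, j⟩, rfl⟩ h
    have h : zv k j + x ∈ cube m := h
    have key : ∀ (k : ℤ) (r : ℝ), 0 ≤ (k:ℝ) + r → (k:ℝ) + r < 1 → k = -⌊r⌋ := by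
      intro k r h1 h2
      have : ⌊r⌋ = -k := by rw [Int.floor_eq_iff]; push_cast; constructor <;> linarith
      omega
    have e1 := key k x.1 h.1.1 h.1.2
    have e2 : j = fun i => -⌊x.2 i⌋ := funext fun i => key (j i) (x.2 i) (h.2 i (mem_univ i)).1 (h.2 i (mem_univ i)).2
    refine Subtype.ext ?_
    show zv k j = _
    rw [e1, e2]

open Pointwise in
lemma int_trans {m : ℕ} {h : Spc m → ℝ} (hh : IsPeriodic h) (a : Spc m) :
    ∫ x in cube m, h (a + x) = ∫ x in cube m, h x := by
  have h1 := fd_cube m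
  have h2 : IsAddFundamentalDomain (LZ m) (a +ᵥ cube m) := h1.vadd_of_comm a
  have h3 := h1.setIntegral_eq h2 (f := h) (by
    rintro ⟨_, ⟨k, j⟩, rfl⟩ x
    show h (zv k j + x) = h x
    rw [add_comm]; exact per_zv hh x k j)
  rw [h3, ← image_vadd]
  have := (measurePreserving_add_left (volume : Measure (Spc m)) a).setIntegral_image_emb
    (measurableEmbedding_addLeft a) h (cube m)
  exact this.symm

lemma int_trans' {m : ℕ} {h : Spc m → ℝ} (hh : IsPeriodic h) (a : Spc m) :
    ∫ x in cube m, h (x - a) = ∫ x in cube m, h x := by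
  rw [← int_trans hh (-a)]; simp_rw [neg_add_eq_sub]

lemma int_pd_zero {m : ℕ} {h : Spc m → ℝ} (hh : IsPeriodic h) (hd : Differentiable ℝ h) {B : ℝ}
    (hB : ∀ x, ‖grd h x‖ ≤ B) {A : ℝ} (hA : ∀ x, |h x| ≤ A) (v : Spc m) : ∫ x in cube m, pd v h x = 0 := by
  have hm : AEStronglyMeasurable (fun x => pd v h x) (μT m) := (measurable_fderiv_apply_const ℝ h v).aestronglyMeasurable
  have key := hasDerivAt_integral_of_dominated_loc_of_deriv_le (μ := μT m) (F := fun (s : ℝ) (x : Spc m) => h (s • v + x))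
    (F' := fun s x => pd v h (s • v + x)) (x₀ := 0) (s := univ) (bound := fun _ => B * ‖v‖) univ_mem
    (Eventually.of_forall fun s => (hd.continuous.comp (by fun_prop : Continuous fun x : Spc m => s • v + x)).aestronglyMeasurable)
    (Integrable.of_bound (C := A) (hd.continuous.comp (by fun_prop : Continuous fun x : Spc m => (0:ℝ) • v + x)).aestronglyMeasurable
      (Eventually.of_forall fun x => hA _)) (by simpa using hm)
    (Eventually.of_forall fun x s _ => ((grd h (s • v + x)).le_opNorm v).trans
      (mul_le_mul_of_nonneg_right (hB _) (norm_nonneg _))) (integrable_const _)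
    (Eventually.of_forall fun x s _ => by
      have h1 : HasDerivAt (fun s : ℝ => s • v + x) ((1:ℝ) • v) s := ((hasDerivAt_id s).smul_const v).add_const x
      rw [one_smul] at h1
      exact (hd (s • v + x)).hasFDerivAt.comp_hasDerivAt s h1)
  have h2 : (fun s : ℝ => ∫ x, h (s • v + x) ∂(μT m)) = fun _ => ∫ x in cube m, h x := by
    funext s; exact int_trans hh (s • v)
  have h3 := key.2
  rw [h2] at h3
  have := h3.unique (hasDerivAt_const _ _)
  unfold μT at this
  simpa using this

def mi {m : ℕ} (h : Spc m → ℝ) (x : Spc m) : ℝ := ∫ y in cube1 m, h (x.1, y)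

instance prob1 (m : ℕ) : IsProbabilityMeasure (volume.restrict (cube1 m)) := ⟨by simp [vol_cube1]⟩

lemma mi_int {m : ℕ} {h : Spc m → ℝ} (hc : Continuous h) {M : ℝ} (hM : ∀ x, |h x| ≤ M) (s : ℝ) :
    Integrable (fun y => h (s, y)) (volume.restrict (cube1 m)) :=
  Integrable.of_bound (C := M) (hc.comp (by fun_prop : Continuous fun y : Fin m → ℝ => (s, y))).aestronglyMeasurable
    (Eventually.of_forall fun y => hM _)

lemma mi_le {m : ℕ} {h : Spc m → ℝ} {M : ℝ} (hM : ∀ x, |h x| ≤ M) (x : Spc m) : |mi h x| ≤ M := by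
  have := norm_integral_le_of_norm_le_const (μ := volume.restrict (cube1 m)) (f := fun y => h (x.1, y)) (C := M)
    (Eventually.of_forall fun y => hM _)
  simpa [mi, Measure.real] using this

lemma mi_sub {m : ℕ} {h g : Spc m → ℝ} (hc : Continuous h) (gc : Continuous g) {M : ℝ} (hM : ∀ x, |h x| ≤ M)
    {M' : ℝ} (hM' : ∀ x, |g x| ≤ M') (x : Spc m) : mi h x - mi g x = mi (fun z => h z - g z) x := by
  unfold mi; rw [integral_sub (mi_int hc hM _) (mi_int gc hM' _)]

lemma mi_cont {m : ℕ} {h : Spc m → ℝ} (hc : Continuous h) {M : ℝ} (hM : ∀ x, |h x| ≤ M) : Continuous (mi h) := by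
  have : Continuous fun s : ℝ => ∫ y in cube1 m, h (s, y) := by
    refine continuous_of_dominated (bound := fun _ => M) (fun s => (mi_int hc hM s).aestronglyMeasurable)
      (fun s => Eventually.of_forall fun y => hM _) (integrable_const _) (Eventually.of_forall fun y => ?_)
    exact hc.comp (by fun_prop : Continuous fun s : ℝ => (s, y))
  exact this.comp continuous_fst

lemma mi_deriv {m : ℕ} {h : Spc m → ℝ} (hd : Differentiable ℝ h) {B : ℝ}
    (hB : ∀ x, ‖grd h x‖ ≤ B) {A : ℝ} (hA : ∀ x, |h x| ≤ A) (hc : Continuous (grd h)) (x : Spc m) :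
    HasDerivAt (fun s : ℝ => ∫ y in cube1 m, h (s, y)) (mi (pd (e1 m) h) x) x.1 := by
  have key := hasDerivAt_integral_of_dominated_loc_of_deriv_le (μ := volume.restrict (cube1 m))
    (F := fun (s : ℝ) (y : Fin m → ℝ) => h (s, y))
    (F' := fun s y => pd (e1 m) h (s, y)) (x₀ := x.1) (s := univ) (bound := fun _ => B * ‖e1 m‖) univ_mem
    (Eventually.of_forall fun s => (mi_int hd.continuous hA s).aestronglyMeasurable)
    (mi_int hd.continuous hA _)
    (Continuous.aestronglyMeasurable (by
      have h1 : Continuous fun y : Fin m → ℝ => grd h (x.1, y) := hc.comp (by fun_prop)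
      exact h1.clm_apply continuous_const))
    (Eventually.of_forall fun x s _ => ((grd h _).le_opNorm _).trans
      (mul_le_mul_of_nonneg_right (hB _) (norm_nonneg _))) (integrable_const _)
    (Eventually.of_forall fun y s _ => by
      have h1 : HasDerivAt (fun s : ℝ => ((s, y) : Spc m)) (e1 m) s := (hasDerivAt_id s).prodMk (hasDerivAt_const s y)
      exact (hd _).hasFDerivAt.comp_hasDerivAt s h1)
  exact key.2

lemma per_bdd {m : ℕ} {E : Type*} [NormedAddCommGroup E] {F : Spc m → E} (hF : ∀ x k j, F (x + zv k j) = F x)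
    (hc : Continuous F) : ∃ B, 0 ≤ B ∧ ∀ x, ‖F x‖ ≤ B := by
  obtain ⟨B, hB⟩ := (isCompact_Icc (a := (0 : Spc m)) (b := one1 m)).exists_bound_of_continuousOn hc.continuousOn
  refine ⟨max B 0, le_max_right _ _, fun x => ?_⟩
  refine per_forall (F := F) (P := fun a => ‖a‖ ≤ max B 0) hF (fun x hx => (hB x ?_).trans (le_max_left _ _)) x
  have := cube_sub_CC hx
  exact ⟨⟨this.1.1, fun i => (this.2 i).1⟩, ⟨this.1.2, fun i => (this.2 i).2⟩⟩

/-- `C¹` periodic functions. -/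
structure C1p {m : ℕ} (h : Spc m → ℝ) : Prop where
  cd : ContDiff ℝ 1 h
  per : IsPeriodic h

namespace C1p
variable {m : ℕ} {h g : Spc m → ℝ}
lemma diff (H : C1p h) : Differentiable ℝ h := H.cd.differentiable one_ne_zero
lemma cont (H : C1p h) : Continuous h := H.cd.continuous
lemma contg (H : C1p h) : Continuous (grd h) := H.cd.continuous_fderiv one_ne_zero
lemma bdd (H : C1p h) : ∃ B, 0 ≤ B ∧ ∀ x, |h x| ≤ B := per_bdd (per_zv H.per) H.cont
lemma bddg (H : C1p h) : ∃ B, 0 ≤ B ∧ ∀ x, ‖grd h x‖ ≤ B := per_bdd (grd_per H.per) H.contg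
lemma pdc (H : C1p h) (v : Spc m) : Continuous (pd v h) := H.contg.clm_apply continuous_const
lemma mul (H : C1p h) (G : C1p g) : C1p (fun x => h x * g x) :=
  ⟨H.cd.mul G.cd, fun x k j => by simp only [H.per x k j, G.per x k j]⟩
lemma sub (H : C1p h) (G : C1p g) : C1p (fun x => h x - g x) :=
  ⟨H.cd.sub G.cd, fun x k j => by simp only [H.per x k j, G.per x k j]⟩
lemma div (H : C1p h) (G : C1p g) (h0 : ∀ x, g x ≠ 0) : C1p (fun x => h x / g x) :=
  ⟨H.cd.div G.cd h0, fun x k j => by simp only [H.per x k j, G.per x k j]⟩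
lemma pd_mul (H : C1p h) (G : C1p g) (v x : Spc m) : pd v (fun z => h z * g z) x = pd v h x * g x + h x * pd v g x := by
  unfold pd
  rw [fderiv_fun_mul (H.diff x) (G.diff x)]
  simp; ring
lemma pd_sub (H : C1p h) (G : C1p g) (v x : Spc m) : pd v (fun z => h z - g z) x = pd v h x - pd v g x := by
  unfold pd
  rw [fderiv_fun_sub (H.diff x) (G.diff x)]; rfl
lemma pd_div (H : C1p h) (G : C1p g) (h0 : ∀ x, g x ≠ 0) (v x : Spc m) :
    pd v (fun z => h z / g z) x = (pd v h x * g x - h x * pd v g x) * ((g x)⁻¹ * (g x)⁻¹) := by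
  have h1 := (H.div G h0).pd_mul G v x
  have h2 : (fun z => h z / g z * g z) = h := by funext z; rw [div_mul_cancel₀ _ (h0 z)]
  rw [h2] at h1
  have := h0 x
  have h3 : pd v (fun z => h z / g z) x = (pd v h x - h x / g x * pd v g x) / g x := by
    rw [h1]; field_simp; ring
  rw [h3]; field_simp
lemma int_pd (H : C1p h) (v : Spc m) : ∫ x in cube m, pd v h x = 0 := by
  obtain ⟨B, _, hB⟩ := H.bddg
  obtain ⟨A, _, hA⟩ := H.bdd
  exact int_pd_zero H.per H.diff hB hA v
lemma hasF_mi (H : C1p h) (x : Spc m) :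
    HasFDerivAt (mi h) (mi (pd (e1 m) h) x • ContinuousLinearMap.fst ℝ ℝ (Fin m → ℝ)) x := by
  obtain ⟨B, _, hB⟩ := H.bddg
  obtain ⟨A, _, hA⟩ := H.bdd
  have h1 := mi_deriv H.diff hB hA H.contg x
  have h2 := h1.hasFDerivAt.comp x (ContinuousLinearMap.fst ℝ ℝ (Fin m → ℝ)).hasFDerivAt
  refine h2.congr_fderiv ?_
  ext <;> simp
end C1p

lemma pd_per {m : ℕ} {h : Spc m → ℝ} (hh : IsPeriodic h) (v : Spc m) : IsPeriodic (pd v h) := fun x k j => by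
  show grd h (x + zv k j) v = grd h x v
  rw [grd_per hh]

lemma mi_per {m : ℕ} {h : Spc m → ℝ} (hh : IsPeriodic h) : IsPeriodic (mi h) := fun x k j => by
  unfold mi
  refine integral_congr_ae (Eventually.of_forall fun y => ?_)
  have := hh (x.1, y) k 0
  simpa using this

lemma C1p.bddp {m : ℕ} {h : Spc m → ℝ} (H : C1p h) (v : Spc m) : ∃ B, 0 ≤ B ∧ ∀ x, |pd v h x| ≤ B :=
  per_bdd (per_zv (pd_per H.per v)) (H.pdc v)

lemma C1p.mi {m : ℕ} {h : Spc m → ℝ} (H : C1p h) : C1p (mi h) := by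
  refine ⟨contDiff_one_iff_fderiv.2 ⟨fun x => (H.hasF_mi x).differentiableAt, ?_⟩, mi_per H.per⟩
  have : fderiv ℝ (_root_.mi h) = fun x => _root_.mi (pd (e1 m) h) x • ContinuousLinearMap.fst ℝ ℝ (Fin m → ℝ) :=
    funext fun x => (H.hasF_mi x).fderiv
  rw [this]
  obtain ⟨B, _, hB⟩ := H.bddp (e1 m)
  exact (mi_cont (H.pdc _) hB).smul continuous_const

lemma C1p.pd_mi {m : ℕ} {h : Spc m → ℝ} (H : C1p h) (x : Spc m) :
    pd (e1 m) (_root_.mi h) x = _root_.mi (pd (e1 m) h) x := by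
  unfold pd; rw [(H.hasF_mi x).fderiv]; simp [e1]; rfl

structure SS {m : ℕ} (B c : ℝ) (ψ : Spc m → ℝ) : Prop where
  c1 : C1p ψ
  b0 : ∀ x, |ψ x| ≤ B
  b1 : ∀ x, ‖grd ψ x‖ ≤ B
  mp : ∀ x, c ≤ mi ψ x

def Cl {m : ℕ} (ψ ψ' : Spc m → ℝ) (δ : ℝ) : Prop := ∀ x, |ψ x - ψ' x| ≤ δ ∧ ‖grd ψ x - grd ψ' x‖ ≤ δ

structure Good {m : ℕ} (B c : ℝ) (Q : (Spc m → ℝ) → Spc m → ℝ) : Prop where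
  cont : ∀ ψ, SS B c ψ → Continuous (Q ψ)
  per : ∀ ψ, SS B c ψ → IsPeriodic (Q ψ)
  bd : ∃ M, 0 ≤ M ∧ ∀ ψ, SS B c ψ → ∀ x, |Q ψ x| ≤ M
  lip : ∃ K, 0 ≤ K ∧ ∀ ψ, SS B c ψ → ∀ ψ', SS B c ψ' → ∀ δ, Cl ψ ψ' δ → ∀ x, |Q ψ x - Q ψ' x| ≤ K * δ

lemma Cl.nn {m : ℕ} {ψ ψ' : Spc m → ℝ} {δ : ℝ} (h : Cl ψ ψ' δ) : 0 ≤ δ := (abs_nonneg _).trans (h 0).1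

namespace Good
variable {m : ℕ} {B c : ℝ} {Q R : (Spc m → ℝ) → Spc m → ℝ}
lemma const {g : Spc m → ℝ} (hc : Continuous g) (hp : IsPeriodic g) : Good B c (fun _ => g) :=
  ⟨fun _ _ => hc, fun _ _ => hp, by
    obtain ⟨M, hM, h⟩ := per_bdd (per_zv hp) hc
    exact ⟨M, hM, fun _ _ => h⟩, ⟨0, le_rfl, fun _ _ _ _ _ _ _ => by simp⟩⟩
lemma idd (hB : 0 ≤ B) : Good (m := m) B c (fun ψ => ψ) :=
  ⟨fun _ h => h.c1.cont, fun _ h => h.c1.per, ⟨B, hB, fun _ h => h.b0⟩,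
    ⟨1, zero_le_one, fun ψ _ ψ' _ δ h x => by rw [one_mul]; exact (h x).1⟩⟩
lemma pdd (hB : 0 ≤ B) (v : Spc m) : Good B c (fun ψ => pd v ψ) :=
  ⟨fun _ h => h.c1.pdc v, fun _ h => pd_per h.c1.per v, ⟨B * ‖v‖, by positivity, fun ψ h x =>
      ((grd ψ x).le_opNorm v).trans (mul_le_mul_of_nonneg_right (h.b1 x) (norm_nonneg _))⟩,
    ⟨‖v‖, norm_nonneg _, fun ψ _ ψ' _ δ h x => by
      have := ((grd ψ x - grd ψ' x).le_opNorm v).trans (mul_le_mul_of_nonneg_right (h x).2 (norm_nonneg _))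
      rw [mul_comm]; exact this⟩⟩
lemma add (hQ : Good B c Q) (hR : Good B c R) : Good B c (fun ψ x => Q ψ x + R ψ x) := by
  obtain ⟨M, hM, h⟩ := hQ.bd
  obtain ⟨M', hM', h'⟩ := hR.bd
  obtain ⟨K, hK, l⟩ := hQ.lip
  obtain ⟨K', hK', l'⟩ := hR.lip
  refine ⟨fun ψ hψ => (hQ.cont ψ hψ).add (hR.cont ψ hψ), fun ψ hψ x k j => by
    simp only [hQ.per ψ hψ x k j, hR.per ψ hψ x k j], ⟨M + M', by positivity, fun ψ hψ x =>
    (abs_add_le _ _).trans (add_le_add (h ψ hψ x) (h' ψ hψ x))⟩, ⟨K + K', by positivity, ?_⟩⟩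
  intro ψ hψ ψ' hψ' δ hδ x
  rw [add_sub_add_comm, add_mul]
  exact (abs_add_le _ _).trans (add_le_add (l ψ hψ ψ' hψ' δ hδ x) (l' ψ hψ ψ' hψ' δ hδ x))
lemma mul (hQ : Good B c Q) (hR : Good B c R) : Good B c (fun ψ x => Q ψ x * R ψ x) := by
  obtain ⟨M, hM, h⟩ := hQ.bd
  obtain ⟨M', hM', h'⟩ := hR.bd
  obtain ⟨K, hK, l⟩ := hQ.lip
  obtain ⟨K', hK', l'⟩ := hR.lip
  refine ⟨fun ψ hψ => (hQ.cont ψ hψ).mul (hR.cont ψ hψ), fun ψ hψ x k j => by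
    simp only [hQ.per ψ hψ x k j, hR.per ψ hψ x k j], ⟨M * M', by positivity, fun ψ hψ x => by
    rw [abs_mul]; exact mul_le_mul (h ψ hψ x) (h' ψ hψ x) (abs_nonneg _) hM⟩, ⟨M * K' + K * M', by positivity, ?_⟩⟩
  intro ψ hψ ψ' hψ' δ hδ x
  have hn := hδ.nn
  have e : Q ψ x * R ψ x - Q ψ' x * R ψ' x = Q ψ x * (R ψ x - R ψ' x) + (Q ψ x - Q ψ' x) * R ψ' x := by ring
  rw [e]
  refine (abs_add_le _ _).trans ?_
  rw [abs_mul, abs_mul]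
  have a1 := mul_le_mul (h ψ hψ x) (l' ψ hψ ψ' hψ' δ hδ x) (abs_nonneg _) hM
  have a2 := mul_le_mul (l ψ hψ ψ' hψ' δ hδ x) (h' ψ' hψ' x) (abs_nonneg _) (by positivity)
  linarith
lemma neg (hQ : Good B c Q) : Good B c (fun ψ x => - Q ψ x) := by
  have := (const (B := B) (c := c) (m := m) (g := fun _ => -1) continuous_const (fun _ _ _ => rfl)).mul hQ
  simpa using this
lemma sub (hQ : Good B c Q) (hR : Good B c R) : Good B c (fun ψ x => Q ψ x - R ψ x) := by
  simpa [sub_eq_add_neg] using hQ.add hR.neg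
lemma sum {ι : Type*} (s : Finset ι) {Q : ι → (Spc m → ℝ) → Spc m → ℝ} (hQ : ∀ i, Good B c (Q i)) :
    Good B c (fun ψ x => ∑ i ∈ s, Q i ψ x) := by
  classical
  induction s using Finset.induction_on with
  | empty => simpa using const (B := B) (c := c) (m := m) (g := fun _ => 0) continuous_const (fun _ _ _ => rfl)
  | insert a s ha ih => simp_rw [Finset.sum_insert ha]; exact (hQ a).add ih
lemma mi (hQ : Good B c Q) : Good B c (fun ψ => mi (Q ψ)) := by
  obtain ⟨M, hM, h⟩ := hQ.bd
  obtain ⟨K, hK, l⟩ := hQ.lip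
  refine ⟨fun ψ hψ => mi_cont (hQ.cont ψ hψ) (h ψ hψ), fun ψ hψ => mi_per (hQ.per ψ hψ),
    ⟨M, hM, fun ψ hψ => mi_le (h ψ hψ)⟩, ⟨K, hK, fun ψ hψ ψ' hψ' δ hδ x => ?_⟩⟩
  rw [mi_sub (hQ.cont ψ hψ) (hQ.cont ψ' hψ') (h ψ hψ) (h ψ' hψ')]
  exact mi_le (l ψ hψ ψ' hψ' δ hδ) x
lemma inv (hQ : Good B c Q) (hc : 0 < c) (hq : ∀ ψ, SS B c ψ → ∀ x, c ≤ Q ψ x) : Good B c (fun ψ x => (Q ψ x)⁻¹) := by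
  obtain ⟨M, hM, h⟩ := hQ.bd
  obtain ⟨K, hK, l⟩ := hQ.lip
  have b : ∀ ψ, SS B c ψ → ∀ x, |(Q ψ x)⁻¹| ≤ c⁻¹ := fun ψ hψ x => by
    have := hq ψ hψ x
    rw [abs_of_nonneg (inv_nonneg.2 (hc.le.trans this))]; exact inv_anti₀ hc this
  refine ⟨fun ψ hψ => (hQ.cont ψ hψ).inv₀ fun x => (hc.trans_le (hq ψ hψ x)).ne', fun ψ hψ x k j => by
    simp only [hQ.per ψ hψ x k j], ⟨c⁻¹, by positivity, b⟩, ⟨c⁻¹ * K * c⁻¹, by positivity, fun ψ hψ ψ' hψ' δ hδ x => ?_⟩⟩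
  have h1 := (hc.trans_le (hq ψ hψ x)).ne'
  have h2 := (hc.trans_le (hq ψ' hψ' x)).ne'
  have hn := hδ.nn
  have e : (Q ψ x)⁻¹ - (Q ψ' x)⁻¹ = -((Q ψ x)⁻¹ * (Q ψ x - Q ψ' x) * (Q ψ' x)⁻¹) := by field_simp; ring
  rw [e, abs_neg, abs_mul, abs_mul]
  have a1 := mul_le_mul (b ψ hψ x) (l ψ hψ ψ' hψ' δ hδ x) (abs_nonneg _) (by positivity)
  have a2 := mul_le_mul a1 (b ψ' hψ' x) (abs_nonneg _) (by positivity)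
  linarith
end Good

lemma C1p.ofV {m : ℕ} {V : Spc m → ℝ} (hV : ContDiff ℝ 2 V) (hp : IsPeriodic V) (v : Spc m) : C1p (pd v V) :=
  ⟨(hV.fderiv_right (m := 1) (by norm_num)).clm_apply contDiff_const, pd_per hp v⟩

lemma C1p.phi {m : ℕ} {V : Spc m → ℝ} (hV : ContDiff ℝ 2 V) (hp : IsPeriodic V) {B c : ℝ} (hc : 0 < c) {ψ : Spc m → ℝ}
    (hψ : SS B c ψ) : C1p (fun z : Spc m => phiF V ψ z.1) :=
  ((C1p.ofV hV hp (e1 m)).mul hψ.c1).mi.div hψ.c1.mi fun x => (hc.trans_le (hψ.mp x)).ne'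

lemma Fop_eq {m : ℕ} {V : Spc m → ℝ} (hV : ContDiff ℝ 2 V) (hp : IsPeriodic V) {B c : ℝ} (hc : 0 < c) {ψ : Spc m → ℝ}
    (hψ : SS B c ψ) (x : Spc m) : Fop V ψ x = gradDot V ψ x + lap V x * ψ x -
      ((mi (fun z => pd (e1 m) (pd (e1 m) V) z * ψ z + pd (e1 m) V z * pd (e1 m) ψ z) x * mi ψ x -
        mi (fun z => pd (e1 m) V z * ψ z) x * mi (pd (e1 m) ψ) x) * ((mi ψ x)⁻¹ * (mi ψ x)⁻¹) * ψ x +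
      mi (fun z => pd (e1 m) V z * ψ z) x * (mi ψ x)⁻¹ * pd (e1 m) ψ x) := by
  have ha := C1p.ofV hV hp (e1 m)
  have h0 : ∀ x, mi ψ x ≠ 0 := fun x => (hc.trans_le (hψ.mp x)).ne'
  unfold Fop
  rw [(C1p.phi hV hp hc hψ).pd_mul hψ.c1]
  congr 2
  have e : (fun z : Spc m => phiF V ψ z.1) = fun z => mi (fun z => pd (e1 m) V z * ψ z) z / mi ψ z := rfl
  have e2 : pd (e1 m) (fun z => pd (e1 m) V z * ψ z) = 
      fun z => pd (e1 m) (pd (e1 m) V) z * ψ z + pd (e1 m) V z * pd (e1 m) ψ z := funext fun z => ha.pd_mul hψ.c1 _ z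
  rw [e, (ha.mul hψ.c1).mi.pd_div hψ.c1.mi h0, (ha.mul hψ.c1).pd_mi, hψ.c1.pd_mi, e2]

lemma lap_cont {m : ℕ} {V : Spc m → ℝ} (hV : ContDiff ℝ 2 V) (hp : IsPeriodic V) : Continuous (lap V) :=
  ((C1p.ofV hV hp _).pdc _).add (continuous_finsetSum _ fun _ _ => (C1p.ofV hV hp _).pdc _)

lemma lap_per {m : ℕ} {V : Spc m → ℝ} (hp : IsPeriodic V) : IsPeriodic (lap V) := fun x k j => by
  unfold lap
  simp only [(pd_per (pd_per hp _) _) x k j]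

lemma good_congr {m : ℕ} {B c : ℝ} {Q R : (Spc m → ℝ) → Spc m → ℝ} (h : Good B c Q)
    (e : ∀ ψ, SS B c ψ → ∀ x, R ψ x = Q ψ x) : Good B c R := by
  have e' : ∀ ψ, SS B c ψ → R ψ = Q ψ := fun ψ hψ => funext (e ψ hψ)
  obtain ⟨M, hM, hb⟩ := h.bd
  obtain ⟨K, hK, l⟩ := h.lip
  refine ⟨fun ψ hψ => e' ψ hψ ▸ h.cont ψ hψ, fun ψ hψ => e' ψ hψ ▸ h.per ψ hψ, ⟨M, hM, fun ψ hψ => ?_⟩, ⟨K, hK, fun ψ hψ ψ' hψ' => ?_⟩⟩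
  · rw [e' ψ hψ]; exact hb ψ hψ
  · rw [e' ψ hψ, e' ψ' hψ']; exact l ψ hψ ψ' hψ'

lemma good_Fop {m : ℕ} {V : Spc m → ℝ} (hV : ContDiff ℝ 2 V) (hp : IsPeriodic V) {B c : ℝ} (hB : 0 ≤ B) (hc : 0 < c) :
    Good B c (fun ψ => Fop V ψ) := by
  refine good_congr ?_ (fun ψ hψ x => Fop_eq hV hp hc hψ x)
  have gp : ∀ v, Good B c (fun _ => pd v V) := fun v => Good.const (C1p.ofV hV hp v).cont (pd_per hp v)
  have gpp : Good B c (fun _ => pd (e1 m) (pd (e1 m) V)) := Good.const ((C1p.ofV hV hp _).pdc _) (pd_per (pd_per hp _) _)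
  have gi : Good (m := m) B c (fun ψ => ψ) := Good.idd hB
  have gd := fun v : Spc m => Good.pdd (c := c) hB v
  have g1 : Good B c (fun ψ => gradDot V ψ) :=
    ((gp _).mul (gd _)).add (Good.sum _ fun i => (gp (eC m i)).mul (gd (eC m i)))
  have g2 : Good B c (fun ψ x => lap V x * ψ x) := (Good.const (lap_cont hV hp) (lap_per hp)).mul gi
  have gN := ((gp (e1 m)).mul gi).mi
  have gN1 := ((gpp.mul gi).add ((gp (e1 m)).mul (gd (e1 m)))).mi
  have gI := gi.mi.inv hc (fun ψ hψ x => hψ.mp x)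
  exact (g1.add g2).sub ((((gN1.mul gi.mi).sub (gN.mul (gd (e1 m)).mi)).mul (gI.mul gI) |>.mul gi).add
    ((gN.mul gI).mul (gd (e1 m))))

lemma Fop_mean {m : ℕ} {V : Spc m → ℝ} (hV : ContDiff ℝ 2 V) (hp : IsPeriodic V) {B c : ℝ} (hc : 0 < c) {ψ : Spc m → ℝ}
    (hψ : SS B c ψ) : ∫ x in cube m, Fop V ψ x = 0 := by
  have ha := fun v => (C1p.ofV hV hp v).mul hψ.c1
  have hφ := (C1p.phi hV hp hc hψ).mul hψ.c1
  have e : ∀ x, Fop V ψ x = pd (e1 m) (fun z => pd (e1 m) V z * ψ z - phiF V ψ z.1 * ψ z) x +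
      ∑ i, pd (eC m i) (fun z => pd (eC m i) V z * ψ z) x := by
    intro x
    rw [(ha _).pd_sub hφ, (C1p.ofV hV hp (e1 m)).pd_mul hψ.c1]
    simp_rw [fun i => (C1p.ofV hV hp (eC m i)).pd_mul hψ.c1 (eC m i) x]
    rw [Finset.sum_add_distrib, ← Finset.sum_mul]
    unfold Fop gradDot lap
    ring
  have hint : ∀ {h : Spc m → ℝ} (_ : C1p h) v, Integrable (pd v h) (μT m) := fun {h} H v => by
    obtain ⟨A, _, hA⟩ := H.bddp v
    exact Integrable.of_bound (C := A) (H.pdc v).aestronglyMeasurable (Eventually.of_forall hA)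
  simp_rw [e]
  have h1 := integral_add (hint ((ha (e1 m)).sub hφ) (e1 m)) (integrable_finsetSum Finset.univ fun i _ => hint (ha (eC m i)) (eC m i))
  have h2 := integral_finsetSum (μ := μT m) Finset.univ fun i _ => hint (ha (eC m i)) (eC m i)
  unfold μT at h1 h2
  rw [h1, h2, ((ha (e1 m)).sub hφ).int_pd, Finset.sum_eq_zero fun i _ => (ha (eC m i)).int_pd _]
  simp

def Hs {m : ℕ} {E : Type*} [NormedAddCommGroup E] [NormedSpace ℝ E] (G : Spc m → E) (a : ℝ) (x : Spc m) : E :=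
  ∫ z, gk 1 z • G (x - Real.sqrt a • z)

lemma heat_eq_cnv {m : ℕ} {β t : ℝ} (ht : 0 < t) (g : Spc m → ℝ) (x : Spc m) :
    heatSG β t g x = cnv (gk (t / β)) g x := by
  unfold heatSG cnv
  rw [if_neg (by linarith)]
  refine integral_congr_ae (Eventually.of_forall fun y => ?_)
  simp only [smul_eq_mul]
  rw [mul_comm]; rfl

lemma gk_sqrt {m : ℕ} {a : ℝ} (ha : 0 < a) (z : Spc m) : gk a (Real.sqrt a • z) = (Real.sqrt a ^ (m + 1))⁻¹ * gk 1 z := by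
  unfold gk
  have e1 : qd (Real.sqrt a • z) = a * qd z := by
    unfold qd; simp only [Prod.smul_fst, Prod.smul_snd, Pi.smul_apply, smul_eq_mul, mul_pow, Real.sq_sqrt ha.le]
    rw [← Finset.mul_sum]; ring
  have e2 : (Real.sqrt a ^ (m + 1))⁻¹ = a ^ (-((m:ℝ) + 1) / 2) := by
    rw [← Real.rpow_natCast, Real.sqrt_eq_rpow, ← Real.rpow_mul ha.le, ← Real.rpow_neg ha.le]
    congr 1; push_cast; ring
  rw [e1, e2, Real.mul_rpow (by positivity) ha.le, mul_one]
  have : -(a * qd z) / (4 * a) = -qd z / (4 * 1) := by field_simp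
  rw [this]; ring

lemma heat_eq_Hs {m : ℕ} {β t : ℝ} (hβ : 0 < β) (ht : 0 ≤ t) (g : Spc m → ℝ) (x : Spc m) :
    heatSG β t g x = Hs g (t / β) x := by
  rcases ht.eq_or_lt with h | h
  · subst h
    unfold heatSG Hs
    rw [if_pos le_rfl, zero_div, Real.sqrt_zero]
    simp only [zero_smul, sub_zero, smul_eq_mul]
    rw [integral_mul_const, integral_gk one_pos, one_mul]
  · rw [heat_eq_cnv h]
    have ha : 0 < t / β := by positivity
    set a := t / β
    have hs : 0 < Real.sqrt a := Real.sqrt_pos.2 ha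
    unfold cnv Hs
    have h1 : ∫ y, g y • gk a (x - y) = ∫ z, g (x - z) • gk a z := by
      rw [← integral_sub_left_eq_self (fun z => g (x - z) • gk a z) volume x]; simp
    rw [h1]
    have h2 := Measure.integral_comp_smul (volume : Measure (Spc m)) (fun z => g (x - z) • gk a z) (Real.sqrt a)
    rw [finrank_Spc, abs_of_pos (by positivity)] at h2
    have h3 : (fun z => g (x - Real.sqrt a • z) • gk a (Real.sqrt a • z)) =
      fun z => (Real.sqrt a ^ (m + 1))⁻¹ • (gk 1 z • g (x - Real.sqrt a • z)) := by
      funext z; rw [gk_sqrt ha]; simp only [smul_eq_mul]; ring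
    rw [h3, integral_smul] at h2
    exact (smul_right_injective ℝ (by positivity : (Real.sqrt a ^ (m + 1))⁻¹ ≠ 0) h2).symm

lemma Hs_int {m : ℕ} {E : Type*} [NormedAddCommGroup E] [NormedSpace ℝ E] [SecondCountableTopologyEither (Spc m) E] {G : Spc m → E} (hc : Continuous G) {B : ℝ}
    (hB : ∀ x, ‖G x‖ ≤ B) (a : ℝ) (x : Spc m) : Integrable fun z => gk 1 z • G (x - Real.sqrt a • z) :=
  (integrable_gk one_pos).smul_bdd B (hc.comp (by fun_prop : Continuous fun z : Spc m => x - Real.sqrt a • z)).aestronglyMeasurable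
    (Eventually.of_forall fun z => hB _)

lemma Hs_deriv {m : ℕ} {g : Spc m → ℝ} (H : C1p g) (a : ℝ) (x0 : Spc m) :
    HasFDerivAt (Hs g a) (Hs (grd g) a x0) x0 := by
  obtain ⟨B, _, hB⟩ := H.bddg
  obtain ⟨A, _, hA⟩ := H.bdd
  refine hasFDerivAt_integral_of_dominated_of_fderiv_le (s := univ)
    (F := fun x z => gk 1 z • g (x - Real.sqrt a • z)) (F' := fun x z => gk 1 z • grd g (x - Real.sqrt a • z))
    (bound := fun z => gk 1 z * B) univ_mem
    (Eventually.of_forall fun x => (Hs_int H.cont hA a x).aestronglyMeasurable) (Hs_int H.cont hA a x0)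
    (Hs_int H.contg hB a x0).aestronglyMeasurable ?_ ((integrable_gk one_pos).mul_const B) ?_
  · refine Eventually.of_forall fun z x _ => ?_
    rw [norm_smul, Real.norm_of_nonneg (gk_nonneg one_pos z)]
    exact mul_le_mul_of_nonneg_left (hB _) (gk_nonneg one_pos z)
  · refine Eventually.of_forall fun z x _ => ?_
    have h1 : HasFDerivAt g (grd g (x - Real.sqrt a • z)) (x - Real.sqrt a • z) := (H.diff _).hasFDerivAt
    have h2 : HasFDerivAt (fun x => g (x - Real.sqrt a • z)) (grd g (x - Real.sqrt a • z)) x :=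
      (hasFDerivAt_comp_sub (Real.sqrt a • z)).2 h1
    exact h2.const_smul (gk 1 z)

lemma gk_mom {m : ℕ} {α : ℝ} (hα : 0 ≤ α) (hα1 : α ≤ 1) : Integrable fun z : Spc m => gk 1 z * ‖z‖ ^ α := by
  obtain ⟨C, hC, h⟩ := gk_poly (m := m)
  refine Integrable.mono' ((integrable_gk (a := 4 * 1) (by norm_num)).const_mul C)
    ((continuous_gk 1).mul (continuous_norm.rpow_const fun _ => Or.inr hα)).aestronglyMeasurable (Eventually.of_forall fun z => ?_)
  have h0 := gk_nonneg one_pos z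
  rw [Real.norm_of_nonneg (by positivity)]
  refine le_trans (mul_le_mul_of_nonneg_left ?_ h0) (h 1 one_pos 1 (by constructor <;> norm_num) z)
  have hq := qd_nonneg z
  have h1 : ‖z‖ ^ α ≤ 1 + ‖z‖ := by
    rcases le_total ‖z‖ 1 with hz | hz
    · have := Real.rpow_le_one (norm_nonneg z) hz hα; linarith [norm_nonneg z]
    · have := Real.rpow_le_rpow_of_exponent_le hz hα1; rw [Real.rpow_one] at this; linarith
  have h2 := norm_sq_le_qd z
  have h3 : ‖z‖ ≤ 1 + qd z := by nlinarith [sq_nonneg (‖z‖ - 1)]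
  have h4 : (1 + qd z) ^ 3 = 1 + 3 * qd z + 3 * qd z ^ 2 + qd z ^ 3 := by ring
  rw [div_one, h4]
  have h5 : ‖z‖ ≤ 3 * qd z + 1 + qd z^2 + qd z ^ 3 := by have : 0 ≤ qd z ^ 3 := by positivity
                                                         nlinarith
  rcases le_total ‖z‖ 1 with hz | hz
  · have hb : ‖z‖ ^ α ≤ 1 := Real.rpow_le_one (norm_nonneg z) hz hα
    have : 0 ≤ qd z ^ 3 := by positivity
    nlinarith
  · have hb := Real.rpow_le_rpow_of_exponent_le hz hα1; rw [Real.rpow_one] at hb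
    have : 0 ≤ qd z ^ 3 := by positivity
    nlinarith

lemma sqrt_sub_le {a b : ℝ} (ha : 0 ≤ a) (hb : 0 ≤ b) : |Real.sqrt a - Real.sqrt b| ≤ Real.sqrt |a - b| := by
  apply Real.le_sqrt_of_sq_le
  rw [sq_abs]
  have h1 := Real.sq_sqrt ha
  have h2 := Real.sq_sqrt hb
  have h3 := Real.sqrt_nonneg a
  have h4 := Real.sqrt_nonneg b
  rcases le_total a b with h | h
  · rw [abs_of_nonpos (by linarith)]
    have := Real.sqrt_le_sqrt h
    nlinarith
  · rw [abs_of_nonneg (by linarith)]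
    have := Real.sqrt_le_sqrt h
    nlinarith

lemma Hs_holder {m : ℕ} {E : Type*} [NormedAddCommGroup E] [NormedSpace ℝ E] [SecondCountableTopologyEither (Spc m) E]
    {G : Spc m → E} (hc : Continuous G) {B : ℝ}
    (hB : ∀ x, ‖G x‖ ≤ B) {α K : ℝ} (hα : 0 ≤ α) (hα1 : α ≤ 1) (hK : 0 ≤ K)
    (hG : ∀ x y, ‖G x - G y‖ ≤ K * ‖x - y‖ ^ α) {a a' : ℝ} (ha : 0 ≤ a) (ha' : 0 ≤ a') (x : Spc m) :
    ‖Hs G a x - Hs G a' x‖ ≤ (K * ∫ z : Spc m, gk 1 z * ‖z‖ ^ α) * |a - a'| ^ (α / 2) := by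
  unfold Hs
  rw [← integral_sub (Hs_int hc hB a x) (Hs_int hc hB a' x)]
  refine (norm_integral_le_of_norm_le (((gk_mom hα hα1).const_mul K).mul_const (|a - a'| ^ (α / 2)))
    (Eventually.of_forall fun z => ?_)).trans (le_of_eq ?_)
  · have h0 := gk_nonneg one_pos z
    rw [← smul_sub, norm_smul, Real.norm_of_nonneg h0]
    have e : (x - Real.sqrt a • z) - (x - Real.sqrt a' • z) = (Real.sqrt a' - Real.sqrt a) • z := by module
    have h1 := hG (x - Real.sqrt a • z) (x - Real.sqrt a' • z)
    rw [e, norm_smul, Real.norm_eq_abs, Real.mul_rpow (abs_nonneg _) (norm_nonneg _)] at h1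
    have h2 : |Real.sqrt a' - Real.sqrt a| ^ α ≤ |a - a'| ^ (α / 2) := by
      rw [abs_sub_comm]
      refine (Real.rpow_le_rpow (abs_nonneg _) (sqrt_sub_le ha ha') hα).trans (le_of_eq ?_)
      rw [Real.sqrt_eq_rpow, ← Real.rpow_mul (abs_nonneg _)]; congr 1; ring
    calc _ ≤ gk 1 z * (K * (|a - a'| ^ (α / 2) * ‖z‖ ^ α)) := by
          refine mul_le_mul_of_nonneg_left (h1.trans ?_) h0
          gcongr
      _ = _ := by ring
  · rw [integral_mul_const, integral_const_mul]

lemma cont_of_holder {m : ℕ} {E : Type*} [NormedAddCommGroup E] {G : Spc m → E} {K α : ℝ} (hα : 0 < α)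
    (h : ∀ x y, ‖G x - G y‖ ≤ K * ‖x - y‖ ^ α) : Continuous G := by
  refine continuous_iff_continuousAt.2 fun y => ?_
  refine tendsto_iff_norm_sub_tendsto_zero.2 ?_
  refine squeeze_zero (fun _ => norm_nonneg _) (fun x => h x y) ?_
  have : Continuous fun x : Spc m => K * ‖x - y‖ ^ α :=
    continuous_const.mul ((by fun_prop : Continuous fun x : Spc m => ‖x - y‖).rpow_const fun _ => Or.inr hα.le)
  have := this.tendsto y
  simpa [Real.zero_rpow hα.ne'] using this

lemma memW_C1p {m : ℕ} {σ p : ℝ} (h2 : Hyp2 m σ p) {f : Spc m → ℝ} (hf : MemW σ p f) : C1p f := by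
  obtain ⟨C, hC, H⟩ := sob h2
  obtain ⟨hp, hσ, hα⟩ := hyp2_p h2
  obtain ⟨per, _, d, _, fin⟩ := hf
  exact ⟨contDiff_one_iff_fderiv.2 ⟨d hσ.le, cont_of_holder hα (H f per (d hσ.le) fin).2.2⟩, per⟩

lemma cl_cont {m : ℕ} {σ p : ℝ} (h2 : Hyp2 m σ p) {S : Set ℝ} {ψ : ℝ → Spc m → ℝ} (hM : ∀ t ∈ S, MemW σ p (ψ t))
    (hc : ContW σ p S ψ) : ∀ s0 ∈ S, ∀ ε > 0, ∃ δ > 0, ∀ s ∈ S, |s - s0| < δ → Cl (ψ s) (ψ s0) ε := by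
  obtain ⟨C, hC, H⟩ := sob h2
  intro s0 hs0 ε hε
  obtain ⟨δ, hδ, h⟩ := hc s0 hs0 (ε / (C + 1)) (by positivity)
  refine ⟨δ, hδ, fun s hs hd x => ?_⟩
  have h' := h s hs hd
  have a := memW_C1p h2 (hM s hs)
  have b := memW_C1p h2 (hM s0 hs0)
  have fin : WNorm σ p (fun x => ψ s x - ψ s0 x) < ⊤ := h'.trans ENNReal.ofReal_lt_top
  have K := H _ (a.sub b).per (a.sub b).diff fin
  have hw : C * (WNorm σ p (fun x => ψ s x - ψ s0 x)).toReal ≤ ε := by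
    have : (WNorm σ p (fun x => ψ s x - ψ s0 x)).toReal ≤ ε / (C + 1) :=
      ENNReal.toReal_le_of_le_ofReal (by positivity) h'.le
    calc _ ≤ C * (ε / (C + 1)) := mul_le_mul_of_nonneg_left this hC
      _ ≤ (C + 1) * (ε / (C + 1)) := mul_le_mul_of_nonneg_right (by linarith) (by positivity)
      _ = ε := by field_simp
  refine ⟨(K.1 x).trans hw, ?_⟩
  have e : grd (fun x => ψ s x - ψ s0 x) x = grd (ψ s) x - grd (ψ s0) x := fderiv_fun_sub (a.diff x) (b.diff x)
  rw [← e]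
  exact (K.2.1 x).trans hw

lemma SS_of_pos {m : ℕ} {f : Spc m → ℝ} (hf : C1p f) (hp : ∀ x, 0 < mi f x) : ∃ B, 0 ≤ B ∧ ∃ c, 0 < c ∧ SS B c f := by
  obtain ⟨B, hB, b⟩ := hf.bdd
  obtain ⟨B', hB', b'⟩ := hf.bddg
  obtain ⟨D, hD, d⟩ := per_bdd (F := fun x => (mi f x)⁻¹) (fun x k j => by
    show (mi f (x + zv k j))⁻¹ = _
    rw [per_zv hf.mi.per]) (hf.mi.cont.inv₀ fun x => (hp x).ne')
  refine ⟨max B B', le_max_of_le_left hB, (D + 1)⁻¹, by positivity, hf, fun x => (b x).trans (le_max_left _ _),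
    fun x => (b' x).trans (le_max_right _ _), fun x => ?_⟩
  have := d x
  rw [Real.norm_of_nonneg (inv_nonneg.2 (hp x).le)] at this
  rw [inv_le_comm₀ (by positivity) (hp x)]
  linarith

lemma SS_of_cl {m : ℕ} {f g : Spc m → ℝ} {B c : ℝ} (hf : SS B c f) (hg : C1p g) {δ : ℝ} (h : Cl g f δ) :
    SS (B + δ) (c - δ) g := by
  refine ⟨hg, fun x => ?_, fun x => ?_, fun x => ?_⟩
  · have a := abs_le.1 (hf.b0 x); have b := abs_le.1 (h x).1
    exact abs_le.2 ⟨by linarith, by linarith⟩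
  · have := norm_add_le (grd f x) (grd g x - grd f x)
    rw [add_sub_cancel] at this
    linarith [hf.b1 x, (h x).2]
  · obtain ⟨A, _, hA⟩ := hf.c1.bdd
    obtain ⟨A', _, hA'⟩ := hg.bdd
    have e := mi_sub hg.cont hf.c1.cont hA' hA x
    have l := mi_le (h := fun z => g z - f z) (M := δ) (fun z => (h z).1) x
    have := abs_le.1 l
    have := hf.mp x
    linarith

lemma unif_SS {m : ℕ} {T : ℝ} (hT : 0 ≤ T) {ψ : ℝ → Spc m → ℝ} (h1 : ∀ s ∈ Icc 0 T, C1p (ψ s))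
    (hp : ∀ s ∈ Icc 0 T, ∀ x, 0 < mi (ψ s) x)
    (hc : ∀ s0 ∈ Icc 0 T, ∀ ε > 0, ∃ δ > 0, ∀ s ∈ Icc 0 T, |s - s0| < δ → Cl (ψ s) (ψ s0) ε) :
    ∃ B, 0 ≤ B ∧ ∃ c, 0 < c ∧ ∀ s ∈ Icc 0 T, SS B c (ψ s) := by
  suffices key : (fun S : Set ℝ => ∃ B, 0 ≤ B ∧ ∃ c, 0 < c ∧ ∀ s ∈ S ∩ Icc 0 T, SS B c (ψ s)) (Icc 0 T) by
    obtain ⟨B, hB, c, hc, h⟩ := key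
    exact ⟨B, hB, c, hc, fun s hs => h s ⟨hs, hs⟩⟩
  refine IsCompact.induction_on (s := Icc (0:ℝ) T)
      (p := fun S => ∃ B, 0 ≤ B ∧ ∃ c, 0 < c ∧ ∀ s ∈ S ∩ Icc 0 T, SS B c (ψ s)) isCompact_Icc ?_ ?_ ?_ ?_
  · exact ⟨0, le_rfl, 1, one_pos, fun s hs => by simp at hs⟩
  · rintro S S' hS ⟨B, hB, c, hc, h⟩
    exact ⟨B, hB, c, hc, fun s hs => h s ⟨hS hs.1, hs.2⟩⟩
  · rintro S S' ⟨B, hB, c, hc, h⟩ ⟨B', hB', c', hc', h'⟩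
    refine ⟨max B B', le_max_of_le_left hB, min c c', lt_min hc hc', fun s hs => ?_⟩
    rcases hs.1 with a | a
    · have H := h s ⟨a, hs.2⟩
      exact ⟨H.c1, fun x => (H.b0 x).trans (le_max_left _ _), fun x => (H.b1 x).trans (le_max_left _ _), fun x => (min_le_left _ _).trans (H.mp x)⟩
    · have H := h' s ⟨a, hs.2⟩
      exact ⟨H.c1, fun x => (H.b0 x).trans (le_max_right _ _), fun x => (H.b1 x).trans (le_max_right _ _), fun x => (min_le_right _ _).trans (H.mp x)⟩
  · intro s0 hs0
    obtain ⟨B, hB, c, hcp, H⟩ := SS_of_pos (h1 s0 hs0) (hp s0 hs0)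
    obtain ⟨δ, hδ, h⟩ := hc s0 hs0 (c / 2) (by positivity)
    refine ⟨Metric.ball s0 δ, mem_nhdsWithin_of_mem_nhds (Metric.ball_mem_nhds _ hδ), B + c / 2, by positivity, c - c / 2, by linarith, fun s hs => ?_⟩
    exact SS_of_cl H (h1 s hs.2) (h s hs.2 (by simpa [Real.dist_eq] using hs.1))

def clp (T s : ℝ) : ℝ := max 0 (min s T)
lemma clp_mem {T : ℝ} (hT : 0 ≤ T) (s : ℝ) : clp T s ∈ Icc 0 T := ⟨le_max_left _ _, max_le hT (min_le_right _ _)⟩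
lemma clp_id {T s : ℝ} (h : s ∈ Icc 0 T) : clp T s = s := by
  unfold clp; rw [min_eq_left h.2, max_eq_right h.1]
lemma clp_cont (T : ℝ) : Continuous (clp T) := by unfold clp; fun_prop

/-- joint continuity of the source -/
lemma src_cont {m : ℕ} {T : ℝ} (hT : 0 ≤ T) {ψ : ℝ → Spc m → ℝ} {B c : ℝ} (hS : ∀ s ∈ Icc 0 T, SS B c (ψ s))
    (hc : ∀ s0 ∈ Icc 0 T, ∀ ε > 0, ∃ δ > 0, ∀ s ∈ Icc 0 T, |s - s0| < δ → Cl (ψ s) (ψ s0) ε)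
    {Q : (Spc m → ℝ) → Spc m → ℝ} (hQ : Good B c Q) :
    Continuous fun q : ℝ × Spc m => Q (ψ (clp T q.1)) q.2 := by
  obtain ⟨K, hK, l⟩ := hQ.lip
  refine continuous_iff_continuousAt.2 fun q0 => ?_
  refine Metric.tendsto_nhds.2 fun ε hε => ?_
  have m0 := clp_mem hT q0.1
  obtain ⟨δ, hδ, h⟩ := hc _ m0 (ε / (2 * (K + 1))) (by positivity)
  have e1 : ∀ᶠ q : ℝ × Spc m in nhds q0, dist (clp T q.1) (clp T q0.1) < δ :=
    Metric.tendsto_nhds.1 (((clp_cont T).comp continuous_fst).tendsto q0) δ hδ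
  have e2 : ∀ᶠ q : ℝ × Spc m in nhds q0, dist (Q (ψ (clp T q0.1)) q.2) (Q (ψ (clp T q0.1)) q0.2) < ε / 2 :=
    Metric.tendsto_nhds.1 (((hQ.cont _ (hS _ m0)).comp continuous_snd).tendsto q0) _ (by positivity)
  filter_upwards [e1, e2] with q h1 h3
  have mq := clp_mem hT q.1
  have := l _ (hS _ mq) _ (hS _ m0) _ (h _ mq (by simpa [Real.dist_eq] using h1)) q.2
  have hb : K * (ε / (2 * (K + 1))) < ε / 2 := by
    have : K * (ε / (2 * (K + 1))) = (K / (K + 1)) * (ε / 2) := by field_simp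
    rw [this]
    have : K / (K + 1) < 1 := by rw [div_lt_one (by positivity)]; linarith
    nlinarith
  calc _ ≤ dist (Q (ψ (clp T q.1)) q.2) (Q (ψ (clp T q0.1)) q.2) + dist (Q (ψ (clp T q0.1)) q.2) (Q (ψ (clp T q0.1)) q0.2) := dist_triangle _ _ _
    _ < ε / 2 + ε / 2 := add_lt_add (by rw [Real.dist_eq]; linarith) h3
    _ = ε := by ring

lemma rpow_cmp {d D ν γ : ℝ} (hd : 0 ≤ d) (hD : d ≤ D) (hν : 0 < ν) (h : ν ≤ γ) : d ^ γ ≤ D ^ (γ - ν) * d ^ ν := by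
  rcases hd.eq_or_lt with e | e
  · subst e; rw [Real.zero_rpow (by linarith), Real.zero_rpow (by linarith), mul_zero]
  · have : d ^ γ = d ^ (γ - ν) * d ^ ν := by rw [← Real.rpow_add e]; congr 1; ring
    rw [this]
    exact mul_le_mul_of_nonneg_right (Real.rpow_le_rpow hd hD (by linarith)) (by positivity)

lemma Hs_holder_t {m : ℕ} {E : Type*} [NormedAddCommGroup E] [NormedSpace ℝ E] [SecondCountableTopologyEither (Spc m) E]
    {G : Spc m → E} (hc : Continuous G) {B : ℝ}
    (hB : ∀ x, ‖G x‖ ≤ B) {α K : ℝ} (hα : 0 ≤ α) (hα1 : α ≤ 1) (hK : 0 ≤ K)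
    (hG : ∀ x y, ‖G x - G y‖ ≤ K * ‖x - y‖ ^ α) {β ν : ℝ} (hβ : 0 < β) (hν : 0 < ν) (hνα : ν ≤ α / 2) (T : ℝ) :
    ∃ C, 0 ≤ C ∧ ∀ t h, 0 ≤ t → 0 ≤ h → t + h ≤ T → ∀ x, ‖Hs G ((t + h) / β) x - Hs G (t / β) x‖ ≤ C * h ^ ν := by
  refine ⟨|(K * ∫ z : Spc m, gk 1 z * ‖z‖ ^ α) * ((T / β) ^ (α / 2 - ν) * (1 / β) ^ ν)|, abs_nonneg _, fun t h ht hh hT x => ?_⟩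
  have hI : 0 ≤ ∫ z : Spc m, gk 1 z * ‖z‖ ^ α := integral_nonneg fun z => mul_nonneg (gk_nonneg one_pos z) (by positivity)
  refine (Hs_holder hc hB hα hα1 hK hG (by positivity) (by positivity) x).trans ?_
  have e : |(t + h) / β - t / β| = h / β := by
    rw [← sub_div, add_sub_cancel_left, abs_of_nonneg (by positivity)]
  rw [e]
  have h1 := rpow_cmp (d := h / β) (D := T / β) (by positivity) (by gcongr; linarith) hν hνα
  have h3 : (h / β) ^ ν = (1 / β) ^ ν * h ^ ν := by
    rw [← Real.mul_rpow (by positivity) hh]; congr 1; ring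
  calc _ ≤ (K * ∫ z : Spc m, gk 1 z * ‖z‖ ^ α) * ((T / β) ^ (α / 2 - ν) * (h / β) ^ ν) :=
        mul_le_mul_of_nonneg_left h1 (by positivity)
    _ = ((K * ∫ z : Spc m, gk 1 z * ‖z‖ ^ α) * ((T / β) ^ (α / 2 - ν) * (1 / β) ^ ν)) * h ^ ν := by rw [h3]; ring
    _ ≤ _ := mul_le_mul_of_nonneg_right (le_abs_self _) (by positivity)

lemma C1p.lip {m : ℕ} {f : Spc m → ℝ} (hf : C1p f) : ∃ K, 0 ≤ K ∧ ∀ x y, ‖f x - f y‖ ≤ K * ‖x - y‖ ^ (1:ℝ) := by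
  obtain ⟨B, hB, b⟩ := hf.bddg
  refine ⟨B, hB, fun x y => ?_⟩
  rw [Real.rpow_one]
  exact convex_univ.norm_image_sub_le_of_norm_fderiv_le (𝕜 := ℝ) (fun z _ => hf.diff z) (fun z _ => b z) (mem_univ _) (mem_univ _)

/-- all data about the source -/
structure Dat {m : ℕ} (V : Spc m → ℝ) (ψ : ℝ → Spc m → ℝ) (T B c M H ν : ℝ) : Prop where
  T0 : 0 ≤ T
  c0 : 0 < c
  H0 : 0 ≤ H
  M0 : 0 ≤ M
  ss : ∀ s ∈ Icc 0 T, SS B c (ψ s)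
  ct : Continuous fun q : ℝ × Spc m => Fop V (ψ (clp T q.1)) q.2
  per : ∀ s, IsPeriodic (Fop V (ψ (clp T s)))
  bd : ∀ s y, |Fop V (ψ (clp T s)) y| ≤ M
  mean : ∀ s, ∫ x in cube m, Fop V (ψ (clp T s)) x = 0
  hol : ∀ s ∈ Icc 0 T, ∀ t ∈ Icc 0 T, ∀ y, |Fop V (ψ (clp T s)) y - Fop V (ψ (clp T t)) y| ≤ H * |s - t| ^ ν

lemma heat_Duh {m : ℕ} {β t : ℝ} (g f : ℝ → Spc m → ℝ) (h : ∀ s ∈ Ioo 0 t, g s = f s) (x : Spc m) :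
    ∫ s in Ioc 0 t, heatSG β (t - s) (g s) x = Duh (fun τ => gk (τ / β)) f t x := by
  rw [integral_Ioc_eq_integral_Ioo]
  refine setIntegral_congr_fun measurableSet_Ioo fun s hs => ?_
  show heatSG β (t - s) (g s) x = cnv (gk ((t - s) / β)) (f s) x
  rw [heat_eq_cnv (by linarith [hs.2]), h s hs]

lemma mild_rep {m : ℕ} {V : Spc m → ℝ} {β σ p : ℝ} {ψ0 : Spc m → ℝ} {Tmax : ℝ≥0∞} {ψ : ℝ → Spc m → ℝ}
    (hβ : 0 < β) (hψ : IsMildSolution V β σ p ψ0 Tmax ψ) {T M : ℝ}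
    (hT : ENNReal.ofReal T < Tmax) (h0 : C1p ψ0) (hc : ∀ s ∈ Icc 0 T, C1p (ψ s))
    (hs : Src (fun s => Fop V (ψ (clp T s))) T M 0) {t : ℝ} (ht : t ∈ Icc 0 T) (x : Spc m) :
    ψ t x = Hs ψ0 (t / β) x + Duh (fun τ => gk (τ / β)) (fun s => Fop V (ψ (clp T s))) t x ∧
    grd (ψ t) x = Hs (grd ψ0) (t / β) x + Duh (fun τ => gk1 (τ / β)) (fun s => Fop V (ψ (clp T s))) t x := by
  have hT0 : 0 ≤ T := ht.1.trans ht.2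
  obtain ⟨C0, hC0, k0⟩ := kfam0 (m := m)
  obtain ⟨D0, hD0, k0⟩ := k0.scale hC0 hβ
  obtain ⟨C1, hC1, k1⟩ := kfam1 (m := m)
  obtain ⟨D1, hD1, k1⟩ := k1.scale hC1 hβ
  have hs' : Src (fun s => Fop V (ψ (clp T s))) t M 0 := ⟨hs.meas, hs.nn, fun s h y => by
    simpa using hs.bd s ⟨h.1, h.2.trans_le ht.2⟩ y⟩
  have hD : ∀ x, HasFDerivAt (fun x => Hs ψ0 (t / β) x + Duh (fun τ => gk (τ / β)) (fun s => Fop V (ψ (clp T s))) t x)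
      (Hs (grd ψ0) (t / β) x + Duh (fun τ => gk1 (τ / β)) (fun s => Fop V (ψ (clp T s))) t x) x := fun x =>
    (Hs_deriv h0 _ x).add (hasFDerivAt_Duh k0 k1 (fun τ hτ z => hasFDerivAt_gk (by positivity) z) ht.1 hs' (by norm_num) (by norm_num) x)
  have e : ψ t = fun x => Hs ψ0 (t / β) x + Duh (fun τ => gk (τ / β)) (fun s => Fop V (ψ (clp T s))) t x := by
    refine (Continuous.ae_eq_iff_eq (volume : Measure (Spc m)) (hc t ht).cont
      (continuous_iff_continuousAt.2 fun x => (hD x).continuousAt)).1 ?_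
    filter_upwards [hψ.2.2.2 t ⟨ht.1, (ENNReal.ofReal_le_ofReal ht.2).trans_lt hT⟩] with x hx
    rw [hx, heat_eq_Hs hβ ht.1]
    congr 1
    exact heat_Duh _ _ (fun s h => by rw [clp_id ⟨h.1.le, h.2.le.trans ht.2⟩]) x
  refine ⟨congrFun e x, ?_⟩
  show fderiv ℝ (ψ t) x = _
  rw [e]
  exact (hD x).fderiv

lemma get_dat {m : ℕ} {V : Spc m → ℝ} {β σ p : ℝ} {ψ0 : Spc m → ℝ} {Tmax : ℝ≥0∞} {ψ : ℝ → Spc m → ℝ}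
    (hV : ContDiff ℝ 2 V) (hVper : IsPeriodic V) (hβ : 0 < β)
    (h1 : Hyp1 σ p ψ0) (h2 : Hyp2 m σ p) (hψ : IsMildSolution V β σ p ψ0 Tmax ψ) {T : ℝ} (hT0 : 0 ≤ T)
    (hT : ENNReal.ofReal T < Tmax) {ν : ℝ} (hν : 0 < ν) (hνα : ν ≤ (σ - 1 - ((m:ℝ) + 1) / p) / 2) :
    ∃ B c M H, Dat V ψ T B c M H ν := by
  obtain ⟨hp, hσ, hα⟩ := hyp2_p h2
  have hα1 : σ - 1 - ((m:ℝ) + 1) / p ≤ 1 := by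
    have := h2.2.2.2
    have : 0 ≤ ((m:ℝ) + 1) / p := by positivity
    linarith
  have hα2 : σ - 1 - ((m:ℝ) + 1) / p < 1 := by
    have := h2.2.2.2
    have : 0 ≤ ((m:ℝ) + 1) / p := by positivity
    linarith
  have sub : ∀ t ∈ Icc 0 T, t ∈ Ico0 Tmax := fun t ht => ⟨ht.1, (ENNReal.ofReal_le_ofReal ht.2).trans_lt hT⟩
  have hc1 : ∀ s ∈ Icc 0 T, C1p (ψ s) := fun s hs => memW_C1p h2 (hψ.2.1 s (sub s hs)).1
  have hcl : ∀ s0 ∈ Icc 0 T, ∀ ε > 0, ∃ δ > 0, ∀ s ∈ Icc 0 T, |s - s0| < δ → Cl (ψ s) (ψ s0) ε :=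
    cl_cont h2 (fun s hs => (hψ.2.1 s (sub s hs)).1)
      (fun t ht ε hε => by
        obtain ⟨δ, hδ, h⟩ := hψ.2.2.1 t (sub t ht) ε hε
        exact ⟨δ, hδ, fun s hs => h s (sub s hs)⟩)
  obtain ⟨B, hB, c, hc, hS⟩ := unif_SS hT0 hc1 (fun s hs x => (hψ.2.1 s (sub s hs)).2 x.1) hcl
  have G := good_Fop hV hVper hB hc
  obtain ⟨M, hM, bd⟩ := G.bd
  obtain ⟨L, hL, lip⟩ := G.lip
  have hct := src_cont hT0 hS hcl G
  have src : Src (fun s => Fop V (ψ (clp T s))) T M 0 :=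
    ⟨hct.measurable, hM, fun s hs y => by simpa using bd _ (hS _ (clp_mem hT0 s)) y⟩
  have h0 : C1p ψ0 := memW_C1p h2 h1.1.1
  obtain ⟨C0, hC0, k0⟩ := kfam0 (m := m)
  obtain ⟨D0, hD0, k0⟩ := k0.scale hC0 hβ
  obtain ⟨C1, hC1, k1⟩ := kfam1 (m := m)
  obtain ⟨D1, hD1, k1⟩ := k1.scale hC1 hβ
  obtain ⟨K, hK, l0⟩ := h0.lip
  obtain ⟨A, hA, a0⟩ := h0.bdd
  obtain ⟨A', hA', a1⟩ := h0.bddg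
  obtain ⟨S, hS0, sb⟩ := sob h2
  have l1 := (sb ψ0 h0.per h0.diff h1.1.1.2.2.2.2).2.2
  obtain ⟨E0, hE0, b0⟩ := Hs_holder_t h0.cont a0 zero_le_one le_rfl hK l0 hβ hν (by linarith) T
  obtain ⟨E1, hE1, b1⟩ := Hs_holder_t h0.contg a1 hα.le hα1 (by positivity) l1 hβ hν hνα T
  set P0 := 2 * (D0 * M) * T ^ (1 - 0 - ν) / (1 - 0 - ν)
  set P1 := 2 * (D1 * M) * T ^ (1 - 1 / 2 - ν) / (1 - 1 / 2 - ν)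
  have hP0 : 0 ≤ P0 := div_nonneg (by positivity) (by linarith)
  have hP1 : 0 ≤ P1 := div_nonneg (by positivity) (by linarith)
  have key : ∀ t h, 0 ≤ t → 0 ≤ h → t + h ≤ T → Cl (ψ (t + h)) (ψ t) ((E0 + P0 + E1 + P1) * h ^ ν) := by
    intro t h ht hh hle x
    have r := mild_rep hβ hψ hT h0 hc1 src (t := t) ⟨ht, by linarith⟩ x
    have r' := mild_rep hβ hψ hT h0 hc1 src (t := t + h) ⟨by linarith, hle⟩ x
    have q0 := b0 t h ht hh hle x
    have q1 := b1 t h ht hh hle x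
    have d0 : _ ≤ P0 * h ^ ν := Duh_holder0 k0 hD0 hν.le (by linarith) (by linarith) src ht hh hle x
    have d1 : _ ≤ P1 * h ^ ν := Duh_holder0 k1 hD1 hν.le (by linarith) (by linarith) src ht hh hle x
    have hp : 0 ≤ h ^ ν := by positivity
    have z0 := mul_nonneg hE0 hp
    have z1 := mul_nonneg hE1 hp
    have z2 := mul_nonneg hP0 hp
    have z3 := mul_nonneg hP1 hp
    clear_value P0 P1
    constructor
    · rw [r.1, r'.1, add_sub_add_comm]
      refine (norm_add_le _ _).trans ((add_le_add q0 d0).trans ?_)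
      linarith
    · rw [r.2, r'.2, add_sub_add_comm]
      refine (norm_add_le _ _).trans ((add_le_add q1 d1).trans ?_)
      linarith
  refine ⟨B, c, M, L * (E0 + P0 + E1 + P1), hT0, hc, by positivity, hM, hS, hct, fun s => G.per _ (hS _ (clp_mem hT0 s)),
    fun s => bd _ (hS _ (clp_mem hT0 s)), fun s => Fop_mean hV hVper hc (hS _ (clp_mem hT0 s)), ?_⟩
  have main : ∀ s ∈ Icc 0 T, ∀ t ∈ Icc 0 T, s ≤ t → ∀ y, |Fop V (ψ t) y - Fop V (ψ s) y| ≤ L * (E0 + P0 + E1 + P1) * |t - s| ^ ν := by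
    intro s hs t ht hst y
    have := key s (t - s) hs.1 (by linarith) (by linarith [ht.2])
    rw [add_sub_cancel] at this
    have := lip _ (hS t ht) _ (hS s hs) _ this y
    rw [abs_of_nonneg (by linarith : 0 ≤ t - s)]
    rwa [mul_assoc]
  intro s hs t ht y
  rw [clp_id hs, clp_id ht]
  rcases le_total s t with h | h
  · rw [abs_sub_comm, abs_sub_comm s t]; exact main s hs t ht h y
  · exact main t ht s hs h y

lemma cnv_per {m : ℕ} {k g : Spc m → ℝ} (hg : IsPeriodic g) : IsPeriodic (cnv k g) := fun x i j => by
  show cnv k g (x + zv i j) = cnv k g x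
  unfold cnv
  rw [← integral_add_right_eq_self (fun y => g y • k (x + zv i j - y)) (zv i j)]
  simp only [add_sub_add_right_eq_sub, per_zv hg]

lemma Duh_per {m : ℕ} {k g : ℝ → Spc m → ℝ} {t : ℝ} (hg : ∀ s, IsPeriodic (g s)) : IsPeriodic (Duh k g t) := fun x i j => by
  unfold Duh
  simp only [cnv_per (hg _) x i j]

lemma cnv_mean {m : ℕ} {k g : Spc m → ℝ} (hk : Integrable k) (hgm : Measurable g) (hg : IsPeriodic g) {M : ℝ} (hM : ∀ x, |g x| ≤ M)
    (h0 : ∫ x in cube m, g x = 0) : ∫ x in cube m, cnv k g x = 0 := by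
  have e : ∀ x, cnv k g x = ∫ z, g (x - z) * k z := fun x => by
    unfold cnv
    rw [← integral_sub_left_eq_self (fun z => g (x - z) * k z) volume x]; simp
  simp only [e]
  have hi : Integrable (Function.uncurry fun x z => g (x - z) * k z) ((μT m).prod volume) := by
    refine Integrable.mono' (g := fun q : Spc m × Spc m => M * ‖k q.2‖) ((integrable_const M).mul_prod hk.norm) ?_ (Eventually.of_forall fun q => ?_)
    · exact (hgm.comp (measurable_fst.sub measurable_snd)).aestronglyMeasurable.mul hk.aestronglyMeasurable.comp_snd
    · show ‖g (q.1 - q.2) * k q.2‖ ≤ _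
      rw [norm_mul]
      exact mul_le_mul_of_nonneg_right (hM _) (norm_nonneg _)
  have sw := integral_integral_swap hi
  unfold μT at sw
  rw [sw]
  have : ∀ z, ∫ x in cube m, g (x - z) * k z = 0 := fun z => by
    rw [integral_mul_const, int_trans' hg, h0, zero_mul]
  simp [this]

lemma Duh_mean {m : ℕ} {k g : ℝ → Spc m → ℝ} {C t H ν : ℝ} (hk : KFam k 0 C) (hC : 0 ≤ C) (hν : 0 ≤ ν) (hs : Src g t H ν)
    (hg : ∀ s, IsPeriodic (g s)) (h0 : ∀ s, ∫ x in cube m, g s x = 0) :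
    ∫ x in cube m, Duh k g t x = 0 := by
  unfold Duh
  have hH := hs.nn
  have hi : Integrable (Function.uncurry fun x s => cnv (k (t - s)) (g s) x) ((μT m).prod (volume.restrict (Ioo 0 t))) := by
    refine Integrable.mono' (integrable_const (H * C * t ^ ν)) ?_ ?_
    · refine StronglyMeasurable.aestronglyMeasurable ?_
      show StronglyMeasurable fun q : Spc m × ℝ => ∫ y, g q.2 y • k (t - q.2) (q.1 - y)
      refine StronglyMeasurable.integral_prod_right (f := fun (q : Spc m × ℝ) y => g q.2 y • k (t - q.2) (q.1 - y)) ?_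
      refine StronglyMeasurable.smul (hs.meas.comp (g := fun q : ℝ × Spc m => g q.1 q.2) (f := fun q : (Spc m × ℝ) × Spc m => (q.1.2, q.2)) (by fun_prop)).stronglyMeasurable ?_
      exact hk.meas.comp_measurable (g := fun q : (Spc m × ℝ) × Spc m => (t - q.1.2, q.1.1 - q.2)) (by fun_prop)
    · have : ∀ᵐ q : Spc m × ℝ ∂(μT m).prod (volume.restrict (Ioo 0 t)), q.2 ∈ Ioo 0 t :=
        Measure.quasiMeasurePreserving_snd.ae (ae_restrict_mem measurableSet_Ioo)
      filter_upwards [this] with q hq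
      refine (Duh_bd hk hs q.1 hq).trans ?_
      rw [sub_zero]
      exact mul_le_mul_of_nonneg_left (Real.rpow_le_rpow (by linarith [hq.2]) (by linarith [hq.1]) hν) (by positivity)
  have sw := integral_integral_swap hi
  unfold μT at sw
  rw [sw]
  refine setIntegral_eq_zero_of_forall_eq_zero fun s hs' => ?_
  exact cnv_mean (hk.int _ (by linarith [hs'.2])) (hs.meas' s) (hg s) (hs.bd s hs') (h0 s)

lemma pd_pd {m : ℕ} {w : Spc m → ℝ} {D1 : Spc m → Spc m →L[ℝ] ℝ} {D2 : Spc m → Spc m →L[ℝ] Spc m →L[ℝ] ℝ}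
    (h1 : ∀ x, HasFDerivAt w (D1 x) x) (h2 : ∀ x, HasFDerivAt D1 (D2 x) x) (v x : Spc m) :
    pd v (pd v w) x = D2 x v v := by
  have e : pd v w = fun z => D1 z v := funext fun z => by unfold pd; rw [(h1 z).fderiv]
  unfold pd at e ⊢
  rw [e]
  have : HasFDerivAt (fun z => D1 z v) ((ContinuousLinearMap.apply ℝ ℝ v).comp (D2 x)) x :=
    (ContinuousLinearMap.apply ℝ ℝ v).hasFDerivAt.comp x (h2 x)
  rw [this.fderiv]
  rfl

def ce (m : ℕ) : ℝ := ‖e1 m‖ * ‖e1 m‖ + ∑ i, ‖eC m i‖ * ‖eC m i‖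
lemma ce_nn (m : ℕ) : 0 ≤ ce m := by unfold ce; positivity

lemma op2 {m : ℕ} (D : Spc m →L[ℝ] Spc m →L[ℝ] ℝ) (v : Spc m) : |D v v| ≤ ‖D‖ * (‖v‖ * ‖v‖) := by
  have := D.le_opNorm₂ v v
  rwa [mul_assoc] at this

lemma lap_diff {m : ℕ} {w w' : Spc m → ℝ} {D1 D1' : Spc m → Spc m →L[ℝ] ℝ} {D2 D2' : Spc m → Spc m →L[ℝ] Spc m →L[ℝ] ℝ}
    (h1 : ∀ x, HasFDerivAt w (D1 x) x) (h2 : ∀ x, HasFDerivAt D1 (D2 x) x)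
    (h1' : ∀ x, HasFDerivAt w' (D1' x) x) (h2' : ∀ x, HasFDerivAt D1' (D2' x) x) (x : Spc m) :
    |lap w x - lap w' x| ≤ ce m * ‖D2 x - D2' x‖ := by
  unfold lap
  simp only [pd_pd h1 h2, pd_pd h1' h2']
  have e : ∀ v, D2 x v v - D2' x v v = (D2 x - D2' x) v v := fun v => rfl
  rw [add_sub_add_comm, ← Finset.sum_sub_distrib]
  simp only [e]
  refine (abs_add_le _ _).trans ?_
  have := Finset.abs_sum_le_sum_abs (fun i => (D2 x - D2' x) (eC m i) (eC m i)) Finset.univ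
  have h3 : ∑ i, |(D2 x - D2' x) (eC m i) (eC m i)| ≤ ∑ i, ‖D2 x - D2' x‖ * (‖eC m i‖ * ‖eC m i‖) :=
    Finset.sum_le_sum fun i _ => op2 _ _
  rw [← Finset.mul_sum] at h3
  have h4 := op2 (D2 x - D2' x) (e1 m)
  unfold ce
  rw [add_mul, mul_comm, mul_comm (∑ i, ‖eC m i‖ * ‖eC m i‖)]
  linarith

lemma eLp_bd {m : ℕ} {f : Spc m → ℝ} {C : ℝ} (h : ∀ x, |f x| ≤ C) (p : ℝ≥0∞) : eLpNorm f p (μT m) ≤ ENNReal.ofReal C := by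
  refine (eLpNorm_le_of_ae_bound (Eventually.of_forall h)).trans (le_of_eq ?_)
  simp

lemma W2 {m : ℕ} {w : Spc m → ℝ} {D1 : Spc m → Spc m →L[ℝ] ℝ} {D2 : Spc m → Spc m →L[ℝ] Spc m →L[ℝ] ℝ}
    (hp : IsPeriodic w)
    (h1 : ∀ x, HasFDerivAt w (D1 x) x) (h2 : ∀ x, HasFDerivAt D1 (D2 x) x) {A0 A1 A2 : ℝ}
    (b0 : ∀ x, |w x| ≤ A0) (b1 : ∀ x, ‖D1 x‖ ≤ A1) (b2 : ∀ x, ‖D2 x‖ ≤ A2) (p : ℝ) : MemW 2 p w := by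
  have hd : Differentiable ℝ w := fun x => (h1 x).differentiableAt
  have e1 : fderiv ℝ w = D1 := funext fun x => (h1 x).fderiv
  have e2 : fderiv ℝ D1 = D2 := funext fun x => (h2 x).fderiv
  have n2 : ∀ x, ‖iteratedFDeriv ℝ 2 w x‖ ≤ A2 := fun x => by
    have := norm_iteratedFDeriv_fderiv (𝕜 := ℝ) (f := w) (n := 1) (x := x)
    rw [← this, norm_iteratedFDeriv_one, e1, e2]
    exact b2 x
  refine ⟨hp, hd.continuous.measurable, fun _ => hd, fun _ => ?_, ?_⟩
  · show Differentiable ℝ (fderiv ℝ w)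
    rw [e1]; exact fun x => (h2 x).differentiableAt
  · unfold WNorm LpN
    rw [if_neg (by norm_num), if_neg (by norm_num), if_neg (by norm_num)]
    refine ENNReal.add_lt_top.2 ⟨ENNReal.add_lt_top.2 ⟨?_, ?_⟩, ?_⟩
    · exact (eLp_bd b0 _).trans_lt ENNReal.ofReal_lt_top
    · refine (eLp_bd (C := A1) (fun x => ?_) _).trans_lt ENNReal.ofReal_lt_top
      rw [abs_norm]; show ‖fderiv ℝ w x‖ ≤ _; rw [e1]; exact b1 x
    · refine (eLp_bd (C := A2) (fun x => ?_) _).trans_lt ENNReal.ofReal_lt_top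
      rw [abs_norm]; exact n2 x

section
variable {m : ℕ} {V : Spc m → ℝ} {ψ : ℝ → Spc m → ℝ} {T B c M H ν : ℝ}

def gs (V : Spc m → ℝ) (ψ : ℝ → Spc m → ℝ) (T t : ℝ) (s : ℝ) (y : Spc m) : ℝ :=
  Fop V (ψ (clp T s)) y - Fop V (ψ (clp T t)) y

lemma v1_eq (β : ℝ) {t : ℝ} (ht : t ∈ Icc 0 T) : v1 V β ψ t = Duh (fun τ => gk (τ / β)) (gs V ψ T t) t := by
  funext x
  refine heat_Duh _ _ (fun s h => ?_) x
  unfold gs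
  rw [clp_id ht, clp_id ⟨h.1.le, h.2.le.trans ht.2⟩]

lemma Dat.src (D : Dat V ψ T B c M H ν) {t : ℝ} (ht : t ∈ Icc 0 T) : Src (gs V ψ T t) t H ν := by
  refine ⟨?_, D.H0, fun s hs y => ?_⟩
  · refine Continuous.measurable ?_
    exact D.ct.sub (D.ct.comp (by fun_prop : Continuous fun q : ℝ × Spc m => (t, q.2)))
  · have := D.hol s ⟨hs.1.le, hs.2.le.trans ht.2⟩ t ht y
    rwa [abs_sub_comm s t, abs_of_nonneg (by linarith [hs.2] : 0 ≤ t - s)] at this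

lemma Dat.gper (D : Dat V ψ T B c M H ν) (t s : ℝ) : IsPeriodic (gs V ψ T t s) := fun x k j => by
  unfold gs
  rw [D.per s x k j, D.per t x k j]

lemma Dat.fint (D : Dat V ψ T B c M H ν) (s : ℝ) : IntegrableOn (Fop V (ψ (clp T s))) (cube m) := by
  have : Integrable (Fop V (ψ (clp T s))) (μT m) :=
    Integrable.of_bound (C := M) (D.ct.comp (by fun_prop : Continuous fun y : Spc m => (s, y))).aestronglyMeasurable
      (Eventually.of_forall (D.bd s))
  exact this

lemma Dat.gmean (D : Dat V ψ T B c M H ν) (t s : ℝ) : ∫ x in cube m, gs V ψ T t s x = 0 := by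
  unfold gs
  rw [integral_sub (D.fint s) (D.fint t), D.mean, D.mean, sub_zero]

lemma Dat.d1 (D : Dat V ψ T B c M H ν) {β : ℝ} (hβ : 0 < β) (hν : 0 < ν) {t : ℝ} (ht : t ∈ Icc 0 T) (x : Spc m) :
    HasFDerivAt (v1 V β ψ t) (Duh (fun τ => gk1 (τ / β)) (gs V ψ T t) t x) x := by
  obtain ⟨C0, hC0, k0⟩ := kfam0 (m := m)
  obtain ⟨D0, hD0, k0⟩ := k0.scale hC0 hβ
  obtain ⟨C1, hC1, k1⟩ := kfam1 (m := m)
  obtain ⟨D1, hD1, k1⟩ := k1.scale hC1 hβ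
  rw [v1_eq β ht]
  exact hasFDerivAt_Duh k0 k1 (fun τ hτ z => hasFDerivAt_gk (by positivity) z) ht.1 (D.src ht) (by linarith) (by linarith) x

lemma Dat.d2 (D : Dat V ψ T B c M H ν) {β : ℝ} (hβ : 0 < β) (hν : 0 < ν) {t : ℝ} (ht : t ∈ Icc 0 T) (x : Spc m) :
    HasFDerivAt (Duh (fun τ => gk1 (τ / β)) (gs V ψ T t) t) (Duh (fun τ => gk2 (τ / β)) (gs V ψ T t) t x) x := by
  obtain ⟨C1, hC1, k1⟩ := kfam1 (m := m)
  obtain ⟨D1, hD1, k1⟩ := k1.scale hC1 hβ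
  obtain ⟨C2, hC2, k2⟩ := kfam2 (m := m)
  obtain ⟨D2, hD2, k2⟩ := k2.scale hC2 hβ
  exact hasFDerivAt_Duh (E := Spc m →L[ℝ] ℝ) k1 k2 (fun τ hτ z => hasFDerivAt_gk1 (by positivity) z) ht.1 (D.src ht) (by linarith) (by linarith) x

lemma Dat.part1 (D : Dat V ψ T B c M H ν) {β : ℝ} (hβ : 0 < β) (hν : 0 < ν) (p : ℝ) {t : ℝ} (ht : t ∈ Icc 0 T) :
    MemW 2 p (v1 V β ψ t) ∧ ∫ x in cube m, v1 V β ψ t x = 0 := by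
  obtain ⟨C0, hC0, k0⟩ := kfam0 (m := m)
  obtain ⟨D0, hD0, k0⟩ := k0.scale hC0 hβ
  obtain ⟨C1, hC1, k1⟩ := kfam1 (m := m)
  obtain ⟨D1, hD1, k1⟩ := k1.scale hC1 hβ
  obtain ⟨C2, hC2, k2⟩ := kfam2 (m := m)
  obtain ⟨D2, hD2, k2⟩ := k2.scale hC2 hβ
  constructor
  · have hb0 : ∀ x, |v1 V β ψ t x| ≤ H * D0 * (t ^ (ν - 0 + 1) / (ν - 0 + 1)) := fun x => by
      rw [v1_eq β ht]; exact Duh_norm_le k0 ht.1 (D.src ht) (by linarith) x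
    refine W2 ?_ (D.d1 hβ hν ht) (D.d2 hβ hν ht) hb0
      (fun x => Duh_norm_le k1 ht.1 (D.src ht) (by linarith) x)
      (fun x => Duh_norm_le (E := Spc m →L[ℝ] Spc m →L[ℝ] ℝ) k2 ht.1 (D.src ht) (by linarith) x) p
    rw [v1_eq β ht]; exact Duh_per (D.gper t)
  · rw [v1_eq β ht]
    exact Duh_mean k0 hD0 hν.le (D.src ht) (D.gper t) (D.gmean t)

lemma Dat.part2 (D : Dat V ψ T B c M H ν) {β : ℝ} (hβ : 0 < β) (hν : 0 < ν) (hν1 : ν ≤ 1) (p : ℝ) {ε : ℝ} (hε : 0 < ε) (hεν : ε < ν) :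
    HolderW (ν - ε) 0 p (Icc 0 T) (fun t x => -(β⁻¹ * lap (v1 V β ψ t) x)) := by
  obtain ⟨C2, hC2, k2⟩ := kfam2 (m := m)
  obtain ⟨D2, hD2, k2⟩ := k2.scale hC2 hβ
  set P := 2 * (2 * (D2 * H)) * T ^ ε / ε
  have key : ∀ t ∈ Icc 0 T, ∀ t' ∈ Icc 0 T, t ≤ t' → ∀ x, |lap (v1 V β ψ t') x - lap (v1 V β ψ t) x| ≤ ce m * (P * |t' - t| ^ (ν - ε)) := by
    intro t ht t' ht' hle x
    refine (lap_diff (D.d1 hβ hν ht') (D.d2 hβ hν ht') (D.d1 hβ hν ht) (D.d2 hβ hν ht) x).trans (mul_le_mul_of_nonneg_left ?_ (ce_nn m))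
    rw [abs_of_nonneg (by linarith)]
    have := Duh_holder1 (E := Spc m →L[ℝ] Spc m →L[ℝ] ℝ) k2 hD2 hε hεν hν1 D.H0 D.ct.measurable D.hol (t := t) (h := t' - t) ht.1 (by linarith) (by linarith [ht'.2]) x
    rw [add_sub_cancel] at this
    exact this
  refine ⟨β⁻¹ * (ce m * P), fun t ht t' ht' => ?_⟩
  unfold WNorm LpN
  rw [if_pos le_rfl]
  refine eLp_bd (fun x => ?_) _
  have e : -(β⁻¹ * lap (v1 V β ψ t') x) - -(β⁻¹ * lap (v1 V β ψ t) x) = β⁻¹ * -(lap (v1 V β ψ t') x - lap (v1 V β ψ t) x) := by ring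
  rw [e, abs_mul, abs_neg, abs_of_pos (inv_pos.2 hβ), mul_assoc, mul_assoc]
  refine mul_le_mul_of_nonneg_left ?_ (inv_pos.2 hβ).le
  rcases le_total t t' with h | h
  · exact key t ht t' ht' h x
  · rw [abs_sub_comm, abs_sub_comm t' t]; exact key t' ht' t ht h x
end

/-- **Lemma `v1lp`.** Assume `[H₁]`, `[H₂]`, and let `ψ` be the maximal mild solution. Then
`v₁(t) := ∫₀ᵗ e^{−(t−s)A_p}(F(ψ(s)) − F(ψ(t))) ds ∈ D(A_p) = W^{2,p} ∩ L^p₀` for every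
`t ∈ [0,T_max)`, and `A_p v₁ = −β⁻¹Δv₁ ∈ C^{ν−ε}_loc([0,T_max), L^p(𝕋ⁿ))` for every
`ε ∈ (0,ν)`, where `ν := min(1 − σ/2, σ/2 − 1/2 − n/(2p))` (`n = m + 1`). -/
theorem v1_in_domain_and_holder
    (m : ℕ) (V : Spc m → ℝ) (β σ p : ℝ) (ψ0 : Spc m → ℝ)
    (Tmax : ℝ≥0∞) (ψ : ℝ → Spc m → ℝ)
    (hV : ContDiff ℝ 2 V) (hVper : IsPeriodic V) (hβ : 0 < β)
    (h1 : Hyp1 σ p ψ0) (h2 : Hyp2 m σ p)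
    (hψ : IsMaximalMildSolution V β σ p ψ0 Tmax ψ) :
    (∀ t ∈ Ico0 Tmax, MemW 2 p (v1 V β ψ t) ∧ (∫ x in cube m, v1 V β ψ t x) = 0) ∧
    ∀ ε : ℝ, 0 < ε → ε < min (1 - σ / 2) (σ / 2 - 1 / 2 - ((m : ℝ) + 1) / (2 * p)) →
      ∀ T : ℝ, 0 ≤ T → ENNReal.ofReal T < Tmax →
        HolderW (min (1 - σ / 2) (σ / 2 - 1 / 2 - ((m : ℝ) + 1) / (2 * p)) - ε) 0 p
          (Set.Icc 0 T) (fun t x => -(β⁻¹ * lap (v1 V β ψ t) x)) := by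
  obtain ⟨hp, hσ, hα⟩ := hyp2_p h2
  have hp0 : 0 < p := by linarith
  have e : σ / 2 - 1 / 2 - ((m : ℝ) + 1) / (2 * p) = (σ - 1 - ((m:ℝ) + 1) / p) / 2 := by
    field_simp
  have hν : 0 < min (1 - σ / 2) (σ / 2 - 1 / 2 - ((m : ℝ) + 1) / (2 * p)) := by
    refine lt_min (by linarith [h2.2.2.2]) ?_
    rw [e]; linarith
  have hνα : min (1 - σ / 2) (σ / 2 - 1 / 2 - ((m : ℝ) + 1) / (2 * p)) ≤ (σ - 1 - ((m:ℝ) + 1) / p) / 2 := by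
    rw [← e]; exact min_le_right _ _
  have hν1 : min (1 - σ / 2) (σ / 2 - 1 / 2 - ((m : ℝ) + 1) / (2 * p)) ≤ 1 :=
    (min_le_left _ _).trans (by linarith)
  refine ⟨fun t ht => ?_, fun ε hε hεν T hT0 hT => ?_⟩
  · obtain ⟨B, c, M, H, D⟩ := get_dat hV hVper hβ h1 h2 hψ.1 ht.1 ht.2 hν hνα
    exact D.part1 hβ hν p ⟨ht.1, le_rfl⟩
  · obtain ⟨B, c, M, H, D⟩ := get_dat hV hVper hβ h1 h2 hψ.1 hT0 hT hν hνα
    exact D.part2 hβ hν hν1 p hε hεν
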